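/- Let α be a positive algebraic irrational real number and let b ≥ 2 be an integer. Then α is normal to base b if and only if for every integer k ≥ 0, lim_{N→∞} (1/log N) · Σ_{1 ≤ |n| ≤ N} ζ(−k + 2πin/log b) · e^{2πin·log α/log b}/n^{k+1} = 0. -/

import Mathlib

/-- `digitCount b x a l` is the number of indices `i ∈ [0, l]` such that the `i`-th digit
`c_i = ⌊x·b^i⌋ mod b` of the `b`-adic expansion of `x` equals `a`. -/
noncomputable def digitCount (b : ℕ) (x : ℝ) (a : ℕ) (l : ℕ) : ℕ :=
  ((Finset.range (l + 1)).filter fun i => ⌊x * (b : ℝ) ^ i⌋ % (b : ℤ) = (a : ℤ)).card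

/-- `x` is simply normal to base `b`: every digit `a ∈ {0,…,b-1}` appears with
asymptotic frequency `1/b`. -/
def SimplyNormal (b : ℕ) (x : ℝ) : Prop :=
  ∀ a : ℕ, a < b →
    Filter.Tendsto (fun l : ℕ => (digitCount b x a l : ℝ) / l) Filter.atTop (nhds (1 / b))

/-- `x` is normal to base `b`: `x` is simply normal to base `b^k` for every `k ≥ 1`. -/
def NormalToBase (b : ℕ) (x : ℝ) : Prop :=
  ∀ k : ℕ, 0 < k → SimplyNormal (b ^ k) x

section
open MeasureTheory
open Set hiding range pi
open Real (exp log sqrt sin cos pi)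
open Finset (range)
open Complex (I)

lemma osc (φ φ1 φ2 w w' : ℝ → ℝ) (a c μ : ℝ) (hac : a ≤ c)
    (hφ : ∀ u, HasDerivAt φ (φ1 u) u) (hφ1 : ∀ u, HasDerivAt φ1 (φ2 u) u) (hφ2 : Continuous φ2)
    (hpos : ∀ u, 0 ≤ φ2 u)
    (hw : ∀ u ∈ Icc a c, HasDerivAt w (w' u) u) (hw' : ContinuousOn w' (Icc a c))
    (hneg : ∀ u ∈ Icc a c, w' u ≤ 0) (hnn : ∀ u ∈ Icc a c, 0 ≤ w u) (hμ : 0 < μ)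
    (hcase : (∀ u ∈ Icc a c, μ ≤ φ1 u) ∨ (∀ u ∈ Icc a c, φ1 u ≤ -μ)) :
    ‖∫ u in a..c, (w u : ℂ) * Complex.exp (φ u * I)‖ ≤ 4 * w a / μ := by
  have hu : uIcc a c = Icc a c := uIcc_of_le hac
  have ha : a ∈ Icc a c := ⟨le_rfl, hac⟩
  have hc : c ∈ Icc a c := ⟨hac, le_rfl⟩
  have habs : ∀ u ∈ Icc a c, μ ≤ |φ1 u| := by
    intro u hu
    rcases hcase with h | h
    · exact (h u hu).trans (le_abs_self _)
    · have := h u hu; rw [abs_of_nonpos (by linarith)]; linarith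
  have hne : ∀ u ∈ Icc a c, φ1 u ≠ 0 := by
    intro u hu h0
    have := habs u hu
    rw [h0] at this; simp at this; linarith
  have hφc : Continuous φ := continuous_iff_continuousAt.2 fun u => (hφ u).continuousAt
  have hφ1c : Continuous φ1 := continuous_iff_continuousAt.2 fun u => (hφ1 u).continuousAt
  have hwc : ContinuousOn w (Icc a c) := fun u hu => (hw u hu).continuousAt.continuousWithinAt
  have hwa : ∀ u ∈ Icc a c, w u ≤ w a := by
    have hanti : AntitoneOn w (Icc a c) := by
      apply antitoneOn_of_deriv_nonpos (convex_Icc a c) hwc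
      · intro u hu; exact (hw u (interior_subset hu)).differentiableAt.differentiableWithinAt
      · intro u hu; rw [(hw u (interior_subset hu)).deriv]; exact hneg u (interior_subset hu)
    intro u hu; exact hanti ha hu hu.1
  set g : ℝ → ℂ := fun u => ((w u / φ1 u : ℝ) : ℂ) with hg
  set g' : ℝ → ℂ := fun u => (((w' u * φ1 u - w u * φ2 u) / (φ1 u)^2 : ℝ) : ℂ) with hg'
  set v : ℝ → ℂ := fun u => -I * Complex.exp (φ u * I) with hv
  set v' : ℝ → ℂ := fun u => (φ1 u : ℂ) * Complex.exp (φ u * I) with hv'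
  have hgd : ∀ u ∈ uIcc a c, HasDerivAt g (g' u) u := by
    intro u huu; rw [hu] at huu
    exact ((hw u huu).div (hφ1 u) (hne u huu)).ofReal_comp
  have hvd : ∀ u ∈ uIcc a c, HasDerivAt v (v' u) u := by
    intro u huu
    have h1 : HasDerivAt (fun u => (φ u : ℂ) * I) ((φ1 u : ℂ) * I) u :=
      ((hφ u).ofReal_comp).mul_const _
    have h2 := (h1.cexp).const_mul (-I)
    refine h2.congr_deriv ?_
    simp only [hv']
    linear_combination (-(φ1 u:ℂ) * Complex.exp (φ u * I)) * Complex.I_mul_I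
  have hg'c : ContinuousOn g' (Icc a c) := by
    apply Complex.continuous_ofReal.comp_continuousOn
    apply ContinuousOn.div
    · exact (hw'.mul hφ1c.continuousOn).sub (hwc.mul hφ2.continuousOn)
    · exact (hφ1c.pow 2).continuousOn
    · intro u hu; exact pow_ne_zero 2 (hne u hu)
  have hv'c : Continuous v' := by
    simp only [hv']; fun_prop
  have hvc : Continuous v := by
    simp only [hv]; fun_prop
  have key := intervalIntegral.integral_mul_deriv_eq_deriv_mul hgd hvd
    (by rw [← hu] at hg'c; exact hg'c.intervalIntegrable) (hv'c.intervalIntegrable _ _)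
  have e1 : ∫ u in a..c, (w u : ℂ) * Complex.exp (φ u * I) = ∫ u in a..c, g u * v' u := by
    apply intervalIntegral.integral_congr
    intro u huu; rw [hu] at huu
    have := hne u huu
    simp only [hg, hv']
    push_cast
    have h2 : (φ1 u : ℂ) ≠ 0 := by exact_mod_cast this
    field_simp
  rw [e1, key]
  have hvn : ∀ u, ‖v u‖ = 1 := by
    intro u; simp only [hv]; rw [norm_mul, Complex.norm_exp_ofReal_mul_I]; simp
  have hgn : ∀ u ∈ Icc a c, ‖g u‖ ≤ w a / μ := by
    intro u huu
    simp only [hg]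
    rw [Complex.norm_real, Real.norm_eq_abs, abs_div, abs_of_nonneg (hnn u huu)]
    have := habs u huu
    have h3 := hwa u huu
    have h4 := hnn u huu
    have h5 := hnn a ha
    gcongr
  set G : ℝ → ℝ := fun u => - w' u / μ + w a * (φ2 u / (φ1 u)^2) with hG
  have hGc : ContinuousOn G (Icc a c) := by
    apply ContinuousOn.add
    · exact (hw'.neg).div_const _
    · apply continuousOn_const.mul
      apply hφ2.continuousOn.div (hφ1c.pow 2).continuousOn
      intro u hu; exact pow_ne_zero 2 (hne u hu)
  have hGi : ∫ u in a..c, G u = (-w c / μ - w a / φ1 c) - (-w a/μ - w a / φ1 a) := by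
    apply intervalIntegral.integral_eq_sub_of_hasDerivAt (f := fun u => -w u / μ - w a / φ1 u)
    · intro u huu; rw [hu] at huu
      have h1 := ((hw u huu).neg.div_const μ).sub ((hasDerivAt_const u (w a)).div (hφ1 u) (hne u huu))
      refine h1.congr_deriv ?_
      simp only [hG]
      have := hne u huu
      field_simp
      ring
    · rw [← hu] at hGc; exact hGc.intervalIntegrable
  have hbd : ‖∫ u in a..c, g' u * v u‖ ≤ ∫ u in a..c, G u := by
    apply intervalIntegral.norm_integral_le_of_norm_le hac
    · refine Filter.Eventually.of_forall fun u huu => ?_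
      have huu : u ∈ Icc a c := ⟨huu.1.le, huu.2⟩
      rw [norm_mul, hvn, mul_one]
      simp only [hg', hG]
      rw [Complex.norm_real, Real.norm_eq_abs]
      have h0 := hne u huu
      have e : (w' u * φ1 u - w u * φ2 u) / (φ1 u)^2 = w' u / φ1 u - w u * (φ2 u / (φ1 u)^2) := by
        field_simp
      rw [e]
      refine (abs_sub _ _).trans (add_le_add ?_ ?_)
      · rw [abs_div, abs_of_nonpos (hneg u huu)]
        have := habs u huu
        have := hneg u huu
        have : 0 ≤ - w' u := by linarith
        gcongr
      · have h5 : 0 ≤ φ2 u / (φ1 u)^2 := div_nonneg (hpos u) (sq_nonneg _)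
        rw [abs_of_nonneg (mul_nonneg (hnn u huu) h5)]
        have := hwa u huu
        gcongr
    · rw [← hu] at hGc; exact hGc.intervalIntegrable
  have hlast : w a / φ1 a - w a / φ1 c ≤ w a / μ := by
    have hwa0 := hnn a ha
    rcases hcase with h | h
    · have h1 := h a ha
      have h2 := h c hc
      have : 0 ≤ w a / φ1 c := div_nonneg hwa0 (by linarith)
      have : w a / φ1 a ≤ w a / μ := by gcongr
      linarith
    · have h1 := h a ha
      have h2 := h c hc
      have : w a / φ1 a ≤ 0 := div_nonpos_of_nonneg_of_nonpos hwa0 (by linarith)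
      have : w a / (-φ1 c) ≤ w a / μ := by
        have : μ ≤ -φ1 c := by linarith
        gcongr
      rw [div_neg] at this
      linarith
  have hwc0 := hnn c hc
  have hwcm : 0 ≤ w c / μ := by positivity
  calc ‖g c * v c - g a * v a - ∫ u in a..c, g' u * v u‖
      ≤ ‖g c‖ * ‖v c‖ + ‖g a‖ * ‖v a‖ + ‖∫ u in a..c, g' u * v u‖ := by
        rw [← norm_mul, ← norm_mul]
        exact (norm_sub_le _ _).trans (add_le_add (norm_sub_le _ _) le_rfl)
    _ ≤ w a / μ + w a / μ + ((-w c / μ - w a / φ1 c) - (-w a/μ - w a / φ1 a)) := by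
        rw [hvn, hvn, mul_one, mul_one, ← hGi]
        exact add_le_add (add_le_add (hgn c hc) (hgn a ha)) hbd
    _ ≤ 4 * w a / μ := by
        have : 4 * w a / μ = 4 * (w a / μ) := by ring
        rw [this, neg_div, neg_div]; linarith

lemma split_mono (g : ℝ → ℝ) (hg : Continuous g) (hm : Monotone g) (a c y : ℝ) (hac : a ≤ c) :
    ∃ p ∈ Icc a c, (p = a ∨ ∀ u ∈ Icc a p, g u ≤ y) ∧ (p = c ∨ ∀ u ∈ Icc p c, y ≤ g u) := by
  rcases le_total y (g a) with h | h
  · exact ⟨a, ⟨le_rfl, hac⟩, Or.inl rfl, Or.inr fun u hu => h.trans (hm hu.1)⟩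
  rcases le_total (g c) y with h' | h'
  · exact ⟨c, ⟨hac, le_rfl⟩, Or.inr fun u hu => (hm hu.2).trans h', Or.inl rfl⟩
  obtain ⟨p, hp, rfl⟩ := intermediate_value_Icc hac hg.continuousOn ⟨h, h'⟩
  exact ⟨p, hp, Or.inr fun u hu => hm hu.2, Or.inr fun u hu => hm hu.1⟩

lemma vdc (φ φ1 φ2 w w' : ℝ → ℝ) (a c μ κ : ℝ) (hac : a ≤ c)
    (hφ : ∀ u, HasDerivAt φ (φ1 u) u) (hφ1 : ∀ u, HasDerivAt φ1 (φ2 u) u) (hφ2 : Continuous φ2)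
    (hpos : ∀ u, 0 ≤ φ2 u)
    (hw : ∀ u ∈ Icc a c, HasDerivAt w (w' u) u) (hw' : ContinuousOn w' (Icc a c))
    (hneg : ∀ u ∈ Icc a c, w' u ≤ 0) (hnn : ∀ u ∈ Icc a c, 0 ≤ w u) (hμ : 0 < μ) (hκ : 0 < κ)
    (hst : ∀ u, |φ1 u| ≤ μ → κ ≤ φ2 u) :
    ‖∫ u in a..c, (w u : ℂ) * Complex.exp (φ u * I)‖ ≤ w a * (8 / μ + 2 * μ / κ) := by
  have hφc : Continuous φ := continuous_iff_continuousAt.2 fun u => (hφ u).continuousAt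
  have hφ1c : Continuous φ1 := continuous_iff_continuousAt.2 fun u => (hφ1 u).continuousAt
  have hm : Monotone φ1 := monotone_of_deriv_nonneg (fun u => (hφ1 u).differentiableAt)
    (fun u => by rw [(hφ1 u).deriv]; exact hpos u)
  have hwc : ContinuousOn w (Icc a c) := fun u hu => (hw u hu).continuousAt.continuousWithinAt
  have ha : a ∈ Icc a c := ⟨le_rfl, hac⟩
  have hwa : ∀ u ∈ Icc a c, w u ≤ w a := by
    have hanti : AntitoneOn w (Icc a c) := by
      apply antitoneOn_of_deriv_nonpos (convex_Icc a c) hwc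
      · intro u hu; exact (hw u (interior_subset hu)).differentiableAt.differentiableWithinAt
      · intro u hu; rw [(hw u (interior_subset hu)).deriv]; exact hneg u (interior_subset hu)
    intro u hu; exact hanti ha hu hu.1
  have hwa0 := hnn a ha
  obtain ⟨p, hp, hp1, hp2⟩ := split_mono φ1 hφ1c hm a c (-μ) hac
  obtain ⟨q, hq, hq1, hq2⟩ := split_mono φ1 hφ1c hm p c μ hp.2
  set F : ℝ → ℂ := fun u => (w u : ℂ) * Complex.exp (φ u * I) with hF
  have hFc : ContinuousOn F (Icc a c) := by
    apply (Complex.continuous_ofReal.comp_continuousOn hwc).mul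
    have : Continuous fun u => Complex.exp (φ u * I) := by fun_prop
    exact this.continuousOn
  have hFi : ∀ x ∈ Icc a c, ∀ y ∈ Icc a c, IntervalIntegrable F volume x y := by
    intro x hx y hy
    apply ContinuousOn.intervalIntegrable
    exact hFc.mono (by intro z hz; exact ⟨(le_min hx.1 hy.1).trans hz.1, hz.2.trans (max_le hx.2 hy.2)⟩)
  have hqa : q ∈ Icc a c := ⟨hp.1.trans hq.1, hq.2⟩
  have hc : c ∈ Icc a c := ⟨hac, le_rfl⟩
  have hsplit : ∫ u in a..c, F u = (∫ u in a..p, F u) + (∫ u in p..q, F u) + ∫ u in q..c, F u := by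
    rw [intervalIntegral.integral_add_adjacent_intervals (hFi a ha p hp) (hFi p hp q hqa),
      intervalIntegral.integral_add_adjacent_intervals (hFi a ha q hqa) (hFi q hqa c hc)]
  have b1 : ‖∫ u in a..p, F u‖ ≤ 4 * w a / μ := by
    rcases hp1 with h | h
    · rw [h]; simp; positivity
    · have hs : Icc a p ⊆ Icc a c := Icc_subset_Icc le_rfl hp.2
      exact osc φ φ1 φ2 w w' a p μ hp.1 hφ hφ1 hφ2 hpos (fun u hu => hw u (hs hu)) (hw'.mono hs)
        (fun u hu => hneg u (hs hu)) (fun u hu => hnn u (hs hu)) hμ (Or.inr h)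
  have b3 : ‖∫ u in q..c, F u‖ ≤ 4 * w a / μ := by
    rcases hq2 with h | h
    · rw [h]; simp; positivity
    · have hs : Icc q c ⊆ Icc a c := Icc_subset_Icc hqa.1 le_rfl
      refine (osc φ φ1 φ2 w w' q c μ hq.2 hφ hφ1 hφ2 hpos (fun u hu => hw u (hs hu)) (hw'.mono hs)
        (fun u hu => hneg u (hs hu)) (fun u hu => hnn u (hs hu)) hμ (Or.inl h)).trans ?_
      have := hwa q hqa
      gcongr
  have b2 : ‖∫ u in p..q, F u‖ ≤ w a * (2 * μ / κ) := by
    rcases hq1 with h | h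
    · rw [h]; simp; positivity
    rcases hp2 with h' | h'
    · have : q = p := le_antisymm (h' ▸ hqa.2) hq.1
      rw [this]; simp; positivity
    have hlen : κ * (q - p) ≤ 2 * μ := by
      have h1 : κ * (q - p) ≤ φ1 q - φ1 p := by
        apply (convex_Icc p q).mul_sub_le_image_sub_of_le_deriv hφ1c.continuousOn
          (fun u _ => (hφ1 u).differentiableAt.differentiableWithinAt) _ p ⟨le_rfl, hq.1⟩ q
          ⟨hq.1, le_rfl⟩ hq.1
        intro u hu
        have hu := interior_subset hu
        rw [(hφ1 u).deriv]
        apply hst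
        rw [abs_le]
        exact ⟨h' u ⟨hu.1, hu.2.trans hqa.2⟩, h u ⟨hu.1, hu.2⟩⟩
      have h2 := h' p ⟨le_rfl, hp.2⟩
      have h3 := h q ⟨hq.1, le_rfl⟩
      linarith
    have : ‖∫ u in p..q, F u‖ ≤ w a * |q - p| := by
      apply intervalIntegral.norm_integral_le_of_norm_le_const
      intro u hu
      rw [uIoc_of_le hq.1] at hu
      have hu' : u ∈ Icc a c := ⟨hp.1.trans hu.1.le, hu.2.trans hqa.2⟩
      simp only [hF]
      rw [norm_mul, Complex.norm_exp_ofReal_mul_I, mul_one, Complex.norm_real, Real.norm_eq_abs,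
        abs_of_nonneg (hnn u hu')]
      exact hwa u hu'
    refine this.trans ?_
    rw [abs_of_nonneg (by linarith [hq.1])]
    have : q - p ≤ 2 * μ / κ := by rw [le_div_iff₀ hκ]; linarith
    gcongr
  rw [hsplit]
  refine (norm_add₃_le).trans ((add_le_add (add_le_add b1 b2) b3).trans (le_of_eq ?_))
  ring

noncomputable def ee (x : ℝ) : ℂ := Complex.exp ((2 * pi * x : ℝ) * I)

noncomputable def Dk (N : ℕ) (u : ℝ) : ℝ := 1 + 2 * ∑ n ∈ range N, cos (2 * pi * (n + 1) * u)

noncomputable def nu (N : ℕ) : ℝ := (2 * N + 1) * pi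

lemma norm_ee (x : ℝ) : ‖ee x‖ = 1 := Complex.norm_exp_ofReal_mul_I _

lemma continuous_ee : Continuous ee := by unfold ee; fun_prop

lemma continuous_Dk (N : ℕ) : Continuous (Dk N) := by unfold Dk; fun_prop

lemma nu_ge (N : ℕ) : 6 * (N : ℝ) ≤ nu N := by
  unfold nu
  have := Real.pi_gt_three
  have h : (0:ℝ) ≤ N := Nat.cast_nonneg N
  nlinarith

lemma Dk_mul_sin (N : ℕ) (u : ℝ) : Dk N u * sin (pi * u) = sin (nu N * u) := by
  induction N with
  | zero => simp [Dk, nu]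
  | succ N ih =>
    have e : Dk (N+1) u = Dk N u + 2 * cos (2 * pi * (N + 1) * u) := by
      unfold Dk; rw [Finset.sum_range_succ]; ring
    rw [e, add_mul, ih]
    have e1 : nu (N+1) * u = 2 * pi * (N + 1) * u + pi * u := by
      unfold nu; push_cast; ring
    have e2 : nu N * u = 2 * pi * (N + 1) * u - pi * u := by
      unfold nu; ring
    rw [e1, e2, Real.sin_add, Real.sin_sub]; ring

lemma sin_pi_ge (u : ℝ) (h0 : 0 ≤ u) (h1 : u ≤ 1/2) : 2 * u ≤ sin (pi * u) := by
  have := Real.mul_le_sin (x := pi * u) (by positivity) (by nlinarith [Real.pi_pos])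
  have e : 2 / pi * (pi * u) = 2 * u := by field_simp
  linarith

lemma sin_pi_pos (u : ℝ) (h0 : 0 < u) (h1 : u ≤ 1/2) : 0 < sin (pi * u) := by
  linarith [sin_pi_ge u h0.le h1]

lemma Dk_eq (N : ℕ) (u : ℝ) (h0 : 0 < u) (h1 : u ≤ 1/2) :
    Dk N u = sin (nu N * u) / sin (pi * u) := by
  rw [eq_div_iff (sin_pi_pos u h0 h1).ne', Dk_mul_sin]

lemma abs_Dk_le' (N : ℕ) (u : ℝ) (h0 : 0 < u) (h1 : u ≤ 1/2) : |Dk N u| ≤ 1 / (2 * u) := by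
  rw [Dk_eq N u h0 h1, abs_div, abs_of_pos (sin_pi_pos u h0 h1)]
  have := sin_pi_ge u h0.le h1
  have := Real.abs_sin_le_one (nu N * u)
  gcongr

/-- phase derivative facts -/
lemma ph1 (L Λ τ u : ℝ) : HasDerivAt (fun u => 2 * pi * (Λ * exp (L * u)) + τ * u)
    (2 * pi * Λ * L * exp (L * u) + τ) u := by
  have h1 : HasDerivAt (fun u => exp (L * u)) (exp (L * u) * L) u := by
    have := ((hasDerivAt_id u).const_mul L).exp
    simpa using this
  have := ((h1.const_mul Λ).const_mul (2 * pi)).add ((hasDerivAt_id u).const_mul τ)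
  refine this.congr_deriv ?_
  ring

lemma ph2 (L Λ τ u : ℝ) : HasDerivAt (fun u => 2 * pi * Λ * L * exp (L * u) + τ)
    (2 * pi * Λ * L ^ 2 * exp (L * u)) u := by
  have h1 : HasDerivAt (fun u => exp (L * u)) (exp (L * u) * L) u := by
    have := ((hasDerivAt_id u).const_mul L).exp
    simpa using this
  have := (h1.const_mul (2 * pi * Λ * L)).add_const τ
  refine this.congr_deriv ?_
  ring

lemma wsin (u : ℝ) (h : sin (pi * u) ≠ 0) : HasDerivAt (fun u => 1 / sin (pi * u))
    (- (pi * cos (pi * u)) / sin (pi * u) ^ 2) u := by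
  have h1 : HasDerivAt (fun u => sin (pi * u)) (cos (pi * u) * pi) u := by
    have := ((hasDerivAt_id u).const_mul pi).sin
    simpa using this
  have := (hasDerivAt_const u (1:ℝ)).div h1 h
  refine this.congr_deriv ?_
  ring

lemma wsin_cont (δ c : ℝ) (hδ : 0 < δ) (hc : c ≤ 1/2) : ContinuousOn (fun u =>
    (- (pi * cos (pi * u)) / sin (pi * u) ^ 2)) (Icc δ c) := by
  apply ContinuousOn.div (by fun_prop) (by fun_prop)
  intro u hu
  exact pow_ne_zero 2 (sin_pi_pos u (hδ.trans_le hu.1) (hu.2.trans hc)).ne'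

lemma wsin_neg (u : ℝ) (h0 : 0 < u) (h1 : u ≤ 1/2) :
    - (pi * cos (pi * u)) / sin (pi * u) ^ 2 ≤ 0 := by
  have : 0 ≤ cos (pi * u) := Real.cos_nonneg_of_neg_pi_div_two_le_of_le
    (by nlinarith [Real.pi_pos]) (by nlinarith [Real.pi_pos])
  have hp := Real.pi_pos
  apply div_nonpos_of_nonpos_of_nonneg
  · have := mul_nonneg hp.le this; linarith
  · positivity

lemma wsin_le (δ : ℝ) (h0 : 0 < δ) (h1 : δ ≤ 1/2) : 1 / sin (pi * δ) ≤ 1 / (2 * δ) := by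
  have := sin_pi_ge δ h0.le h1
  gcongr

/-- first derivative test with sine weight -/
lemma oscsin (L Λ τ δ c μ : ℝ) (hΛ : 0 ≤ Λ) (hδ : 0 < δ) (hδc : δ ≤ c) (hc : c ≤ 1/2) (hμ : 0 < μ)
    (hcase : (∀ u ∈ Icc δ c, μ ≤ 2 * pi * Λ * L * exp (L * u) + τ) ∨
      (∀ u ∈ Icc δ c, 2 * pi * Λ * L * exp (L * u) + τ ≤ -μ)) :
    ‖∫ u in δ..c, ((1 / sin (pi * u) : ℝ) : ℂ) *
      Complex.exp ((2 * pi * (Λ * exp (L * u)) + τ * u : ℝ) * I)‖ ≤ 2 / (δ * μ) := by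
  have hp := Real.pi_pos
  have := osc _ _ _ _ _ δ c μ hδc (ph1 L Λ τ) (ph2 L Λ τ) (by fun_prop) (fun u => by positivity)
    (fun u hu => wsin u (sin_pi_pos u (hδ.trans_le hu.1) (hu.2.trans hc)).ne') (wsin_cont δ c hδ hc)
    (fun u hu => wsin_neg u (hδ.trans_le hu.1) (hu.2.trans hc))
    (fun u hu => by have := sin_pi_pos u (hδ.trans_le hu.1) (hu.2.trans hc); positivity) hμ hcase
  refine this.trans ?_
  have h2 := wsin_le δ hδ (hδc.trans hc)
  calc 4 * (1 / sin (pi * δ)) / μ ≤ 4 * (1 / (2 * δ)) / μ := by gcongr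
    _ = 2 / (δ * μ) := by field_simp; norm_num

lemma vdc_st (L Λ τ u : ℝ) (hΛ : 0 ≤ Λ) (hτ : 4 ≤ |τ|)
    (h : |2 * pi * Λ * L * exp (L * u) + τ| ≤ sqrt |τ|) :
    |L| * |τ| / 2 ≤ 2 * pi * Λ * L ^ 2 * exp (L * u) := by
  have h1 : sqrt |τ| ≤ |τ| / 2 := by
    rw [Real.sqrt_le_left (by positivity)]; nlinarith
  have h2 : |τ| - |2 * pi * Λ * L * exp (L * u)| ≤ |2 * pi * Λ * L * exp (L * u) + τ| := by
    have := abs_sub_abs_le_abs_sub τ (-(2 * pi * Λ * L * exp (L * u)))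
    rw [abs_neg, sub_neg_eq_add, add_comm τ] at this
    exact this
  have h3 : |2 * pi * Λ * L * exp (L * u)| = 2 * pi * Λ * |L| * exp (L * u) := by
    rw [abs_mul, abs_mul, abs_of_nonneg (by positivity : 0 ≤ 2 * pi * Λ), abs_of_pos (Real.exp_pos _)]
  rw [h3] at h2
  have h4 : |τ| / 2 ≤ 2 * pi * Λ * |L| * exp (L * u) := by linarith
  have h5 := mul_le_mul_of_nonneg_left h4 (abs_nonneg L)
  have h6 : |L| * (2 * pi * Λ * |L| * exp (L * u)) = 2 * pi * Λ * L ^ 2 * exp (L * u) := by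
    rw [← sq_abs L]; ring
  linarith

lemma vdc_const (L τ W : ℝ) (hL : L ≠ 0) (hτ : 4 ≤ |τ|) :
    W * (8 / sqrt |τ| + 2 * sqrt |τ| / (|L| * |τ| / 2)) = W * (8 + 4 / |L|) / sqrt |τ| := by
  have h1 : 0 < |τ| := by linarith
  have h2 : 0 < sqrt |τ| := Real.sqrt_pos.2 h1
  have h3 : 0 < |L| := abs_pos.2 hL
  have h4 : |τ| = sqrt |τ| * sqrt |τ| := (Real.mul_self_sqrt h1.le).symm
  generalize sqrt |τ| = s at *
  rw [h4]
  field_simp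
  ring

lemma vdcsin (L Λ τ δ c : ℝ) (hL : L ≠ 0) (hΛ : 0 ≤ Λ) (hδ : 0 < δ) (hδc : δ ≤ c) (hc : c ≤ 1/2) (hτ : 4 ≤ |τ|) :
    ‖∫ u in δ..c, ((1 / sin (pi * u) : ℝ) : ℂ) *
      Complex.exp ((2 * pi * (Λ * exp (L * u)) + τ * u : ℝ) * I)‖ ≤
      1 / (2 * δ) * (8 + 4 / |L|) / sqrt |τ| := by
  have hp := Real.pi_pos
  have h3 : 0 < |L| := abs_pos.2 hL
  have := vdc _ _ _ _ _ δ c (sqrt |τ|) (|L| * |τ| / 2) hδc (ph1 L Λ τ) (ph2 L Λ τ) (by fun_prop) (fun u => by positivity)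
    (fun u hu => wsin u (sin_pi_pos u (hδ.trans_le hu.1) (hu.2.trans hc)).ne') (wsin_cont δ c hδ hc)
    (fun u hu => wsin_neg u (hδ.trans_le hu.1) (hu.2.trans hc))
    (fun u hu => by have := sin_pi_pos u (hδ.trans_le hu.1) (hu.2.trans hc); positivity)
    (Real.sqrt_pos.2 (by linarith)) (by positivity) (fun u => vdc_st L Λ τ u hΛ hτ)
  refine this.trans ?_
  rw [vdc_const L τ _ hL hτ]
  have h2 := wsin_le δ hδ (hδc.trans hc)
  gcongr

lemma vdc1 (L Λ τ a c : ℝ) (hL : L ≠ 0) (hΛ : 0 ≤ Λ) (hac : a ≤ c) (hτ : 4 ≤ |τ|) :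
    ‖∫ u in a..c, Complex.exp ((2 * pi * (Λ * exp (L * u)) + τ * u : ℝ) * I)‖ ≤
      (8 + 4 / |L|) / sqrt |τ| := by
  have hp := Real.pi_pos
  have h3 : 0 < |L| := abs_pos.2 hL
  have := vdc _ _ _ (fun _ => 1) (fun _ => 0) a c (sqrt |τ|) (|L| * |τ| / 2) hac (ph1 L Λ τ) (ph2 L Λ τ) (by fun_prop) (fun u => by positivity)
    (fun u hu => hasDerivAt_const u 1) continuousOn_const (fun u hu => le_rfl) (fun u hu => zero_le_one)
    (Real.sqrt_pos.2 (by linarith)) (by positivity) (fun u => vdc_st L Λ τ u hΛ hτ)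
  rw [vdc_const L τ _ hL hτ] at this
  simpa using this

/-- sine product split -/
lemma FD_split (L Λ δ c : ℝ) (N : ℕ) (hδ : 0 < δ) (hδc : δ ≤ c) (hc : c ≤ 1/2) (B : ℝ)
    (h1 : ‖∫ u in δ..c, ((1 / sin (pi * u) : ℝ) : ℂ) *
      Complex.exp ((2 * pi * (Λ * exp (L * u)) + nu N * u : ℝ) * I)‖ ≤ B)
    (h2 : ‖∫ u in δ..c, ((1 / sin (pi * u) : ℝ) : ℂ) *
      Complex.exp ((2 * pi * (Λ * exp (L * u)) + (-nu N) * u : ℝ) * I)‖ ≤ B) :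
    ‖∫ u in δ..c, ee (Λ * exp (L * u)) * (Dk N u : ℂ)‖ ≤ B := by
  have hi : ∀ τ : ℝ, IntervalIntegrable (fun u => ((1 / sin (pi * u) : ℝ) : ℂ) *
      Complex.exp ((2 * pi * (Λ * exp (L * u)) + τ * u : ℝ) * I)) volume δ c := by
    intro τ
    apply ContinuousOn.intervalIntegrable
    rw [uIcc_of_le hδc]
    apply ContinuousOn.mul
    · apply Complex.continuous_ofReal.comp_continuousOn
      apply ContinuousOn.div (by fun_prop) (by fun_prop)
      intro u hu
      exact (sin_pi_pos u (hδ.trans_le hu.1) (hu.2.trans hc)).ne'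
    · fun_prop
  have e : ∫ u in δ..c, ee (Λ * exp (L * u)) * (Dk N u : ℂ) =
      (1 / (2 * I)) * ((∫ u in δ..c, ((1 / sin (pi * u) : ℝ) : ℂ) *
      Complex.exp ((2 * pi * (Λ * exp (L * u)) + nu N * u : ℝ) * I)) -
      ∫ u in δ..c, ((1 / sin (pi * u) : ℝ) : ℂ) *
      Complex.exp ((2 * pi * (Λ * exp (L * u)) + (-nu N) * u : ℝ) * I)) := by
    rw [← intervalIntegral.integral_sub (hi _) (hi _), ← intervalIntegral.integral_const_mul]
    apply intervalIntegral.integral_congr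
    intro u hu
    rw [uIcc_of_le hδc] at hu
    have hs := sin_pi_pos u (hδ.trans_le hu.1) (hu.2.trans hc)
    simp only
    rw [Dk_eq N u (hδ.trans_le hu.1) (hu.2.trans hc)]
    have e1 : Complex.exp ((2 * pi * (Λ * exp (L * u)) + nu N * u : ℝ) * I) =
      ee (Λ * exp (L * u)) * Complex.exp ((nu N * u : ℝ) * I) := by
      unfold ee; rw [← Complex.exp_add]; congr 1; push_cast; ring
    have e2 : Complex.exp ((2 * pi * (Λ * exp (L * u)) + (-nu N) * u : ℝ) * I) =
      ee (Λ * exp (L * u)) * Complex.exp (-((nu N * u : ℝ) * I)) := by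
      unfold ee; rw [← Complex.exp_add]; congr 1; push_cast; ring
    rw [e1, e2]
    have e3 : ((sin (nu N * u) : ℝ) : ℂ) = (Complex.exp ((nu N * u : ℝ) * I) - Complex.exp (-((nu N * u : ℝ) * I))) / (2 * I) := by
      rw [Complex.ofReal_sin, Complex.sin, ← neg_mul]
      field_simp
      rw [Complex.I_sq]; ring
    push_cast [e3]
    ring
  rw [e, norm_mul]
  have : ‖(1 / (2 * I) : ℂ)‖ = 1/2 := by simp
  rw [this]
  have := norm_sub_le (∫ u in δ..c, ((1 / sin (pi * u) : ℝ) : ℂ) *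
      Complex.exp ((2 * pi * (Λ * exp (L * u)) + nu N * u : ℝ) * I))
      (∫ u in δ..c, ((1 / sin (pi * u) : ℝ) : ℂ) *
      Complex.exp ((2 * pi * (Λ * exp (L * u)) + (-nu N) * u : ℝ) * I))
  linarith

/-- Dirichlet lemma -/
lemma dir_int (x : ℝ) (δ : ℝ) (h0 : 0 ≤ δ) (h1 : δ ≤ 1/2) :
    IntervalIntegrable (fun u => sin (x * u) / sin (pi * u)) volume 0 δ := by
  rw [intervalIntegrable_iff_integrableOn_Ioc_of_le h0]
  have hb : ∀ u ∈ Ioc 0 δ, ‖sin (x * u) / sin (pi * u)‖ ≤ |x| / 2 := by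
    intro u hu
    have h2 := sin_pi_ge u hu.1.le (hu.2.trans h1)
    have h3 := sin_pi_pos u hu.1 (hu.2.trans h1)
    rw [Real.norm_eq_abs, abs_div, abs_of_pos h3, div_le_iff₀ h3]
    have : |sin (x * u)| ≤ |x * u| := Real.abs_sin_le_abs
    rw [abs_mul, abs_of_pos hu.1] at this
    nlinarith [abs_nonneg x]
  refine Integrable.mono' (g := fun _ => |x| / 2) (integrable_const _) ?_ ?_
  · apply Measurable.aestronglyMeasurable
    exact (by fun_prop : Measurable fun u => sin (x * u)).div (by fun_prop)
  · exact (ae_restrict_iff' measurableSet_Ioc).2 (Filter.Eventually.of_forall hb)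

lemma dir_pos (x : ℝ) (δ : ℝ) (hx : 0 < x) (h0 : 0 ≤ δ) (h1 : δ ≤ 1/2) :
    |∫ u in (0:ℝ)..δ, sin (x * u) / sin (pi * u)| ≤ 5/2 := by
  have near : ∀ p, 0 ≤ p → p ≤ 1/2 → p ≤ 1/x →
      |∫ u in (0:ℝ)..p, sin (x * u) / sin (pi * u)| ≤ 1/2 := by
    intro p hp0 hp1 hp2
    have := intervalIntegral.norm_integral_le_of_norm_le_const (a := 0) (b := p) (C := x / 2)
      (f := fun u => sin (x * u) / sin (pi * u)) (by
        intro u hu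
        rw [uIoc_of_le hp0] at hu
        have h2 := sin_pi_ge u hu.1.le (hu.2.trans hp1)
        have h3 := sin_pi_pos u hu.1 (hu.2.trans hp1)
        rw [Real.norm_eq_abs, abs_div, abs_of_pos h3, div_le_iff₀ h3]
        have : |sin (x * u)| ≤ |x * u| := Real.abs_sin_le_abs
        rw [abs_mul, abs_of_pos hu.1, abs_of_pos hx] at this
        nlinarith)
    rw [Real.norm_eq_abs, sub_zero, abs_of_nonneg hp0] at this
    refine this.trans ?_
    rw [le_div_iff₀ hx] at hp2
    linarith
  rcases le_total δ (1/x) with h | h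
  · exact (near δ h0 h1 h).trans (by norm_num)
  · have hpos : 0 < 1/x := by positivity
    have hi := dir_int x δ h0 h1
    have hi1 := dir_int x (1/x) hpos.le (h.trans h1)
    rw [← intervalIntegral.integral_add_adjacent_intervals hi1 (hi1.symm.trans hi)]
    have hn := near (1/x) hpos.le (h.trans h1) le_rfl
    have ho := oscsin 0 0 x (1/x) δ x le_rfl hpos h h1 hx (Or.inl (fun u _ => by simp))
    have e : ∫ u in (1/x)..δ, sin (x * u) / sin (pi * u) =
        (∫ u in (1/x)..δ, ((1 / sin (pi * u) : ℝ) : ℂ) *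
      Complex.exp ((2 * pi * (0 * exp (0 * u)) + x * u : ℝ) * I)).im := by
      have := Complex.imCLM.intervalIntegral_comp_comm (a := 1/x) (b := δ) (μ := volume)
        (f := fun u => ((1 / sin (pi * u) : ℝ) : ℂ) *
      Complex.exp ((2 * pi * (0 * exp (0 * u)) + x * u : ℝ) * I)) (by
        apply ContinuousOn.intervalIntegrable
        rw [uIcc_of_le h]
        apply ContinuousOn.mul
        · apply Complex.continuous_ofReal.comp_continuousOn
          apply ContinuousOn.div (by fun_prop) (by fun_prop)
          intro u hu
          exact (sin_pi_pos u (hpos.trans_le hu.1) (hu.2.trans h1)).ne'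
        · fun_prop)
      rw [Complex.imCLM_apply] at this
      rw [← this]
      apply intervalIntegral.integral_congr
      intro u hu
      simp only [Complex.imCLM_apply]
      rw [Complex.im_ofReal_mul, Complex.exp_ofReal_mul_I_im]
      simp; ring
    rw [e]
    have h3 := Complex.abs_im_le_norm (∫ u in (1/x)..δ, ((1 / sin (pi * u) : ℝ) : ℂ) *
      Complex.exp ((2 * pi * (0 * exp (0 * u)) + x * u : ℝ) * I))
    have h4 : 2 / (1 / x * x) = 2 := by field_simp
    rw [h4] at ho
    refine (abs_add_le _ _).trans ?_
    linarith

lemma dirichlet (x : ℝ) (δ : ℝ) (h0 : 0 ≤ δ) (h1 : δ ≤ 1/2) :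
    |∫ u in (0:ℝ)..δ, sin (x * u) / sin (pi * u)| ≤ 5/2 := by
  rcases lt_trichotomy x 0 with hx | rfl | hx
  · have := dir_pos (-x) δ (by linarith) h0 h1
    simp only [neg_mul, Real.sin_neg, neg_div, intervalIntegral.integral_neg, abs_neg] at this
    exact this
  · simp; norm_num
  · exact dir_pos x δ hx h0 h1

lemma int_Dk_abs (N : ℕ) (δ : ℝ) (h0 : 0 ≤ δ) (h1 : δ ≤ 1/2) : |∫ u in (0:ℝ)..δ, Dk N u| ≤ 5/2 := by
  have := dirichlet (nu N) δ h0 h1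
  convert this using 2
  apply intervalIntegral.integral_congr_ae
  refine Filter.Eventually.of_forall fun u hu => ?_
  rw [uIoc_of_le h0] at hu
  exact Dk_eq N u hu.1 (hu.2.trans h1)

lemma int_Dk (N : ℕ) (x : ℝ) : ∫ u in (0:ℝ)..x, Dk N u =
    x + ∑ n ∈ range N, sin (2 * pi * (n + 1) * x) / (pi * (n + 1)) := by
  have hp := Real.pi_pos
  have : ∀ u ∈ uIcc 0 x, HasDerivAt (fun x => x + ∑ n ∈ range N, sin (2 * pi * (n + 1) * x) / (pi * (n + 1))) (Dk N u) u := by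
    intro u _
    have h1 : ∀ n ∈ range N, HasDerivAt (fun x : ℝ => sin (2 * pi * (n + 1) * x) / (pi * (n + 1)))
      (2 * cos (2 * pi * (n + 1) * u)) u := by
      intro n _
      have := (((hasDerivAt_id u).const_mul (2 * pi * ((n:ℝ) + 1))).sin).div_const (pi * ((n:ℝ) + 1))
      refine this.congr_deriv ?_
      have h2 : (n:ℝ) + 1 ≠ 0 := by positivity
      simp only [id]
      field_simp
    have := (hasDerivAt_id u).add (HasDerivAt.fun_sum h1)
    refine this.congr_deriv ?_
    unfold Dk
    rw [Finset.mul_sum]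
  rw [intervalIntegral.integral_eq_sub_of_hasDerivAt this ((continuous_Dk N).intervalIntegrable _ _)]
  simp

lemma int_Dk_half (N : ℕ) : ∫ u in (0:ℝ)..(1/2), Dk N u = 1/2 := by
  rw [int_Dk]
  simp only [add_eq_left]
  apply Finset.sum_eq_zero
  intro n _
  have : 2 * pi * ((n:ℝ) + 1) * (1/2) = ((n + 1 : ℕ) : ℝ) * pi := by push_cast; ring
  rw [this, Real.sin_nat_mul_pi]; simp

noncomputable def Psi (N : ℕ) (u : ℝ) : ℝ := ∫ v in u..(1/2), Dk N v

lemma Psi_eq (N : ℕ) (u : ℝ) : Psi N u = 1/2 - ∫ v in (0:ℝ)..u, Dk N v := by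
  have := intervalIntegral.integral_add_adjacent_intervals
    ((continuous_Dk N).intervalIntegrable 0 u) ((continuous_Dk N).intervalIntegrable (μ := volume) u (1/2))
  rw [int_Dk_half] at this
  unfold Psi; linarith

lemma Psi_deriv (N : ℕ) (u : ℝ) : HasDerivAt (Psi N) (- Dk N u) u := by
  have : Psi N = fun u => 1/2 - ∫ v in (0:ℝ)..u, Dk N v := funext (Psi_eq N)
  rw [this]
  exact (intervalIntegral.integral_hasDerivAt_right ((continuous_Dk N).intervalIntegrable _ _)
    (continuous_Dk N).stronglyMeasurable.stronglyMeasurableAtFilter (continuous_Dk N).continuousAt).const_sub _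

lemma Psi_le (N : ℕ) (u : ℝ) (h0 : 0 ≤ u) (h1 : u ≤ 1/2) : |Psi N u| ≤ 3 := by
  rw [Psi_eq]
  have := abs_le.1 (int_Dk_abs N u h0 h1)
  rw [abs_le]; constructor <;> linarith

lemma Psi_le' (N : ℕ) (u : ℝ) (hN : 1 ≤ N) (h0 : 0 < u) (h1 : u ≤ 1/2) : |Psi N u| ≤ 1 / (3 * N * u) := by
  have hN' : (1:ℝ) ≤ N := by exact_mod_cast hN
  have hn := nu_ge N
  have hn0 : 0 < nu N := by linarith
  have h := FD_split 0 0 u (1/2) N h0 h1 le_rfl (2 / (u * nu N))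
    (oscsin 0 0 (nu N) u (1/2) (nu N) le_rfl h0 h1 le_rfl (by linarith) (Or.inl fun u _ => by simp))
    (oscsin 0 0 (-nu N) u (1/2) (nu N) le_rfl h0 h1 le_rfl (by linarith) (Or.inr fun u _ => by simp))
  have e : ∫ v in u..(1/2), ee (0 * exp (0 * v)) * (Dk N v : ℂ) = (Psi N u : ℂ) := by
    unfold Psi
    rw [← intervalIntegral.integral_ofReal]
    congr 1; ext v; simp [ee]
  rw [e, Complex.norm_real, Real.norm_eq_abs] at h
  refine h.trans ?_
  rw [div_le_div_iff₀ (by positivity) (by positivity)]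
  nlinarith

lemma Psi_sqrt (N : ℕ) (u : ℝ) (hN : 1 ≤ N) (h0 : 0 < u) (h1 : u ≤ 1/2) :
    |Psi N u| ≤ (N : ℝ) ^ (-(1/2) : ℝ) * u ^ (-(1/2):ℝ) := by
  have hN' : (1:ℝ) ≤ N := by exact_mod_cast hN
  have h2 := Psi_le N u h0.le h1
  have h3 := Psi_le' N u hN h0 h1
  have h4 : |Psi N u| ^ 2 ≤ 1 / (N * u) := by
    calc |Psi N u| ^ 2 = |Psi N u| * |Psi N u| := by ring
      _ ≤ 3 * (1 / (3 * N * u)) := by gcongr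
      _ = 1 / (N * u) := by field_simp
  rw [← Real.mul_rpow (by positivity) h0.le]
  have h5 : ((N * u : ℝ) ^ (-(1/2):ℝ)) ^ 2 = 1 / (N * u) := by
    rw [← Real.rpow_natCast, ← Real.rpow_mul (by positivity)]
    norm_num
    rw [Real.rpow_neg_one]; field_simp
  rw [← h5] at h4
  exact (pow_le_pow_iff_left₀ (abs_nonneg _) (by positivity) two_ne_zero).1 h4

lemma exp_bd (L u : ℝ) (h0 : 0 ≤ u) (h1 : u ≤ 1/2) : exp (L * u) ≤ exp (|L| / 2) := by
  apply Real.exp_le_exp.2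
  have := le_abs_self L
  nlinarith [abs_nonneg L]

lemma exp_bd' (L u : ℝ) (h0 : 0 ≤ u) (h1 : u ≤ 1/2) : exp (-(|L| / 2)) ≤ exp (L * u) := by
  apply Real.exp_le_exp.2
  have := neg_abs_le L
  nlinarith [abs_nonneg L]

lemma cont_F (L Λ : ℝ) : Continuous fun u : ℝ => ee (Λ * exp (L * u)) :=
  continuous_ee.comp (by fun_prop)

lemma F_deriv (L Λ u : ℝ) : HasDerivAt (fun u => ee (Λ * exp (L * u)))
    ((2 * pi * Λ * L * exp (L * u) : ℝ) * I * ee (Λ * exp (L * u))) u := by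
  have h := (ph1 L Λ 0 u).ofReal_comp.mul_const I
  have h2 := h.cexp
  have e : (fun u : ℝ => ee (Λ * exp (L * u))) = (fun x : ℝ => Complex.exp (((2 * pi * (Λ * exp (L * x)) + 0 * x : ℝ) : ℂ) * I)) := by
    ext u; unfold ee; simp
  rw [e]
  refine h2.congr_deriv ?_
  unfold ee; simp only [zero_mul, add_zero]; ring

/-- small range one sided -/
lemma A_small (L Λ : ℝ) (N : ℕ) (hL : L ≠ 0) (hΛ : 1 ≤ Λ) (hN : 1 ≤ N)
    (hs : 2 * |L| * exp (|L| / 2) * Λ ≤ N) :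
    ‖(∫ u in (0:ℝ)..(1/2), ee (Λ * exp (L * u)) * (Dk N u : ℂ)) - ee Λ / 2‖ ≤
      8 * (Λ / N) + 4 * pi * |L| * exp (|L| / 2) * sqrt (Λ / N) := by
  have hp := Real.pi_pos
  have hp3 := Real.pi_gt_three
  have hN' : (1:ℝ) ≤ N := by exact_mod_cast hN
  have hn := nu_ge N
  have hn0 : 0 < nu N := by linarith
  have hL' : 0 < |L| := abs_pos.2 hL
  set E := exp (|L| / 2) with hE
  have hE0 : 0 < E := Real.exp_pos _
  set δ : ℝ := 1 / (2 * Λ) with hδ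
  have hδ0 : 0 < δ := by positivity
  have hδ1 : δ ≤ 1/2 := by
    rw [hδ]; exact one_div_le_one_div_of_le (by norm_num) (by linarith)
  have hder : ∀ u ∈ Icc (0:ℝ) (1/2), |2 * pi * Λ * L * exp (L * u)| ≤ pi * N := by
    intro u hu
    have := exp_bd L u hu.1 hu.2
    rw [abs_mul, abs_mul, abs_of_pos (by positivity : 0 < 2 * pi * Λ), abs_of_pos (Real.exp_pos _)]
    calc 2 * pi * Λ * |L| * exp (L * u) ≤ 2 * pi * Λ * |L| * E := by gcongr
      _ = pi * (2 * |L| * E * Λ) := by ring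
      _ ≤ pi * N := by gcongr
  have hnN : 2 * (pi * N) ≤ nu N := by unfold nu; nlinarith
  have hpN : 3 * (N:ℝ) ≤ pi * N := by nlinarith
  have hfar := FD_split L Λ δ (1/2) N hδ0 hδ1 le_rfl (2 / (δ * (pi * N)))
    (oscsin L Λ (nu N) δ (1/2) (pi * N) (by linarith) hδ0 hδ1 le_rfl (by positivity)
      (Or.inl fun u hu => by
        have := abs_le.1 (hder u ⟨hδ0.le.trans hu.1, hu.2⟩); linarith))
    (oscsin L Λ (-nu N) δ (1/2) (pi * N) (by linarith) hδ0 hδ1 le_rfl (by positivity)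
      (Or.inr fun u hu => by
        have := abs_le.1 (hder u ⟨hδ0.le.trans hu.1, hu.2⟩); linarith))
  have hPδ := Psi_le' N δ hN hδ0 hδ1
  have hcF := cont_F L Λ
  have hcD : Continuous fun u => (Dk N u : ℂ) := Complex.continuous_ofReal.comp (continuous_Dk N)
  have hcP : Continuous (Psi N) := continuous_iff_continuousAt.2 fun u => (Psi_deriv N u).continuousAt
  -- integration by parts
  have ibp := intervalIntegral.integral_mul_deriv_eq_deriv_mul (a := 0) (b := δ)
    (u := fun u => ee (Λ * exp (L * u)) - ee Λ)
    (u' := fun u => ((2 * pi * Λ * L * exp (L * u) : ℝ) * I * ee (Λ * exp (L * u))))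
    (v := fun u => (Psi N u : ℂ)) (v' := fun u => ((- Dk N u : ℝ) : ℂ))
    (fun u _ => (F_deriv L Λ u).sub_const _) (fun u _ => (Psi_deriv N u).ofReal_comp)
    (by
      apply Continuous.intervalIntegrable
      exact (by fun_prop : Continuous fun u : ℝ => ((2 * pi * Λ * L * exp (L * u) : ℝ) : ℂ) * I).mul hcF)
    (by
      apply Continuous.intervalIntegrable
      exact Complex.continuous_ofReal.comp (continuous_Dk N).neg)
  have hsplit : (∫ u in (0:ℝ)..(1/2), ee (Λ * exp (L * u)) * (Dk N u : ℂ)) - ee Λ / 2 =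
      -(∫ u in (0:ℝ)..δ, (ee (Λ * exp (L * u)) - ee Λ) * ((- Dk N u : ℝ) : ℂ)) +
      (∫ u in δ..(1/2), ee (Λ * exp (L * u)) * (Dk N u : ℂ)) - ee Λ * (Psi N δ : ℂ) := by
    have i1 : ∀ a c : ℝ, IntervalIntegrable (fun u => ee (Λ * exp (L * u)) * (Dk N u : ℂ)) volume a c :=
      fun a c => (hcF.mul hcD).intervalIntegrable _ _
    rw [← intervalIntegral.integral_add_adjacent_intervals (i1 0 δ) (i1 δ (1/2))]
    have e1 : (∫ u in (0:ℝ)..δ, (ee (Λ * exp (L * u)) - ee Λ) * ((- Dk N u : ℝ) : ℂ)) =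
      - (∫ u in (0:ℝ)..δ, ee (Λ * exp (L * u)) * (Dk N u : ℂ)) + ee Λ * ∫ u in (0:ℝ)..δ, (Dk N u : ℂ) := by
      rw [← intervalIntegral.integral_const_mul, ← intervalIntegral.integral_neg,
        ← intervalIntegral.integral_add]
      · congr 1; ext u; push_cast; ring
      · exact (hcF.mul hcD).neg.intervalIntegrable _ _
      · exact (hcD.const_mul _).intervalIntegrable _ _
    rw [e1, Psi_eq, intervalIntegral.integral_ofReal]
    push_cast; ring
  rw [hsplit, ibp]
  have hFδ : ‖(ee (Λ * exp (L * δ)) - ee Λ)‖ ≤ 2 := by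
    refine (norm_sub_le _ _).trans ?_
    rw [norm_ee, norm_ee]; norm_num
  have hint : ‖∫ u in (0:ℝ)..δ, ((2 * pi * Λ * L * exp (L * u) : ℝ) * I * ee (Λ * exp (L * u))) * (Psi N u : ℂ)‖ ≤
      4 * pi * |L| * E * sqrt (Λ / N) := by
    have h1 := intervalIntegral.norm_integral_le_of_norm_le (μ := volume) (a := 0) (b := δ)
      (f := fun u => ((2 * pi * Λ * L * exp (L * u) : ℝ) * I * ee (Λ * exp (L * u))) * (Psi N u : ℂ))
      (g := fun u => (2 * pi * Λ * |L| * E * (N : ℝ) ^ (-(1/2) : ℝ)) * u ^ (-(1/2):ℝ)) hδ0.le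
      (Filter.Eventually.of_forall fun u hu => by
        have := exp_bd L u hu.1.le (hu.2.trans hδ1)
        have h5 := Psi_sqrt N u hN hu.1 (hu.2.trans hδ1)
        rw [norm_mul, norm_mul, norm_mul, norm_ee, Complex.norm_I, Complex.norm_real, Complex.norm_real,
          Real.norm_eq_abs, Real.norm_eq_abs, abs_mul, abs_mul, abs_of_pos (by positivity : 0 < 2 * pi * Λ), abs_of_pos (Real.exp_pos _)]
        calc 2 * pi * Λ * |L| * exp (L * u) * 1 * 1 * |Psi N u|
            ≤ 2 * pi * Λ * |L| * E * 1 * 1 * ((N : ℝ) ^ (-(1/2) : ℝ) * u ^ (-(1/2):ℝ)) := by gcongr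
          _ = _ := by ring)
      ((intervalIntegral.intervalIntegrable_rpow' (by norm_num)).const_mul _)
    refine h1.trans ?_
    rw [intervalIntegral.integral_const_mul, integral_rpow (Or.inl (by norm_num))]
    have e3 : (-(1/2) + 1 : ℝ) = 1/2 := by norm_num
    rw [e3, Real.zero_rpow (by norm_num), ← Real.sqrt_eq_rpow, Real.rpow_neg (by positivity), ← Real.sqrt_eq_rpow, hδ]
    have hsq : sqrt (1 / (2 * Λ)) ≤ sqrt (1 / Λ) := Real.sqrt_le_sqrt (one_div_le_one_div_of_le (by positivity) (by linarith))
    have hsq2 : Λ * sqrt (1 / Λ) = sqrt Λ := by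
      rw [Real.sqrt_div zero_le_one, Real.sqrt_one, mul_one_div]
      exact Real.div_sqrt
    calc _ = 4 * pi * |L| * E * ((Λ * sqrt (1 / (2 * Λ))) / sqrt N) := by field_simp; ring
      _ ≤ 4 * pi * |L| * E * ((Λ * sqrt (1 / Λ)) / sqrt N) := by gcongr
      _ = _ := by rw [hsq2, Real.sqrt_div (by positivity)]
  simp only [mul_zero, Real.exp_zero, mul_one, sub_self, zero_mul, sub_zero]
  have e5 : 2 / (δ * (pi * N)) ≤ 4/3 * (Λ / N) := by
    rw [hδ]
    calc 2 / (1 / (2 * Λ) * (pi * N)) ≤ 2 / (1 / (2 * Λ) * (3 * N)) := by gcongr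
      _ = _ := by field_simp; norm_num
  have e6 : 1 / (3 * N * δ) = 2/3 * (Λ / N) := by rw [hδ]; field_simp
  rw [e6] at hPδ
  have hq : 0 ≤ Λ / N := by positivity
  have t1 : ‖(ee (Λ * exp (L * δ)) - ee Λ) * (Psi N δ : ℂ)‖ ≤ 2 * (2/3 * (Λ / N)) := by
    rw [norm_mul, Complex.norm_real, Real.norm_eq_abs]; gcongr
  have t2 : ‖ee Λ * (Psi N δ : ℂ)‖ ≤ (2/3 * (Λ / N)) := by
    rw [norm_mul, norm_ee, Complex.norm_real, Real.norm_eq_abs, one_mul]; exact hPδ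
  refine (norm_sub_le _ _).trans ?_
  refine (add_le_add_left (norm_add_le _ _) _).trans ?_
  rw [norm_neg]
  have := norm_sub_le ((ee (Λ * exp (L * δ)) - ee Λ) * (Psi N δ : ℂ)) (∫ u in (0:ℝ)..δ, ((2 * pi * Λ * L * exp (L * u) : ℝ) * I * ee (Λ * exp (L * u))) * (Psi N u : ℂ))
  linarith

/-- large range one sided -/
lemma A_large (L Λ : ℝ) (N : ℕ) (hL : L ≠ 0) (hΛ : 1 ≤ Λ) (hN : 1 ≤ N)
    (hs : 3 * N ≤ Λ * |L| * exp (-(|L| / 2))) :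
    ‖(∫ u in (0:ℝ)..(1/2), ee (Λ * exp (L * u)) * (Dk N u : ℂ))‖ ≤
      6 * (2 * N + 1) / (pi * Λ * |L| * exp (-(|L| / 2))) := by
  have hp := Real.pi_pos
  have hN' : (1:ℝ) ≤ N := by exact_mod_cast hN
  have hn := nu_ge N
  have hn0 : 0 < nu N := by linarith
  have hL' : 0 < |L| := abs_pos.2 hL
  set E := exp (-(|L| / 2)) with hE
  have hE0 : 0 < E := Real.exp_pos _
  set μ := pi * Λ * |L| * E with hμ
  have hμ0 : 0 < μ := by positivity
  set δ : ℝ := 1 / (2 * N + 1) with hδ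
  have hδ0 : 0 < δ := by positivity
  have hδ1 : δ ≤ 1/2 := by
    rw [hδ]; exact one_div_le_one_div_of_le (by norm_num) (by linarith)
  have hνμ : nu N ≤ μ := by
    unfold nu
    calc (2 * N + 1) * pi ≤ (3 * N) * pi := by gcongr; linarith
      _ ≤ (Λ * |L| * E) * pi := by gcongr
      _ = μ := by rw [hμ]; ring
  have hder : ∀ τ : ℝ, |τ| ≤ nu N → (∀ u ∈ Icc (0:ℝ) (1/2), μ ≤ 2 * pi * Λ * L * exp (L * u) + τ) ∨
      (∀ u ∈ Icc (0:ℝ) (1/2), 2 * pi * Λ * L * exp (L * u) + τ ≤ -μ) := by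
    intro τ hτ
    have hτ' := abs_le.1 hτ
    have key : ∀ u ∈ Icc (0:ℝ) (1/2), 2 * μ ≤ 2 * pi * Λ * |L| * exp (L * u) := by
      intro u hu
      have := exp_bd' L u hu.1 hu.2
      calc 2 * μ = 2 * pi * Λ * |L| * E := by rw [hμ]; ring
        _ ≤ _ := by gcongr
    rcases lt_or_gt_of_ne hL with h | h
    · right; intro u hu; have := key u hu; rw [abs_of_neg h] at this; linarith
    · left; intro u hu; have := key u hu; rw [abs_of_pos h] at this; linarith
  have hfar := FD_split L Λ δ (1/2) N hδ0 hδ1 le_rfl (2 / (δ * μ))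
    (oscsin L Λ (nu N) δ (1/2) μ (by linarith) hδ0 hδ1 le_rfl hμ0
      ((hder (nu N) (abs_of_pos hn0).le).imp (fun h u hu => h u ⟨hδ0.le.trans hu.1, hu.2⟩) (fun h u hu => h u ⟨hδ0.le.trans hu.1, hu.2⟩)))
    (oscsin L Λ (-nu N) δ (1/2) μ (by linarith) hδ0 hδ1 le_rfl hμ0
      ((hder (-nu N) (by rw [abs_neg]; exact (abs_of_pos hn0).le)).imp (fun h u hu => h u ⟨hδ0.le.trans hu.1, hu.2⟩) (fun h u hu => h u ⟨hδ0.le.trans hu.1, hu.2⟩)))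
  have hDd : ∀ u, HasDerivAt (Dk N) (2 * ∑ n ∈ range N, -(sin (2 * pi * (n + 1) * u) * (2 * pi * (n + 1)))) u := by
    intro u
    have h1 : ∀ n ∈ range N, HasDerivAt (fun x : ℝ => cos (2 * pi * (n + 1) * x))
      (-(sin (2 * pi * (n + 1) * u) * (2 * pi * (n + 1)))) u := by
      intro n _
      have := (((hasDerivAt_id u).const_mul (2 * pi * ((n:ℝ) + 1))).cos)
      refine this.congr_deriv ?_
      simp
    exact ((HasDerivAt.fun_sum h1).const_mul 2).const_add 1
  have hnear := osc _ _ _ (Dk N) _ 0 δ μ hδ0.le (ph1 L Λ 0) (ph2 L Λ 0) (by fun_prop) (fun u => by positivity)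
    (fun u _ => hDd u) (by fun_prop) (by
      intro u hu
      have : 0 ≤ ∑ n ∈ range N, (sin (2 * pi * (n + 1) * u) * (2 * pi * (n + 1))) := by
        apply Finset.sum_nonneg
        intro n hn
        have hn' : (n:ℝ) + 1 ≤ N := by exact_mod_cast Finset.mem_range.1 hn
        have : 0 ≤ sin (2 * pi * (n + 1) * u) := by
          have hu0 := hu.1
          apply Real.sin_nonneg_of_nonneg_of_le_pi
          · positivity
          · have : (2 * N + 1) * u ≤ 1 := by
              calc _ ≤ (2 * N + 1) * δ := by gcongr; exact hu.2
                _ = 1 := by rw [hδ]; field_simp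
            calc 2 * pi * (n + 1) * u ≤ 2 * pi * N * u := by gcongr
              _ = pi * (2 * N * u) := by ring
              _ ≤ pi * 1 := by gcongr; linarith
              _ = pi := mul_one _
        positivity
      rw [Finset.sum_neg_distrib]; linarith) (by
      intro u hu
      rcases hu.1.eq_or_lt with h | h
      · rw [← h]; unfold Dk; simp; positivity
      · rw [Dk_eq N u h (hu.2.trans hδ1)]
        apply div_nonneg _ (sin_pi_pos u h (hu.2.trans hδ1)).le
        apply Real.sin_nonneg_of_nonneg_of_le_pi
        · positivity
        · calc nu N * u ≤ nu N * δ := by gcongr; exact hu.2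
            _ = pi := by rw [hδ]; unfold nu; field_simp) hμ0
      ((hder 0 (by simpa using hn0.le)).imp (fun h u hu => h u ⟨hu.1, hu.2.trans hδ1⟩) (fun h u hu => h u ⟨hu.1, hu.2.trans hδ1⟩))
  have e0 : (∫ u in (0:ℝ)..δ, (Dk N u : ℂ) * Complex.exp ((2 * pi * (Λ * exp (L * u)) + 0 * u : ℝ) * I)) =
      ∫ u in (0:ℝ)..δ, ee (Λ * exp (L * u)) * (Dk N u : ℂ) := by
    congr 1; ext u; unfold ee; rw [mul_comm]; simp
  rw [e0] at hnear
  have hcD : Continuous fun u => (Dk N u : ℂ) := Complex.continuous_ofReal.comp (continuous_Dk N)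
  have i1 : ∀ a c : ℝ, IntervalIntegrable (fun u => ee (Λ * exp (L * u)) * (Dk N u : ℂ)) volume a c :=
      fun a c => ((cont_F L Λ).mul hcD).intervalIntegrable _ _
  rw [← intervalIntegral.integral_add_adjacent_intervals (i1 0 δ) (i1 δ (1/2))]
  refine (norm_add_le _ _).trans ((add_le_add hnear hfar).trans ?_)
  have e1 : Dk N 0 = 2 * N + 1 := by unfold Dk; simp; ring
  rw [e1]
  have e2 : 2 / (δ * μ) = 2 * (2 * N + 1) / μ := by rw [hδ]; field_simp
  rw [e2]
  apply le_of_eq; ring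

lemma ee_add (x y : ℝ) : ee (x + y) = ee x * ee y := by
  unfold ee; rw [← Complex.exp_add]; congr 1; push_cast; ring

lemma ee_lip (x y : ℝ) : ‖ee x - ee y‖ ≤ 2 * pi * |x - y| := by
  have e : ee x - ee y = ee y * (ee (x - y) - 1) := by
    rw [mul_sub, ← ee_add]; simp
  rw [e, norm_mul, norm_ee, one_mul]
  have := Real.norm_exp_I_mul_ofReal_sub_one_le (x := 2 * pi * (x - y))
  rw [mul_comm] at this
  unfold ee
  refine this.trans ?_
  rw [Real.norm_eq_abs, abs_mul, abs_of_pos Real.two_pi_pos]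

lemma A_mid (L Λ : ℝ) (N : ℕ) (hL : L ≠ 0) (hΛ : 0 ≤ Λ) (hN : 1 ≤ N) :
    ‖(∫ u in (0:ℝ)..(1/2), ee (Λ * exp (L * u)) * (Dk N u : ℂ)) +
      (∫ u in (0:ℝ)..(1/2), ee (Λ * exp (-L * u)) * (Dk N u : ℂ))‖ ≤
      2 * ((1 + |L|) * (8 + 4 / |L|)) + 5 + 2 * (Λ / N) := by
  have hp := Real.pi_pos
  have hp4 := Real.pi_le_four
  have hN' : (1:ℝ) ≤ N := by exact_mod_cast hN
  have hn := nu_ge N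
  have hn0 : 0 < nu N := by linarith
  have hL' : 0 < |L| := abs_pos.2 hL
  have hsN : 1 ≤ sqrt N := Real.one_le_sqrt.2 hN'
  have hsN2 : sqrt N * sqrt N = N := Real.mul_self_sqrt (by linarith)
  set s := sqrt N with hs
  set δ : ℝ := 1 / (2 * (1 + |L|) * s) with hδ
  have hδ0 : 0 < δ := by positivity
  have hδ1 : δ ≤ 1/2 := by
    rw [hδ]; refine one_div_le_one_div_of_le (by norm_num) ?_
    nlinarith
  have hδL : |L| * δ ≤ 1 := by
    rw [hδ, mul_one_div, div_le_one (by positivity)]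
    nlinarith
  have hcD : Continuous fun u => (Dk N u : ℂ) := Complex.continuous_ofReal.comp (continuous_Dk N)
  have i1 : ∀ L a c : ℝ, IntervalIntegrable (fun u => ee (Λ * exp (L * u)) * (Dk N u : ℂ)) volume a c :=
      fun L a c => ((cont_F L Λ).mul hcD).intervalIntegrable _ _
  have hfar : ∀ L' : ℝ, |L'| = |L| → ‖∫ u in δ..(1/2), ee (Λ * exp (L' * u)) * (Dk N u : ℂ)‖ ≤
      (1 + |L|) * (8 + 4 / |L|) := by
    intro L' hLL
    have hL'0 : L' ≠ 0 := abs_pos.1 (hLL ▸ hL')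
    have hb : 1 / (2 * δ) * (8 + 4 / |L'|) / sqrt |nu N| ≤ (1 + |L|) * (8 + 4 / |L|) := by
      rw [abs_of_pos hn0, hLL]
      have : s ≤ sqrt (nu N) := Real.sqrt_le_sqrt (by linarith)
      calc 1 / (2 * δ) * (8 + 4 / |L|) / sqrt (nu N) ≤ 1 / (2 * δ) * (8 + 4 / |L|) / s := by gcongr
        _ = _ := by rw [hδ]; field_simp
    have h4 : 4 ≤ |nu N| := by rw [abs_of_pos hn0]; linarith
    apply FD_split L' Λ δ (1/2) N hδ0 hδ1 le_rfl
    · exact (vdcsin L' Λ (nu N) δ (1/2) hL'0 hΛ hδ0 hδ1 le_rfl h4).trans hb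
    · have := (vdcsin L' Λ (-nu N) δ (1/2) hL'0 hΛ hδ0 hδ1 le_rfl (by rwa [abs_neg]))
      rw [abs_neg] at this
      exact this.trans hb
  have hnear : ∀ L' : ℝ, |L'| = |L| → ‖∫ u in (0:ℝ)..δ, (ee (Λ * exp (L' * u)) - ee (Λ + Λ * L' * u)) * (Dk N u : ℂ)‖ ≤ Λ / N := by
    intro L' hLL
    have h1 := intervalIntegral.norm_integral_le_of_norm_le_const (a := 0) (b := δ) (C := pi * Λ * L ^ 2 * δ)
      (f := fun u => (ee (Λ * exp (L' * u)) - ee (Λ + Λ * L' * u)) * (Dk N u : ℂ)) (by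
        intro u hu
        rw [uIoc_of_le hδ0.le] at hu
        rw [norm_mul, Complex.norm_real, Real.norm_eq_abs]
        have hD := abs_Dk_le' N u hu.1 (hu.2.trans hδ1)
        have hee := ee_lip (Λ * exp (L' * u)) (Λ + Λ * L' * u)
        have hx : |L' * u| ≤ 1 := by
          rw [abs_mul, hLL, abs_of_pos hu.1]
          exact (mul_le_mul_of_nonneg_left hu.2 hL'.le).trans hδL
        have h3 := Real.abs_exp_sub_one_sub_id_le hx
        have e : Λ * exp (L' * u) - (Λ + Λ * L' * u) = Λ * (exp (L' * u) - 1 - L' * u) := by ring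
        rw [e, abs_mul, abs_of_nonneg hΛ] at hee
        have e2 : (L' * u) ^ 2 = L ^ 2 * u ^ 2 := by rw [mul_pow, ← sq_abs L', hLL, sq_abs]
        rw [e2] at h3
        have hu0 := hu.1
        calc _ ≤ (2 * pi * (Λ * (L ^ 2 * u ^ 2))) * (1 / (2 * u)) := by
              gcongr
              refine hee.trans ?_
              gcongr
          _ = pi * Λ * L ^ 2 * u := by field_simp
          _ ≤ _ := by gcongr; exact hu.2)
    refine h1.trans ?_
    rw [sub_zero, abs_of_pos hδ0]
    have : L ^ 2 * δ ^ 2 ≤ 1 / (4 * N) := by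
      rw [hδ, ← hsN2, div_pow, mul_div_assoc', div_le_div_iff₀ (by positivity) (by positivity)]
      rw [← sq_abs L]
      have : |L| ^ 2 ≤ (1 + |L|) ^ 2 := by gcongr; linarith
      nlinarith [mul_le_mul_of_nonneg_right this (by positivity : 0 ≤ 4 * (s * s))]
    calc pi * Λ * L ^ 2 * δ * δ = pi * Λ * (L ^ 2 * δ ^ 2) := by ring
      _ ≤ 4 * Λ * (1 / (4 * N)) := by gcongr
      _ = Λ / N := by field_simp
  have hmain : ‖(∫ u in (0:ℝ)..δ, ee (Λ + Λ * L * u) * (Dk N u : ℂ)) + ∫ u in (0:ℝ)..δ, ee (Λ + Λ * (-L) * u) * (Dk N u : ℂ)‖ ≤ 5 := by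
    have i2 : ∀ L : ℝ, IntervalIntegrable (fun u => ee (Λ + Λ * L * u) * (Dk N u : ℂ)) volume 0 δ := by
      intro L
      exact ((continuous_ee.comp (by fun_prop)).mul hcD).intervalIntegrable _ _
    rw [← intervalIntegral.integral_add (i2 _) (i2 _)]
    set c := 2 * pi * (Λ * L) with hc
    have e : ∫ u in (0:ℝ)..δ, (ee (Λ + Λ * L * u) * (Dk N u : ℂ) + ee (Λ + Λ * (-L) * u) * (Dk N u : ℂ)) =
      ee Λ * (((∫ u in (0:ℝ)..δ, sin ((nu N + c) * u) / sin (pi * u)) +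
        ∫ u in (0:ℝ)..δ, sin ((nu N - c) * u) / sin (pi * u) : ℝ) : ℂ) := by
      rw [← intervalIntegral.integral_add (dir_int _ δ hδ0.le hδ1) (dir_int _ δ hδ0.le hδ1),
        ← intervalIntegral.integral_ofReal, ← intervalIntegral.integral_const_mul]
      apply intervalIntegral.integral_congr_ae
      refine Filter.Eventually.of_forall fun u hu => ?_
      rw [uIoc_of_le hδ0.le] at hu
      have h3 := sin_pi_pos u hu.1 (hu.2.trans hδ1)
      rw [Dk_eq N u hu.1 (hu.2.trans hδ1), ee_add, ee_add]
      have e3 : ee (Λ * L * u) + ee (Λ * -L * u) = ((2 * cos (c * u) : ℝ) : ℂ) := by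
        unfold ee
        push_cast
        rw [Complex.two_cos, hc]
        congr 1 <;> (congr 1; push_cast; ring)
      rw [← add_mul, ← mul_add, e3, mul_assoc, ← Complex.ofReal_mul]
      congr 2
      rw [add_mul, sub_mul, Real.sin_add, Real.sin_sub]
      field_simp; ring
    rw [e, norm_mul, norm_ee, one_mul, Complex.norm_real, Real.norm_eq_abs]
    refine (abs_add_le _ _).trans ?_
    have := dirichlet (nu N + c) δ hδ0.le hδ1
    have := dirichlet (nu N - c) δ hδ0.le hδ1
    linarith
  have hnL : |(-L)| = |L| := abs_neg L
  have hsub : ∀ L : ℝ, ∫ u in (0:ℝ)..δ, (ee (Λ * exp (L * u)) - ee (Λ + Λ * L * u)) * (Dk N u : ℂ) =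
    (∫ u in (0:ℝ)..δ, ee (Λ * exp (L * u)) * (Dk N u : ℂ)) - ∫ u in (0:ℝ)..δ, ee (Λ + Λ * L * u) * (Dk N u : ℂ) := by
    intro L
    rw [← intervalIntegral.integral_sub (i1 _ _ _)]
    · congr 1; ext u; ring
    · exact ((continuous_ee.comp (by fun_prop)).mul hcD).intervalIntegrable _ _
  rw [← intervalIntegral.integral_add_adjacent_intervals (i1 L 0 δ) (i1 L δ (1/2)),
    ← intervalIntegral.integral_add_adjacent_intervals (i1 (-L) 0 δ) (i1 (-L) δ (1/2))]
  have f1 := hfar L rfl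
  have f2 := hfar (-L) hnL
  have n1 := hnear L rfl
  have n2 := hnear (-L) hnL
  rw [hsub] at n1 n2
  generalize (∫ u in (0:ℝ)..δ, ee (Λ + Λ * L * u) * (Dk N u : ℂ)) = m1 at *
  generalize (∫ u in (0:ℝ)..δ, ee (Λ + Λ * (-L) * u) * (Dk N u : ℂ)) = m2 at *
  generalize (∫ u in (0:ℝ)..δ, ee (Λ * exp (L * u)) * (Dk N u : ℂ)) = p1 at *
  generalize (∫ u in (0:ℝ)..δ, ee (Λ * exp (-L * u)) * (Dk N u : ℂ)) = p2 at *
  generalize (∫ u in δ..(1/2), ee (Λ * exp (L * u)) * (Dk N u : ℂ)) = q1 at *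
  generalize (∫ u in δ..(1/2), ee (Λ * exp (-L * u)) * (Dk N u : ℂ)) = q2 at *
  have : p1 + q1 + (p2 + q2) = ((p1 - m1) + (p2 - m2)) + (m1 + m2) + (q1 + q2) := by ring
  rw [this]
  have a1 := norm_add_le (((p1 - m1) + (p2 - m2)) + (m1 + m2)) (q1 + q2)
  have a2 := norm_add_le ((p1 - m1) + (p2 - m2)) (m1 + m2)
  have a3 := norm_add_le (p1 - m1) (p2 - m2)
  have a4 := norm_add_le q1 q2
  linarith

lemma Dk_neg (N : ℕ) (u : ℝ) : Dk N (-u) = Dk N u := by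
  unfold Dk
  simp only [mul_neg, Real.cos_neg]

noncomputable def AA (L Λ : ℝ) (N : ℕ) : ℂ :=
  ∫ u in (-(1/2):ℝ)..(1/2), ee (Λ * exp (L * u)) * (Dk N u : ℂ)

lemma AA_eq (L Λ : ℝ) (N : ℕ) : AA L Λ N = (∫ u in (0:ℝ)..(1/2), ee (Λ * exp (L * u)) * (Dk N u : ℂ)) +
      (∫ u in (0:ℝ)..(1/2), ee (Λ * exp (-L * u)) * (Dk N u : ℂ)) := by
  have hcD : Continuous fun u => (Dk N u : ℂ) := Complex.continuous_ofReal.comp (continuous_Dk N)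
  have i1 : ∀ a c : ℝ, IntervalIntegrable (fun u => ee (Λ * exp (L * u)) * (Dk N u : ℂ)) volume a c :=
      fun a c => ((cont_F L Λ).mul hcD).intervalIntegrable _ _
  unfold AA
  rw [← intervalIntegral.integral_add_adjacent_intervals (i1 _ 0) (i1 0 _), add_comm]
  congr 1
  have := intervalIntegral.integral_comp_neg (a := 0) (b := 1/2) (fun u => ee (Λ * exp (L * u)) * (Dk N u : ℂ))
  rw [neg_zero] at this
  rw [← this]
  congr 1; ext u
  rw [Dk_neg]; simp

lemma AA_bounds (L : ℝ) (hL : L ≠ 0) : ∃ C : ℝ, 0 < C ∧ ∀ Λ : ℝ, 1 ≤ Λ → ∀ N : ℕ, 1 ≤ N →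
    ‖AA L Λ N - ee Λ‖ ≤ C * sqrt (Λ / N) ∧ ‖AA L Λ N‖ ≤ C * (N / Λ) := by
  have hp := Real.pi_pos
  have hL' : 0 < |L| := abs_pos.2 hL
  set E := exp (|L| / 2) with hE
  have hE0 : 0 < E := Real.exp_pos _
  have hEi : exp (-(|L| / 2)) = 1 / E := by rw [Real.exp_neg, hE]; field_simp
  set c0 : ℝ := 1 / (2 * |L| * E) with hc0
  have hc00 : 0 < c0 := by positivity
  set C0 : ℝ := 3 * E / |L| with hC0
  have hC00 : 0 < C0 := by positivity
  set M := 2 * ((1 + |L|) * (8 + 4 / |L|)) + 5 + 2 * C0 with hM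
  have hM0 : 0 < M := by positivity
  set S := 16 * sqrt c0 + 8 * pi * |L| * E with hS
  have hS0 : 0 < S := by positivity
  set G := 36 * E / (pi * |L|) with hG
  have hG0 : 0 < G := by positivity
  refine ⟨(M + 1 + G / C0) / sqrt c0 + S + (M + 1 + S * sqrt c0) * (C0 + c0) + G, by positivity, ?_⟩
  intro Λ hΛ N hN
  have hN' : (1:ℝ) ≤ N := by exact_mod_cast hN
  have hmid := A_mid L Λ N hL (by linarith) hN
  rw [← AA_eq] at hmid
  have hΛ0 : 0 < Λ := by linarith
  have hN0 : (0:ℝ) < N := by linarith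
  have hq0 : 0 < Λ / N := by positivity
  have hr0 : 0 < N / Λ := by positivity
  have hqr : (Λ / N) * (N / Λ) = 1 := by field_simp
  have hdiff : ‖AA L Λ N - ee Λ‖ ≤ ‖AA L Λ N‖ + 1 := by
    have := norm_sub_le (AA L Λ N) (ee Λ); rwa [norm_ee] at this
  have hdiff' : ‖AA L Λ N‖ ≤ ‖AA L Λ N - ee Λ‖ + 1 := by
    have := norm_add_le (AA L Λ N - ee Λ) (ee Λ); rwa [norm_ee, sub_add_cancel] at this
  have hsc0 : 0 < sqrt c0 := Real.sqrt_pos.2 hc00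
  rcases le_total (Λ / N) c0 with h1 | h1
  · have hs : 2 * |L| * E * Λ ≤ N := by
      rw [div_le_iff₀ hN0, hc0, div_mul_eq_mul_div, one_mul, le_div_iff₀ (by positivity)] at h1
      linarith
    have a1 := A_small L Λ N hL hΛ hN hs
    have a2 := A_small (-L) Λ N (neg_ne_zero.2 hL) hΛ hN (by rw [abs_neg]; exact hs)
    rw [abs_neg] at a2
    have hA : ‖AA L Λ N - ee Λ‖ ≤ S * sqrt (Λ / N) := by
      rw [AA_eq]
      have e : ∀ x y z : ℂ, x + y - z = (x - z / 2) + (y - z / 2) := by intros; ring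
      rw [e]
      refine (norm_add_le _ _).trans ((add_le_add a1 a2).trans ?_)
      have : Λ / N ≤ sqrt c0 * sqrt (Λ / N) := by
        calc Λ / N = sqrt (Λ / N) * sqrt (Λ / N) := (Real.mul_self_sqrt hq0.le).symm
          _ ≤ _ := by gcongr
      rw [← hE, hS]
      linarith
    have hsq : sqrt (Λ / N) ≤ sqrt c0 := Real.sqrt_le_sqrt h1
    constructor
    · refine hA.trans ?_
      gcongr
      have : 0 < (M + 1 + G / C0) / sqrt c0 := by positivity
      have : 0 < (M + 1 + S * sqrt c0) * (C0 + c0) := by positivity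
      linarith
    · have hb : ‖AA L Λ N‖ ≤ M + 1 + S * sqrt c0 := by
        have : S * sqrt (Λ / N) ≤ S * sqrt c0 := by gcongr
        linarith
      have : 1 ≤ (C0 + c0) * (N / Λ) := by
        calc 1 = (Λ / N) * (N / Λ) := hqr.symm
          _ ≤ _ := by gcongr; linarith
      calc ‖AA L Λ N‖ ≤ (M + 1 + S * sqrt c0) * 1 := by rw [mul_one]; exact hb
        _ ≤ (M + 1 + S * sqrt c0) * ((C0 + c0) * (N / Λ)) := by gcongr
        _ = ((M + 1 + S * sqrt c0) * (C0 + c0)) * (N / Λ) := by ring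
        _ ≤ _ := by
          gcongr
          have : 0 < (M + 1 + G / C0) / sqrt c0 := by positivity
          linarith
  · have hsq : sqrt c0 ≤ sqrt (Λ / N) := Real.sqrt_le_sqrt h1
    have key : ‖AA L Λ N‖ ≤ M + G / C0 → ‖AA L Λ N - ee Λ‖ ≤ ((M + 1 + G / C0) / sqrt c0 + S + (M + 1 + S * sqrt c0) * (C0 + c0) + G) * sqrt (Λ / N) := by
      intro h
      calc ‖AA L Λ N - ee Λ‖ ≤ (M + 1 + G / C0) / sqrt c0 * sqrt c0 := by
            rw [div_mul_cancel₀ _ hsc0.ne']; linarith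
        _ ≤ _ := by
          gcongr
          have : 0 < (M + 1 + S * sqrt c0) * (C0 + c0) := by positivity
          linarith
    rcases le_total (Λ / N) C0 with h2 | h2
    · have hb : ‖AA L Λ N‖ ≤ M := by
        refine hmid.trans ?_
        rw [hM]; linarith
      refine ⟨key (by have : 0 < G / C0 := by positivity
                      linarith), ?_⟩
      have : 1 ≤ (C0 + c0) * (N / Λ) := by
        calc 1 = (Λ / N) * (N / Λ) := hqr.symm
          _ ≤ _ := by gcongr; linarith
      calc ‖AA L Λ N‖ ≤ (M + 1 + S * sqrt c0) * 1 := by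
            have : 0 < S * sqrt c0 := by positivity
            rw [mul_one]; linarith
        _ ≤ (M + 1 + S * sqrt c0) * ((C0 + c0) * (N / Λ)) := by gcongr
        _ = ((M + 1 + S * sqrt c0) * (C0 + c0)) * (N / Λ) := by ring
        _ ≤ _ := by
          gcongr
          have : 0 < (M + 1 + G / C0) / sqrt c0 := by positivity
          linarith
    · have hs : 3 * N ≤ Λ * |L| * exp (-(|L| / 2)) := by
        rw [hEi]
        rw [le_div_iff₀ hN0, hC0, div_mul_eq_mul_div, div_le_iff₀ hL'] at h2
        rw [mul_one_div, le_div_iff₀ hE0]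
        linarith
      have a1 := A_large L Λ N hL hΛ hN hs
      have a2 := A_large (-L) Λ N (neg_ne_zero.2 hL) hΛ hN (by rw [abs_neg]; exact hs)
      rw [abs_neg] at a2
      have hb : ‖AA L Λ N‖ ≤ G * (N / Λ) := by
        rw [AA_eq]
        refine (norm_add_le _ _).trans ((add_le_add a1 a2).trans ?_)
        rw [hEi]
        calc _ = 12 * (2 * N + 1) * (E / (pi * Λ * |L|)) := by field_simp; ring
          _ ≤ 12 * (2 * N + N) * (E / (pi * Λ * |L|)) := by gcongr
          _ = _ := by rw [hG]; field_simp; ring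
      have hb2 : ‖AA L Λ N‖ ≤ M + G / C0 := by
        have : N / Λ ≤ 1 / C0 := by
          rw [← one_div_div]; exact one_div_le_one_div_of_le hC00 h2
        calc _ ≤ G * (N / Λ) := hb
          _ ≤ G * (1 / C0) := by gcongr
          _ = G / C0 := by ring
          _ ≤ _ := by linarith
      refine ⟨key hb2, hb.trans ?_⟩
      gcongr
      have : 0 < (M + 1 + G / C0) / sqrt c0 := by positivity
      have : 0 < (M + 1 + S * sqrt c0) * (C0 + c0) := by positivity
      linarith

open Filter hiding pi
open Topology

noncomputable def PB (K : ℕ) (x : ℝ) : ℝ := bernoulliFun K (Int.fract x)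

lemma PB_meas (K : ℕ) : Measurable (PB K) := (continuous_bernoulliFun (k := K)).measurable.comp measurable_fract

lemma PB_cont (K : ℕ) (hK : 2 ≤ K) : Continuous (PB K) :=
  ContinuousOn.comp_fract'' (continuous_bernoulliFun (k := K)).continuousOn
    (bernoulliFun_endpoints_eq_of_ne_one (by omega)).symm

lemma PB_bdd (K : ℕ) : ∃ C : ℝ, 0 < C ∧ ∀ x, |PB K x| ≤ C := by
  obtain ⟨C, hC⟩ := isCompact_Icc.exists_bound_of_continuousOn (s := Icc (0:ℝ) 1) (continuous_bernoulliFun (k := K)).continuousOn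
  refine ⟨|C| + 1, by positivity, fun x => ?_⟩
  have := hC (Int.fract x) ⟨Int.fract_nonneg x, (Int.fract_lt_one x).le⟩
  rw [Real.norm_eq_abs] at this
  have h2 := le_abs_self C
  unfold PB; linarith

lemma PB_rderiv (K : ℕ) (x : ℝ) : HasDerivWithinAt (PB (K + 1)) ((K + 1) * PB K x) (Ioi x) x := by
  have h1 : HasDerivAt (fun y => bernoulliFun (K+1) (y - ⌊x⌋)) ((K + 1) * PB K x) x := by
    have := (hasDerivAt_bernoulliFun (K+1) (x - ⌊x⌋)).comp x ((hasDerivAt_id x).sub_const (⌊x⌋:ℝ))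
    refine this.congr_deriv ?_
    simp only [PB, id, Int.self_sub_floor, mul_one, Nat.add_sub_cancel]
    push_cast; ring
  refine h1.hasDerivWithinAt.congr_of_eventuallyEq ?_ ?_
  · have : Ioo x (⌊x⌋ + 1 : ℝ) ∈ 𝓝[>] x := Ioo_mem_nhdsGT (Int.lt_floor_add_one x)
    filter_upwards [this] with y hy
    have : ⌊y⌋ = ⌊x⌋ := by
      rw [Int.floor_eq_iff]
      exact ⟨(Int.floor_le x).trans hy.1.le, by exact_mod_cast hy.2⟩
    unfold PB; rw [Int.fract, this]
  · rfl

lemma cpow_deriv (c : ℂ) (x : ℝ) (hx : 0 < x) : HasDerivAt (fun y : ℝ => (y : ℂ) ^ c) (c * (x : ℂ) ^ (c - 1)) x := by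
  have := ((hasDerivAt_id (x : ℂ)).cpow_const (c := c) (Or.inl (by simpa using hx))).comp_ofReal
  simpa using this

lemma cpow_contOn (c : ℂ) (X : ℝ) : ContinuousOn (fun y : ℝ => (y : ℂ) ^ c) (Icc 1 X) :=
  fun x hx => (cpow_deriv c x (by linarith [hx.1])).continuousAt.continuousWithinAt

lemma PB_intervalIntegrable (K : ℕ) (a c : ℝ) : IntervalIntegrable (PB K) volume a c := by
  obtain ⟨C, hC0, hC⟩ := PB_bdd K
  rw [intervalIntegrable_iff]
  have : IsFiniteMeasure (volume.restrict (uIoc a c)) :=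
    ⟨by rw [Measure.restrict_apply_univ, uIoc]; exact measure_Ioc_lt_top⟩
  exact Integrable.mono' (g := fun _ => C) (integrable_const _) (PB_meas K).aestronglyMeasurable
    (Eventually.of_forall hC)

lemma BP (K : ℕ) (hK : 1 ≤ K) (s : ℂ) (X : ℝ) (hX : 1 ≤ X) :
    ∫ x in (1:ℝ)..X, (PB K x : ℂ) * (x : ℂ) ^ (-s - K) =
      (PB (K+1) X : ℂ) * (X : ℂ) ^ (-s - K) / (K + 1) - (bernoulliFun (K+1) 0 : ℂ) / (K + 1) +
      (s + K) / (K + 1) * ∫ x in (1:ℝ)..X, (PB (K+1) x : ℂ) * (x : ℂ) ^ (-s - (K + 1 : ℕ)) := by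
  have hK1 : (K:ℂ) + 1 ≠ 0 := by exact_mod_cast Nat.succ_ne_zero K
  have hu : uIcc 1 X = Icc 1 X := uIcc_of_le hX
  have := intervalIntegral.integral_mul_deriv_eq_deriv_mul_of_hasDeriv_right (a := 1) (b := X)
    (u := fun y : ℝ => (y : ℂ) ^ (-s - K)) (u' := fun x : ℝ => (-s - K) * (x : ℂ) ^ (-s - K - 1))
    (v := fun x => (PB (K+1) x : ℂ)) (v' := fun x => (((K + 1) * PB K x : ℝ) : ℂ))
    (by rw [hu]; exact cpow_contOn _ _)
    (Complex.continuous_ofReal.comp (PB_cont (K+1) (by omega))).continuousOn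
    (fun x hx => (cpow_deriv _ x (by rw [min_eq_left hX] at hx; linarith [hx.1])).hasDerivWithinAt)
    (fun x _ => by
      have := Complex.ofRealCLM.hasFDerivAt.comp_hasDerivWithinAt x (PB_rderiv K x)
      exact this)
    (by
      apply ContinuousOn.intervalIntegrable
      rw [hu]; exact (cpow_contOn _ _).const_mul _)
    ⟨((PB_intervalIntegrable K 1 X).const_mul _).1.ofReal, ((PB_intervalIntegrable K 1 X).const_mul _).2.ofReal⟩
  have e1 : ∫ x in (1:ℝ)..X, (x : ℂ) ^ (-s - K) * (((K + 1) * PB K x : ℝ) : ℂ) =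
      (K + 1) * ∫ x in (1:ℝ)..X, (PB K x : ℂ) * (x : ℂ) ^ (-s - K) := by
    rw [← intervalIntegral.integral_const_mul]
    congr 1; ext x; push_cast; ring
  have e2 : ∫ x in (1:ℝ)..X, (-s - K) * (x : ℂ) ^ (-s - K - 1) * (PB (K+1) x : ℂ) =
      (-s - K) * ∫ x in (1:ℝ)..X, (PB (K+1) x : ℂ) * (x : ℂ) ^ (-s - (K + 1 : ℕ)) := by
    rw [← intervalIntegral.integral_const_mul]
    congr 1; ext x; push_cast; rw [sub_sub]; ring
  rw [e1, e2] at this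
  have e3 : PB (K+1) 1 = bernoulliFun (K+1) 0 := by simp [PB]
  rw [e3] at this
  simp only [Complex.ofReal_one, Complex.one_cpow, one_mul] at this
  field_simp
  linear_combination this

lemma PB_integrable (K : ℕ) (s : ℂ) (hs : 1 - K < s.re) :
    IntegrableOn (fun x : ℝ => (PB K x : ℂ) * (x : ℂ) ^ (-s - K)) (Ioi 1) := by
  obtain ⟨C, hC0, hC⟩ := PB_bdd K
  have h1 : IntegrableOn (fun x : ℝ => (x:ℂ) ^ (-s - K)) (Ioi 1) :=
    integrableOn_Ioi_cpow_of_lt (by simp; linarith) zero_lt_one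
  refine Integrable.bdd_mul (c := C) h1 ((Complex.measurable_ofReal.comp (PB_meas K)).aestronglyMeasurable) ?_
  refine Eventually.of_forall fun x => ?_
  simpa using hC x

/-- the integral over (1,∞) -/
noncomputable def JJ (K : ℕ) (s : ℂ) : ℂ := ∫ x in Ioi (1:ℝ), (PB K x : ℂ) * (x : ℂ) ^ (-s - K)

lemma JJ_tendsto (K : ℕ) (s : ℂ) (hs : 1 - K < s.re) :
    Tendsto (fun X : ℝ => ∫ x in (1:ℝ)..X, (PB K x : ℂ) * (x : ℂ) ^ (-s - K)) atTop (𝓝 (JJ K s)) :=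
  intervalIntegral_tendsto_integral_Ioi 1 (PB_integrable K s hs) tendsto_id

lemma trunc_tendsto (K : ℕ) (hK : 1 ≤ K) (s : ℂ) (hs : -K < s.re) :
    Tendsto (fun X : ℝ => ∫ x in (1:ℝ)..X, (PB K x : ℂ) * (x : ℂ) ^ (-s - K)) atTop
      (𝓝 (- (bernoulliFun (K+1) 0 : ℂ) / (K + 1) + (s + K) / (K + 1) * JJ (K+1) s)) := by
  obtain ⟨C, hC0, hC⟩ := PB_bdd (K+1)
  have h1 := JJ_tendsto (K+1) s (by push_cast; linarith)
  have h2 : Tendsto (fun X : ℝ => (PB (K+1) X : ℂ) * (X : ℂ) ^ (-s - K) / (K + 1)) atTop (𝓝 0) := by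
    have h3 : Tendsto (fun X : ℝ => (PB (K+1) X : ℂ) * (X : ℂ) ^ (-s - K)) atTop (𝓝 0) := by
      apply squeeze_zero_norm' (a := fun X : ℝ => C * X ^ (-(s.re + K)))
      · filter_upwards [eventually_gt_atTop 0] with X hX
        rw [norm_mul, Complex.norm_real, Real.norm_eq_abs, Complex.norm_cpow_eq_rpow_re_of_pos hX]
        have : (-s - K).re = -(s.re + K) := by simp; ring
        rw [this]
        gcongr
        exact hC X
      · have := (tendsto_rpow_neg_atTop (y := s.re + K) (by linarith)).const_mul C
        simpa using this
    simpa using h3.div_const ((K:ℂ) + 1)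
  have h4 := (h2.sub_const ((bernoulliFun (K+1) 0 : ℂ) / (K + 1))).add (h1.const_mul ((s + K) / (K + 1)))
  have e : 0 - (bernoulliFun (K+1) 0 : ℂ) / (K + 1) + (s + K) / (K + 1) * JJ (K+1) s = (- (bernoulliFun (K+1) 0 : ℂ) / (K + 1) + (s + K) / (K + 1) * JJ (K+1) s) := by ring
  rw [e] at h4
  refine h4.congr' ?_
  filter_upwards [eventually_ge_atTop 1] with X hX
  rw [BP K hK s X hX]

lemma JJ_rec (K : ℕ) (hK : 1 ≤ K) (s : ℂ) (hs : 1 - K < s.re) :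
    JJ K s = - (bernoulliFun (K+1) 0 : ℂ) / (K + 1) + (s + K) / (K + 1) * JJ (K+1) s :=
  tendsto_nhds_unique (JJ_tendsto K s hs) (trunc_tendsto K hK s (by linarith))

lemma zeta_base (s : ℂ) (hs : 1 < s.re) : riemannZeta s = 1 / (s - 1) + 1/2 - s * JJ 1 s := by
  have hs1 : s - 1 ≠ 0 := by
    intro h; rw [sub_eq_zero] at h; rw [h] at hs; simp at hs
  have hs0 : s ≠ 0 := by intro h; rw [h] at hs; simp at hs; linarith
  have h1 := LSeries_eq_mul_integral' (fun _ => 1) zero_le_one hs (by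
    simp only [norm_one, Finset.sum_const, Nat.card_Icc, smul_eq_mul, mul_one]
    simp only [add_tsub_cancel_right, nsmul_eq_mul, mul_one, Real.rpow_one]
    exact Asymptotics.isBigO_refl _ _)
  rw [← LSeriesHasSum_one hs |>.LSeries_eq]
  have e0 : LSeries 1 s = LSeries (fun _ => 1) s := rfl
  rw [e0, h1]
  have i1 : IntegrableOn (fun x : ℝ => (x:ℂ) ^ (-s)) (Ioi 1) :=
    integrableOn_Ioi_cpow_of_lt (by simp; linarith) zero_lt_one
  have i2 : IntegrableOn (fun x : ℝ => (x:ℂ) ^ (-s - 1)) (Ioi 1) :=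
    integrableOn_Ioi_cpow_of_lt (by simp; linarith) zero_lt_one
  have i3 := PB_integrable 1 s (by simp; linarith)
  have e : ∫ t in Ioi (1 : ℝ), (∑ k ∈ Finset.Icc 1 ⌊t⌋₊, (1:ℂ)) * (t:ℂ) ^ (-(s + 1)) =
      ∫ t in Ioi (1 : ℝ), ((t:ℂ) ^ (-s) - 1/2 * (t:ℂ) ^ (-s - 1) - (PB 1 t : ℂ) * (t : ℂ) ^ (-s - (1:ℕ))) := by
    apply setIntegral_congr_fun measurableSet_Ioi
    intro t ht
    have ht0 : (0:ℝ) < t := lt_trans zero_lt_one ht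
    have hf : ((⌊t⌋₊ : ℂ)) = (t : ℂ) - ((Int.fract t : ℝ) : ℂ) := by
      have : (⌊t⌋₊ : ℝ) = (⌊t⌋ : ℝ) := natCast_floor_eq_intCast_floor ht0.le
      have h3 : (⌊t⌋₊ : ℝ) = t - Int.fract t := by rw [this]; exact (Int.self_sub_fract t).symm
      exact_mod_cast congrArg (fun x : ℝ => (x : ℂ)) h3
    have hm : (t:ℂ) ^ (-s) = (t:ℂ) * (t:ℂ) ^ (-s - 1) := by
      rw [Complex.cpow_sub _ _ (by exact_mod_cast ht0.ne'), Complex.cpow_one]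
      field_simp [show (t:ℂ) ≠ 0 by exact_mod_cast ht0.ne']
    simp only [Finset.sum_const, Nat.card_Icc, add_tsub_cancel_right, nsmul_eq_mul, mul_one]
    rw [hf, hm, PB, bernoulliFun_one, show -(s+1) = -s - 1 by ring]
    push_cast
    ring
  have hsum : ∫ t in Ioi (1 : ℝ), ((t:ℂ) ^ (-s) - 1/2 * (t:ℂ) ^ (-s - 1) - (PB 1 t : ℂ) * (t : ℂ) ^ (-s - (1:ℕ))) =
      (∫ t in Ioi (1 : ℝ), (t:ℂ) ^ (-s)) - 1/2 * (∫ t in Ioi (1 : ℝ), (t:ℂ) ^ (-s - 1)) - JJ 1 s := by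
    have i4 : IntegrableOn (fun t : ℝ => (t:ℂ) ^ (-s) - 1/2 * (t:ℂ) ^ (-s - 1)) (Ioi 1) := i1.sub (i2.const_mul _)
    rw [integral_sub i4 i3, integral_sub i1 (i2.const_mul _), integral_const_mul]
    rfl
  have v1 : ∫ t in Ioi (1 : ℝ), (t:ℂ) ^ (-s) = 1 / (s - 1) := by
    rw [integral_Ioi_cpow_of_lt (by simp; linarith) zero_lt_one]
    simp
    rw [← one_div (s-1), div_eq_div_iff (show (-s+1:ℂ) ≠ 0 by intro h; apply hs1; linear_combination -h) hs1]; ring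
  have v2 : ∫ t in Ioi (1 : ℝ), (t:ℂ) ^ (-s - 1) = 1 / s := by
    rw [integral_Ioi_cpow_of_lt (by simp; linarith) zero_lt_one]
    simp
  rw [e, hsum, v1, v2]
  field_simp
  ring

open Polynomial in
lemma zeta_right (K : ℕ) (hK : 1 ≤ K) : ∃ p : ℂ[X], p.natDegree + 1 ≤ K ∧ ∀ s : ℂ, 1 < s.re →
    riemannZeta s = 1 / (s - 1) + p.eval s - (ascPochhammer ℂ K).eval s / K.factorial * JJ K s := by
  induction K, hK using Nat.le_induction with
  | base => exact ⟨C (1/2), by simp, fun s hs => by rw [zeta_base s hs]; simp⟩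
  | succ K hK ih =>
    obtain ⟨p, hp, h⟩ := ih
    refine ⟨p + C ((bernoulliFun (K+1) 0 : ℂ) / (K + 1) / K.factorial) * ascPochhammer ℂ K, ?_, ?_⟩
    · have h1 := natDegree_add_le p (C ((bernoulliFun (K+1) 0 : ℂ) / (K + 1) / K.factorial) * ascPochhammer ℂ K)
      have h2 := natDegree_C_mul_le ((bernoulliFun (K+1) 0 : ℂ) / (K + 1) / K.factorial) (ascPochhammer ℂ K)
      rw [ascPochhammer_natDegree] at h2
      omega
    · intro s hs
      have hK0 : (0:ℝ) ≤ K := Nat.cast_nonneg K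
      rw [h s hs, JJ_rec K hK s (by linarith), ascPochhammer_succ_eval, Nat.factorial_succ]
      have hK1 : (K:ℂ) + 1 ≠ 0 := by exact_mod_cast Nat.succ_ne_zero K
      have hf : (K.factorial : ℂ) ≠ 0 := by exact_mod_cast K.factorial_ne_zero
      simp only [eval_add, eval_mul, eval_C]
      push_cast
      field_simp
      ring

lemma JJ_diff (K : ℕ) (s : ℂ) (hs : 1 - K < s.re) : DifferentiableAt ℂ (JJ K) s := by
  obtain ⟨C, hC0, hC⟩ := PB_bdd K
  set f : ℝ → ℂ := (Ioi (1:ℝ)).indicator (fun x => (PB K x : ℂ)) with hf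
  have hb : ∀ x, ‖f x‖ ≤ C := by
    intro x
    rw [hf, indicator_apply]
    split_ifs
    · simpa using hC x
    · simpa using hC0.le
  have hm : Measurable f := (Complex.measurable_ofReal.comp (PB_meas K)).indicator measurableSet_Ioi
  have e : JJ K = (mellin f) ∘ (fun s => -s - K + 1) := by
    ext s
    unfold JJ mellin
    simp only [Function.comp, smul_eq_mul, hf]
    have : ∀ t : ℝ, (t:ℂ) ^ (-s - K + 1 - 1) * (Ioi (1:ℝ)).indicator (fun x => (PB K x : ℂ)) t =
      (Ioi (1:ℝ)).indicator (fun x => (PB K x : ℂ) * (x : ℂ) ^ (-s - K)) t := by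
      intro t
      rw [indicator_apply, indicator_apply]
      split_ifs
      · rw [mul_comm]; congr 2; ring
      · simp
    simp_rw [this]
    rw [setIntegral_indicator measurableSet_Ioi]
    congr 2
    ext x; simp
  rw [e]
  apply DifferentiableAt.comp
  · apply mellin_differentiableAt_of_isBigO_rpow (a := 0) (b := (-s - K + 1).re - 1)
    · apply LocallyIntegrable.locallyIntegrableOn
      exact (locallyIntegrable_const C).mono hm.aestronglyMeasurable
        (Eventually.of_forall fun x => (hb x).trans (le_abs_self C))
    · apply Asymptotics.IsBigO.of_bound C
      refine Eventually.of_forall fun x => ?_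
      simpa using hb x
    · simp; linarith
    · apply Asymptotics.IsBigO.of_bound 0
      have : Ioo (0:ℝ) 1 ∈ 𝓝[>] (0:ℝ) := Ioo_mem_nhdsGT zero_lt_one
      filter_upwards [this] with x hx
      simp [hf, hx.2.le]
    · linarith
  · fun_prop

/-- main zeta formula -/
lemma zeta_formula (K : ℕ) (hK : 1 ≤ K) : ∃ p : Polynomial ℂ, p.natDegree + 1 ≤ K ∧ ∀ s : ℂ, -K < s.re → s.im ≠ 0 →
    Tendsto (fun X : ℝ => 1 / (s - 1) + p.eval s - (ascPochhammer ℂ K).eval s / K.factorial *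
      ∫ x in (1:ℝ)..X, (PB K x : ℂ) * (x : ℂ) ^ (-s - K)) atTop (𝓝 (riemannZeta s)) := by
  obtain ⟨p, hp, h⟩ := zeta_right K hK
  refine ⟨p, hp, ?_⟩
  intro s hs him
  have hK0 : (0:ℝ) ≤ K := Nat.cast_nonneg K
  set U : Set ℂ := {z | -K < z.re ∧ 0 < z.im * s.im} with hU
  have hUo : IsOpen U := by
    apply IsOpen.inter
    · exact isOpen_lt continuous_const Complex.continuous_re
    · exact isOpen_lt continuous_const (Complex.continuous_im.mul continuous_const)
  have hUc : Convex ℝ U := by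
    apply Convex.inter
    · exact convex_halfSpace_re_gt _
    · intro x hx y hy a b ha hb hab
      have hx : 0 < x.im * s.im := hx
      have hy : 0 < y.im * s.im := hy
      show 0 < (a • x + b • y).im * s.im
      simp only [Complex.add_im, Complex.smul_im, smul_eq_mul]
      rcases ha.eq_or_lt with rfl | ha
      · simp at hab; subst hab; simpa using hy
      · have : 0 < a * (x.im * s.im) := by positivity
        have : 0 ≤ b * (y.im * s.im) := by positivity
        nlinarith
  set G : ℂ → ℂ := fun s => 1 / (s - 1) + p.eval s - (ascPochhammer ℂ K).eval s / K.factorial *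
    (- (bernoulliFun (K+1) 0 : ℂ) / (K + 1) + (s + K) / (K + 1) * JJ (K+1) s) with hG
  have hne : ∀ z ∈ U, z ≠ 1 := by
    rintro z hz rfl
    have := hz.2
    simp at this
  have hGd : DifferentiableOn ℂ G U := by
    intro z hz
    apply DifferentiableAt.differentiableWithinAt
    have h1 := JJ_diff (K+1) z (by push_cast; linarith [hz.1])
    have h2 : z - 1 ≠ 0 := sub_ne_zero.2 (hne z hz)
    rw [hG]
    fun_prop (disch := assumption)
  have hZd : DifferentiableOn ℂ riemannZeta U := fun z hz =>
    (differentiableAt_riemannZeta (hne z hz)).differentiableWithinAt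
  set z0 : ℂ := ⟨2, s.im⟩
  have hz0 : z0 ∈ U := ⟨by show -(K:ℝ) < 2; linarith, by show 0 < s.im * s.im; exact mul_self_pos.2 him⟩
  have heq : EqOn riemannZeta G U := by
    apply (hZd.analyticOnNhd hUo).eqOn_of_preconnected_of_eventuallyEq (hGd.analyticOnNhd hUo) hUc.isPreconnected hz0
    have : {z : ℂ | 1 < z.re} ∈ 𝓝 z0 := (isOpen_lt continuous_const Complex.continuous_re).mem_nhds (by show (1:ℝ) < 2; norm_num)
    filter_upwards [this] with z hz
    rw [h z hz, hG]
    simp only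
    rw [← JJ_rec K hK z (by linarith [show 1 < z.re from hz])]
  rw [heq ⟨hs, mul_self_pos.2 him⟩, hG]
  exact ((trunc_tendsto K hK s hs).const_mul _).const_sub _

noncomputable def FI (K : ℕ) (L α : ℝ) (n : ℤ) (c : ℝ) : ℂ :=
  ∫ u in (-(log α / L))..c, (PB K (α * exp (L * u)) : ℂ) * ee (-(n * u))

lemma cv (k : ℕ) (L α : ℝ) (hL : 0 < L) (hα : 0 < α) (n : ℤ) (c : ℝ) (hc : -(log α / L) ≤ c) :
    ∫ x in (1:ℝ)..(α * exp (L * c)), (PB (k+1) x : ℂ) * (x : ℂ) ^ (-(-(k : ℂ) + 2 * (pi : ℂ) * I * (n : ℂ) / (L : ℂ)) - ((k+1 : ℕ) : ℂ)) =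
      L * ee (-(n * (log α / L))) * FI (k+1) L α n c := by
  set f : ℝ → ℝ := fun u => α * exp (L * u) with hf
  have hmono : StrictMono f := by
    intro x y h
    simp only [hf]
    have : exp (L * x) < exp (L * y) := Real.exp_lt_exp.2 (by nlinarith)
    nlinarith
  have hder : ∀ x, HasDerivAt f (L * f x) x := by
    intro x
    have := (((hasDerivAt_id x).const_mul L).exp).const_mul α
    refine this.congr_deriv ?_
    simp [hf]; ring
  have hcont : Continuous f := by rw [hf]; fun_prop
  have h1 : f (-(log α / L)) = 1 := by
    simp only [hf]
    rw [show L * -(log α / L) = - log α by field_simp, Real.exp_neg, Real.exp_log hα]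
    field_simp
  have himg : f '' Ioc (-(log α / L)) c = Ioc 1 (f c) := by
    ext y
    constructor
    · rintro ⟨x, hx, rfl⟩
      exact ⟨by rw [← h1]; exact hmono hx.1, hmono.monotone hx.2⟩
    · intro hy
      have := intermediate_value_Ioc hc hcont.continuousOn
      rw [h1] at this
      exact this hy
  have h1c : 1 ≤ f c := by rw [← h1]; exact hmono.monotone hc
  have hfc : α * exp (L * c) = f c := rfl
  rw [hfc, intervalIntegral.integral_of_le h1c, ← himg,
    integral_image_eq_integral_deriv_smul_of_monotoneOn measurableSet_Ioc (fun x hx => (hder x).hasDerivWithinAt) (hmono.monotone.monotoneOn _), FI, intervalIntegral.integral_of_le hc, ← integral_const_mul]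
  apply setIntegral_congr_fun measurableSet_Ioc
  intro u hu
  simp only
  have hfpos : 0 < f u := by simp only [hf]; positivity
  have hlog : log (f u) = log α + L * u := by
    simp only [hf]
    rw [Real.log_mul hα.ne' (Real.exp_pos _).ne', Real.log_exp]
  have hLc : (L:ℂ) ≠ 0 := by exact_mod_cast hL.ne'
  have hfc' : (f u : ℂ) ≠ 0 := by exact_mod_cast hfpos.ne'
  have e1 : (f u : ℂ) ^ (-(-(k : ℂ) + 2 * (pi : ℂ) * I * (n : ℂ) / (L : ℂ)) - ((k+1 : ℕ) : ℂ)) = (f u : ℂ)⁻¹ * ee (-(n * (log α / L))) * ee (-(n * u)) := by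
    rw [show (-(-(k : ℂ) + 2 * (pi : ℂ) * I * (n : ℂ) / (L : ℂ)) - ((k+1 : ℕ) : ℂ)) = -1 + (-(2 * (pi : ℂ) * I * (n : ℂ) / (L : ℂ))) by push_cast; ring,
      Complex.cpow_add _ _ hfc', Complex.cpow_neg_one, mul_assoc (f u : ℂ)⁻¹, ← ee_add]
    congr 1
    rw [Complex.cpow_def_of_ne_zero hfc', ← Complex.ofReal_log hfpos.le, hlog, ee]
    congr 1
    push_cast
    field_simp
    ring
  rw [e1, Complex.real_smul]
  push_cast
  have : α * exp (L * u) = f u := rfl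
  rw [this]
  field_simp

lemma zeta_lim (k : ℕ) : ∃ p : Polynomial ℂ, p.natDegree ≤ k ∧ ∀ (L α : ℝ), 0 < L → 0 < α → ∀ n : ℤ, n ≠ 0 →
    Tendsto (fun J : ℕ => (1 / (-(k : ℂ) + 2 * (pi : ℂ) * I * (n : ℂ) / (L : ℂ) - 1) +
        p.eval (-(k : ℂ) + 2 * (pi : ℂ) * I * (n : ℂ) / (L : ℂ))) * ee (n * (log α / L)) / (n:ℂ)^(k+1)
        - (ascPochhammer ℂ (k+1)).eval (-(k : ℂ) + 2 * (pi : ℂ) * I * (n : ℂ) / (L : ℂ)) / (n:ℂ)^(k+1) * (L / (k+1).factorial) *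
          FI (k+1) L α n (J - 1/2)) atTop
      (𝓝 (riemannZeta (-(k : ℂ) + 2 * (pi : ℂ) * I * (n : ℂ) / (L : ℂ)) *
                  Complex.exp (2 * (pi : ℂ) * I * (n : ℂ) * (log α : ℂ) / (L : ℂ)) / (n : ℂ) ^ (k + 1))) := by
  obtain ⟨p, hp, h⟩ := zeta_formula (k+1) (by omega)
  refine ⟨p, by omega, ?_⟩
  intro L α hL hα n hn
  have hp := Real.pi_pos
  have hnr : (n:ℝ) ≠ 0 := by exact_mod_cast hn
  set s : ℂ := -(k : ℂ) + 2 * (pi : ℂ) * I * (n : ℂ) / (L : ℂ) with hs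
  have hs' : s = ((-k : ℝ) : ℂ) + ((2 * pi * n / L : ℝ) : ℂ) * I := by
    rw [hs]; push_cast; ring
  have hre : s.re = -k := by rw [hs']; simp
  have him : s.im = 2 * pi * n / L := by
    rw [hs', Complex.add_im, Complex.ofReal_im, Complex.im_ofReal_mul]; simp
  have h1 := h s (by rw [hre]; push_cast; linarith) (by rw [him]; positivity)
  have hX : Tendsto (fun J : ℕ => α * exp (L * ((J:ℝ) - 1/2))) atTop atTop := by
    apply Tendsto.const_mul_atTop hα
    apply Real.tendsto_exp_atTop.comp
    apply Tendsto.const_mul_atTop hL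
    exact tendsto_atTop_add_const_right _ _ tendsto_natCast_atTop_atTop
  have h2 := ((h1.comp hX).mul_const (ee (n * (log α / L)))).div_const ((n:ℂ)^(k+1))
  have e3 : ee (n * (log α / L)) = Complex.exp (2 * (pi : ℂ) * I * (n : ℂ) * (log α : ℂ) / (L : ℂ)) := by
    rw [ee]; congr 1; push_cast; ring
  rw [← e3]
  refine h2.congr' ?_
  have hev : ∀ᶠ J : ℕ in atTop, -(log α / L) ≤ (J:ℝ) - 1/2 := by
    have := (tendsto_natCast_atTop_atTop (R := ℝ)).eventually_ge_atTop (-(log α / L) + 1/2)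
    filter_upwards [this] with J hJ
    linarith
  filter_upwards [hev] with J hJ
  have h4 := cv k L α hL hα n _ hJ
  rw [← hs] at h4
  simp only [Function.comp]
  rw [h4]
  have e5 : ee (-(n * (log α / L))) * ee (n * (log α / L)) = 1 := by
    rw [← ee_add]; simp [ee]
  rw [sub_mul, sub_div]
  congr 1
  rw [show (ascPochhammer ℂ (k+1)).eval s / ((k+1).factorial:ℂ) * (L * ee (-(n * (log α / L))) * FI (k+1) L α n (J - 1/2)) * ee (n * (log α / L)) = (ascPochhammer ℂ (k+1)).eval s / ((k+1).factorial:ℂ) * (L * FI (k+1) L α n (J - 1/2)) * (ee (-(n * (log α / L))) * ee (n * (log α / L))) by ring, e5]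
  ring

lemma sum_NZ {M : Type*} [AddCommMonoid M] (g : ℤ → M) (N : ℕ) :
    ∑ n ∈ (Finset.Icc (-(N:ℤ)) N).erase 0, g n = ∑ n ∈ range N, (g ((n:ℤ)+1) + g (-((n:ℤ)+1))) := by
  induction N with
  | zero => simp
  | succ N ih =>
    rw [Finset.sum_range_succ, ← ih]
    have : (Finset.Icc (-((N+1:ℕ):ℤ)) ((N+1:ℕ):ℤ)).erase 0 =
        insert ((N:ℤ)+1) (insert (-((N:ℤ)+1)) ((Finset.Icc (-(N:ℤ)) N).erase 0)) := by
      ext x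
      simp only [Finset.mem_erase, Finset.mem_Icc, Finset.mem_insert]
      push_cast
      omega
    rw [this, Finset.sum_insert, Finset.sum_insert, ← add_assoc, add_comm]
    · simp only [Finset.mem_erase, Finset.mem_Icc]; omega
    · simp only [Finset.mem_insert, Finset.mem_erase, Finset.mem_Icc]; omega

lemma ee_add_neg (x : ℝ) : ee x + ee (-x) = (2 * cos (2 * pi * x) : ℝ) := by
  unfold ee
  rw [Complex.ofReal_mul 2 (cos _), Complex.ofReal_cos, Complex.ofReal_ofNat, Complex.two_cos]
  congr 2
  push_cast; ring

lemma ee_sub_neg (x : ℝ) : ee x - ee (-x) = (2 * sin (2 * pi * x) : ℝ) * I := by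
  unfold ee
  rw [Complex.ofReal_mul 2 (sin _), Complex.ofReal_sin, Complex.ofReal_ofNat, Complex.two_sin, mul_assoc _ I I, Complex.I_mul_I]
  simp

lemma sum_NZ_ee (N : ℕ) (u : ℝ) : ∑ n ∈ (Finset.Icc (-(N:ℤ)) N).erase 0, ee (-((n:ℤ) * u)) = (Dk N u : ℂ) - 1 := by
  rw [sum_NZ, Dk, Finset.mul_sum]
  push_cast
  rw [add_sub_cancel_left]
  apply Finset.sum_congr rfl
  intro n _
  have := ee_add_neg (((n:ℝ)+1) * u)
  rw [add_comm] at this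
  rw [show -(-((n:ℝ)+1) * u) = (((n:ℝ)+1) * u) by ring, this]
  push_cast
  congr 2; ring

lemma sin_sum_bdd (N : ℕ) (x : ℝ) : |∑ n ∈ range N, sin (2 * pi * (n + 1) * x) / (pi * (n + 1))| ≤ 3 := by
  have key : ∀ y, 0 ≤ y → y ≤ 1/2 → |∑ n ∈ range N, sin (2 * pi * (n + 1) * y) / (pi * (n + 1))| ≤ 3 := by
    intro y h0 h1
    have := abs_le.1 (int_Dk_abs N y h0 h1)
    rw [int_Dk] at this
    rw [abs_le]; constructor <;> linarith
  have e : ∀ y : ℝ, ∀ m : ℤ, x = y + m → ∑ n ∈ range N, sin (2 * pi * (n + 1) * x) / (pi * (n + 1)) = ∑ n ∈ range N, sin (2 * pi * (n + 1) * y) / (pi * (n + 1)) := by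
    rintro y m rfl
    apply Finset.sum_congr rfl
    intro n _
    congr 1
    rw [show 2 * pi * ((n:ℝ)+1) * (y + m) = 2 * pi * (n+1) * y + ((((n:ℤ)+1)*m : ℤ):ℝ) * (2 * pi) by push_cast; ring, Real.sin_add_int_mul_two_pi]
  have h := abs_sub_round x
  rw [e (x - round x) (round x) (by ring)]
  rcases le_total 0 (x - round x) with h0 | h0
  · exact key _ h0 (le_of_abs_le h)
  · have := key (-(x - round x)) (by linarith) (by linarith [neg_le_of_abs_le h])
    simp only [mul_neg, Real.sin_neg, neg_div, Finset.sum_neg_distrib, abs_neg] at this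
    exact this

lemma sum_NZ_sin (N : ℕ) (θ : ℝ) : ‖∑ n ∈ (Finset.Icc (-(N:ℤ)) N).erase 0, ee ((n:ℤ) * θ) / (n:ℂ)‖ ≤ 6 * pi := by
  rw [sum_NZ]
  have : ∑ n ∈ range N, (ee ((((n:ℤ)+1 : ℤ):ℝ) * θ) / ((((n:ℤ)+1 : ℤ)):ℂ) + ee (((-((n:ℤ)+1) : ℤ):ℝ) * θ) / (((-((n:ℤ)+1) : ℤ)):ℂ)) =
     (2 * pi * ∑ n ∈ range N, sin (2 * pi * (n + 1) * θ) / (pi * (n + 1)) : ℝ) * I := by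
    rw [Finset.mul_sum, Complex.ofReal_sum, Finset.sum_mul]
    apply Finset.sum_congr rfl
    intro n _
    have := ee_sub_neg (((n:ℝ)+1) * θ)
    have hn : (n:ℂ) + 1 ≠ 0 := by exact_mod_cast Nat.succ_ne_zero n
    have hn' : (n:ℝ) + 1 ≠ 0 := by exact_mod_cast Nat.succ_ne_zero n
    have hp := Real.pi_pos.ne'
    push_cast
    rw [show -((n:ℝ)+1) * θ = -(((n:ℝ)+1) * θ) by ring, div_neg, ← sub_eq_add_neg, ← sub_div, this]
    rw [show 2 * pi * (((n:ℝ)+1) * θ) = 2 * pi * (n+1) * θ by ring]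
    push_cast
    have hpc : (pi : ℂ) ≠ 0 := by exact_mod_cast hp
    field_simp
  rw [this, norm_mul, Complex.norm_I, mul_one, Complex.norm_real, Real.norm_eq_abs, abs_mul, abs_of_pos (by have := Real.pi_pos; positivity : 0 < 2 * pi)]
  have := sin_sum_bdd N θ
  have := Real.pi_pos
  nlinarith

lemma sum_NZ_small : ∃ D : ℝ, 0 < D ∧ ∀ (N : ℕ) (g : ℤ → ℂ) (C : ℝ), 0 ≤ C → (∀ n : ℤ, n ≠ 0 → ‖g n‖ ≤ C * |(n:ℝ)| ^ (-(3/2):ℝ)) →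
    ‖∑ n ∈ (Finset.Icc (-(N:ℤ)) N).erase 0, g n‖ ≤ D * C := by
  have hs : Summable (fun n : ℕ => ((n+1:ℕ):ℝ) ^ (-(3/2):ℝ)) :=
    (summable_nat_add_iff 1).2 (Real.summable_nat_rpow.2 (by norm_num))
  refine ⟨2 * (∑' n : ℕ, ((n+1:ℕ):ℝ) ^ (-(3/2):ℝ)) + 1, ?_, ?_⟩
  · have : 0 ≤ ∑' n : ℕ, ((n+1:ℕ):ℝ) ^ (-(3/2):ℝ) := tsum_nonneg fun n => by positivity
    linarith
  · intro N g C hC h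
    rw [sum_NZ]
    have h1 : ∀ n ∈ range N, ‖g ((n:ℤ)+1) + g (-((n:ℤ)+1))‖ ≤ 2 * C * ((n+1:ℕ):ℝ) ^ (-(3/2):ℝ) := by
      intro n _
      have a1 := h ((n:ℤ)+1) (by omega)
      have a2 := h (-((n:ℤ)+1)) (by omega)
      have e1 : |(((n:ℤ)+1:ℤ):ℝ)| = ((n+1:ℕ):ℝ) := by push_cast; exact abs_of_nonneg (by positivity)
      have e2 : |((-((n:ℤ)+1):ℤ):ℝ)| = ((n+1:ℕ):ℝ) := by push_cast; rw [← abs_neg, neg_neg]; exact abs_of_nonneg (by positivity)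
      rw [e1] at a1; rw [e2] at a2
      refine (norm_add_le _ _).trans ?_
      linarith
    refine (norm_sum_le_of_le _ h1).trans ?_
    rw [← Finset.mul_sum]
    have := hs.sum_le_tsum (range N) (fun i _ => by positivity)
    nlinarith

lemma poly_asym (q : Polynomial ℂ) (d : ℕ) (hd : q.natDegree ≤ d) : ∃ C : ℝ, 0 ≤ C ∧ ∀ n : ℤ, n ≠ 0 →
    ‖q.eval (n:ℂ) / (n:ℂ)^d - q.coeff d‖ ≤ C / |(n:ℝ)| := by
  refine ⟨∑ i ∈ range d, ‖q.coeff i‖, by positivity, ?_⟩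
  intro n hn
  have hnc : (n:ℂ) ≠ 0 := by exact_mod_cast hn
  have hn1 : (1:ℝ) ≤ |(n:ℝ)| := by exact_mod_cast Int.one_le_abs hn
  rw [Polynomial.eval_eq_sum_range' (show q.natDegree < d + 1 by omega), Finset.sum_range_succ, add_div, mul_div_assoc (q.coeff d), div_self (pow_ne_zero _ hnc), mul_one, add_sub_cancel_right, Finset.sum_div, Finset.sum_div]
  apply norm_sum_le_of_le
  intro i hi
  rw [Finset.mem_range] at hi
  rw [norm_div, norm_mul, norm_pow, norm_pow, Complex.norm_intCast]
  rw [div_le_div_iff₀ (by positivity) (by positivity), mul_assoc]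
  apply mul_le_mul_of_nonneg_left _ (norm_nonneg _)
  rw [← pow_succ]
  exact pow_le_pow_right₀ hn1 hi

/-- elementary terms -/
lemma elem_terms (k : ℕ) (L : ℝ) (hL : 0 < L) (p : Polynomial ℂ) (hp : p.natDegree ≤ k) :
    ∃ C : ℝ, ∀ (θ : ℝ) (N : ℕ), ‖∑ n ∈ (Finset.Icc (-(N:ℤ)) N).erase 0,
      (1 / (-(k : ℂ) + 2 * (pi : ℂ) * I * (n : ℂ) / (L : ℂ) - 1) +
        p.eval (-(k : ℂ) + 2 * (pi : ℂ) * I * (n : ℂ) / (L : ℂ))) * ee (n * θ) / (n:ℂ)^(k+1)‖ ≤ C := by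
  have hpi := Real.pi_pos
  set q : Polynomial ℂ := p.comp (Polynomial.C (2 * (pi : ℂ) * I / L) * Polynomial.X + Polynomial.C (-(k:ℂ))) with hq
  have hqd : q.natDegree ≤ k := by
    refine Polynomial.natDegree_comp_le.trans ?_
    refine (Nat.mul_le_mul hp (Polynomial.natDegree_linear_le)).trans (by simp)
  obtain ⟨C1, hC1, h1⟩ := poly_asym q k hqd
  obtain ⟨D, hD, h2⟩ := sum_NZ_small
  have hqe : ∀ n : ℤ, p.eval (-(k : ℂ) + 2 * (pi : ℂ) * I * (n : ℂ) / (L : ℂ)) = q.eval (n:ℂ) := by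
    intro n
    rw [hq]; simp only [Polynomial.eval_comp, Polynomial.eval_add, Polynomial.eval_mul, Polynomial.eval_C, Polynomial.eval_X]
    congr 1; ring
  refine ⟨D * (L / (2 * pi) + C1) + ‖q.coeff k‖ * (6 * pi), ?_⟩
  intro θ N
  have hsplit : ∑ n ∈ (Finset.Icc (-(N:ℤ)) N).erase 0,
      (1 / (-(k : ℂ) + 2 * (pi : ℂ) * I * (n : ℂ) / (L : ℂ) - 1) +
        p.eval (-(k : ℂ) + 2 * (pi : ℂ) * I * (n : ℂ) / (L : ℂ))) * ee (n * θ) / (n:ℂ)^(k+1) =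
      ∑ n ∈ (Finset.Icc (-(N:ℤ)) N).erase 0, ((1 / (-(k : ℂ) + 2 * (pi : ℂ) * I * (n : ℂ) / (L : ℂ) - 1)) * ee (n * θ) / (n:ℂ)^(k+1) + (q.eval (n:ℂ) / (n:ℂ)^k - q.coeff k) * ee (n * θ) / (n:ℂ)) + q.coeff k * ∑ n ∈ (Finset.Icc (-(N:ℤ)) N).erase 0, ee ((n:ℤ) * θ) / (n:ℂ) := by
    rw [Finset.mul_sum, ← Finset.sum_add_distrib]
    apply Finset.sum_congr rfl
    intro n hn
    have hn0 : (n:ℂ) ≠ 0 := by exact_mod_cast (Finset.mem_erase.1 hn).1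
    rw [hqe, pow_succ]
    field_simp
    ring
  rw [hsplit]
  refine (norm_add_le _ _).trans ?_
  apply add_le_add
  · apply h2 N _ _ (by positivity)
    intro n hn
    have hn1 : (1:ℝ) ≤ |(n:ℝ)| := by exact_mod_cast Int.one_le_abs hn
    have hn0 : 0 < |(n:ℝ)| := by linarith
    have hpw : 1 / (|(n:ℝ)| * |(n:ℝ)|) ≤ |(n:ℝ)| ^ (-(3/2):ℝ) := by
      rw [← pow_two, one_div, ← Real.rpow_natCast, ← Real.rpow_neg hn0.le]
      exact Real.rpow_le_rpow_of_exponent_le hn1 (by norm_num)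
    rw [add_mul]
    refine (norm_add_le _ _).trans (add_le_add ?_ ?_)
    · rw [norm_div, norm_mul, norm_ee, mul_one, norm_div, norm_one, norm_pow, Complex.norm_intCast]
      have hs : 2 * pi * |(n:ℝ)| / L ≤ ‖(-(k : ℂ) + 2 * (pi : ℂ) * I * (n : ℂ) / (L : ℂ) - 1)‖ := by
        refine le_trans ?_ (Complex.abs_im_le_norm _)
        have : (-(k : ℂ) + 2 * (pi : ℂ) * I * (n : ℂ) / (L : ℂ) - 1) = ((-k - 1 : ℝ):ℂ) + ((2 * pi * n / L : ℝ) : ℂ) * I := by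
          push_cast; ring
        rw [this, Complex.add_im, Complex.ofReal_im, Complex.im_ofReal_mul]
        simp only [Complex.I_im, mul_one, zero_add]
        rw [abs_div, abs_mul, abs_of_pos hL, abs_of_pos (by positivity : 0 < 2 * pi)]
      have h3 : |(n:ℝ)| ≤ |(n:ℝ)| ^ (k+1) := le_self_pow₀ hn1 (by omega)
      calc 1 / ‖(-(k : ℂ) + 2 * (pi : ℂ) * I * (n : ℂ) / (L : ℂ) - 1)‖ / |(n:ℝ)| ^ (k+1)
          ≤ 1 / (2 * pi * |(n:ℝ)| / L) / |(n:ℝ)| := by gcongr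
        _ = L / (2 * pi) * (1 / (|(n:ℝ)| * |(n:ℝ)|)) := by field_simp
        _ ≤ _ := by gcongr
    · rw [norm_div, norm_mul, norm_ee, mul_one, Complex.norm_intCast]
      calc _ ≤ C1 / |(n:ℝ)| / |(n:ℝ)| := by gcongr; exact h1 n hn
        _ = C1 * (1 / (|(n:ℝ)| * |(n:ℝ)|)) := by field_simp
        _ ≤ _ := by gcongr
  · rw [norm_mul]
    gcongr
    exact sum_NZ_sin N θ

noncomputable def pm (K : ℕ) (m : ℤ) : ℂ := -(K.factorial : ℂ) / (2 * pi * I * m) ^ K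

lemma ee_int (m : ℤ) : ee m = 1 := by
  unfold ee
  rw [show ((2 * pi * (m:ℝ) : ℝ) : ℂ) * I = m * (2 * pi * I) by push_cast; ring]
  exact Complex.exp_int_mul_two_pi_mul_I m

lemma ee_fract (m : ℤ) (x : ℝ) : ee (m * Int.fract x) = ee (m * x) := by
  conv_rhs => rw [← Int.fract_add_floor x, mul_add, ee_add]
  have : ee ((m:ℝ) * (⌊x⌋:ℝ)) = 1 := by
    have := ee_int (m * ⌊x⌋)
    push_cast at this
    exact this
  rw [this, mul_one]

lemma ee_conj (x : ℝ) : (starRingEnd ℂ) (ee x) = ee (-x) := by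
  unfold ee
  rw [← Complex.exp_conj, map_mul, Complex.conj_ofReal, Complex.conj_I]
  congr 1
  push_cast; ring

lemma PB_hasSum (K : ℕ) (hK : 2 ≤ K) (x : ℝ) : HasSum (fun m : ℤ => pm K m * ee (m * x)) (PB K x : ℂ) := by
  have h := hasSum_one_div_pow_mul_fourier_mul_bernoulliFun hK (x := Int.fract x) ⟨Int.fract_nonneg x, (Int.fract_lt_one x).le⟩
  have hpc : (pi : ℂ) ≠ 0 := by exact_mod_cast Real.pi_ne_zero
  have hne : (2 * pi * I : ℂ) ≠ 0 := by simp [hpc]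
  have hf : (K.factorial : ℂ) ≠ 0 := by exact_mod_cast K.factorial_ne_zero
  have h2 := h.mul_left (-(K.factorial : ℂ) / (2 * pi * I) ^ K)
  have e : -(K.factorial : ℂ) / (2 * pi * I) ^ K * (-(2 * pi * I) ^ K / K.factorial * bernoulliFun K (Int.fract x)) = (PB K x : ℂ) := by
    rw [PB]
    have := pow_ne_zero K hne
    generalize (2 * pi * I : ℂ) ^ K = z at *
    field_simp
  rw [e] at h2
  refine h2.congr_fun ?_
  intro m
  rw [← ee_fract, fourier_coe_apply, pm, mul_pow _ (m:ℂ), ee]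
  rw [← div_div, div_eq_mul_one_div _ ((m:ℂ)^K), mul_assoc]
  congr 3
  push_cast
  ring

lemma pm_bound (K : ℕ) (hK : 2 ≤ K) : ∃ C : ℝ, 0 < C ∧ ∀ m : ℤ, ‖pm K m‖ ≤ C * |(m:ℝ)| ^ (-2:ℝ) := by
  refine ⟨K.factorial, by positivity, ?_⟩
  intro m
  rcases eq_or_ne m 0 with rfl | hm
  · simp [pm, show K ≠ 0 by omega]
  · have hm1 : (1:ℝ) ≤ |(m:ℝ)| := by exact_mod_cast Int.one_le_abs hm
    have hm0 : 0 < |(m:ℝ)| := by linarith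
    rw [pm, norm_div, norm_neg, Complex.norm_natCast, norm_pow, norm_mul, norm_mul, norm_mul, Complex.norm_I, Complex.norm_intCast, Complex.norm_real, Real.norm_eq_abs, abs_of_pos Real.pi_pos, div_eq_mul_inv]
    gcongr
    rw [Real.rpow_neg hm0.le, Real.rpow_ofNat]
    gcongr
    have h2 : |(m:ℝ)| ≤ ‖(2:ℂ)‖ * pi * 1 * |(m:ℝ)| := by
      have := Real.pi_gt_three
      rw [Complex.norm_ofNat]
      nlinarith
    calc |(m:ℝ)|^2 ≤ |(m:ℝ)| ^ K := pow_le_pow_right₀ hm1 hK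
      _ ≤ _ := by gcongr

lemma pm_summable (K : ℕ) (hK : 2 ≤ K) : Summable (fun m : ℤ => ‖pm K m‖) := by
  obtain ⟨C, hC, h⟩ := pm_bound K hK
  exact Summable.of_nonneg_of_le (fun m => norm_nonneg _) h ((Real.summable_abs_int_rpow (by norm_num)).mul_left C)

lemma pm_summable' (K : ℕ) (hK : 2 ≤ K) : Summable (fun m : ℤ => ‖pm K m‖ * sqrt |(m:ℝ)|) := by
  obtain ⟨C, hC, h⟩ := pm_bound K hK
  refine Summable.of_nonneg_of_le (fun m => by positivity) ?_ ((Real.summable_abs_int_rpow (b := 3/2) (by norm_num)).mul_left C)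
  intro m
  rcases eq_or_ne m 0 with rfl | hm
  · simp
  · have hm1 : (1:ℝ) ≤ |(m:ℝ)| := by exact_mod_cast Int.one_le_abs hm
    have hm0 : 0 < |(m:ℝ)| := by linarith
    calc _ ≤ C * |(m:ℝ)| ^ (-2:ℝ) * sqrt |(m:ℝ)| := by gcongr; exact h m
      _ = _ := by
        rw [Real.sqrt_eq_rpow, mul_assoc, ← Real.rpow_add hm0]
        norm_num

lemma PB_int_hasSum (K : ℕ) (hK : 2 ≤ K) (w : ℝ → ℂ) (hw : Continuous w) (α L a c : ℝ) :
    HasSum (fun m : ℤ => pm K m * ∫ u in a..c, ee (m * (α * exp (L * u))) * w u)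
      (∫ u in a..c, (PB K (α * exp (L * u)) : ℂ) * w u) := by
  have hce := continuous_ee
  have := intervalIntegral.hasSum_integral_of_dominated_convergence (μ := volume) (a := a) (b := c)
    (F := fun (m : ℤ) u => pm K m * (ee (m * (α * exp (L * u))) * w u))
    (f := fun u => (PB K (α * exp (L * u)) : ℂ) * w u)
    (fun m u => ‖pm K m‖ * ‖w u‖)
    (fun m => by
      apply Continuous.aestronglyMeasurable
      fun_prop)
    (fun m => Eventually.of_forall fun u _ => by rw [norm_mul, norm_mul, norm_ee, one_mul])
    (Eventually.of_forall fun u _ => (pm_summable K hK).mul_right _)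
    (by
      simp_rw [tsum_mul_right]
      apply Continuous.intervalIntegrable
      fun_prop)
    (Eventually.of_forall fun u _ => by
      have := (PB_hasSum K hK (α * exp (L * u))).mul_right (w u)
      refine this.congr_fun fun m => ?_
      ring)
  refine this.congr_fun fun m => ?_
  rw [intervalIntegral.integral_const_mul]

lemma FI_decay (K : ℕ) (hK : 2 ≤ K) (L : ℝ) (hL : 0 < L) : ∃ C : ℝ, 0 < C ∧ ∀ (α : ℝ), 0 < α → ∀ n : ℤ, n ≠ 0 → ∀ c,
    -(log α / L) ≤ c → ‖FI K L α n c‖ ≤ C / sqrt |(n:ℝ)| := by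
  have hp := Real.pi_gt_three
  refine ⟨(∑' m : ℤ, ‖pm K m‖) * (8 + 4 / |L|) + 1, ?_, ?_⟩
  · have : 0 ≤ ∑' m : ℤ, ‖pm K m‖ := tsum_nonneg fun _ => norm_nonneg _
    positivity
  intro α hα n hn c hc
  have hn1 : (1:ℝ) ≤ |(n:ℝ)| := by exact_mod_cast Int.one_le_abs hn
  have hs := PB_int_hasSum K hK (fun u => ee (-(n*u))) (by have := continuous_ee; fun_prop) α L (-(log α / L)) c
  set R := (8 + 4 / |L|) / sqrt |(n:ℝ)| with hR
  have hv : ∀ (Λ : ℝ) (k : ℤ), 0 ≤ Λ → |(k:ℝ)| = |(n:ℝ)| → ‖∫ u in (-(log α / L))..c, ee (Λ * exp (L * u)) * ee (-(k*u))‖ ≤ R := by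
    intro Λ k hΛ hk
    have h1 : (4:ℝ) ≤ |-(2 * pi * (k:ℝ))| := by
      rw [abs_neg, abs_mul, abs_of_pos (by positivity : 0 < 2 * pi), hk]
      nlinarith
    have := vdc1 L Λ (-(2 * pi * k)) (-(log α / L)) c hL.ne' hΛ hc h1
    calc _ = ‖∫ u in (-(log α / L))..c, Complex.exp ((2 * pi * (Λ * exp (L * u)) + -(2 * pi * k) * u : ℝ) * I)‖ := by
          congr 1
          apply intervalIntegral.integral_congr
          intro u _
          simp only [← ee_add]
          unfold ee
          congr 3
          ring
      _ ≤ _ := this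
      _ ≤ R := by
        rw [hR]
        apply div_le_div_of_nonneg_left (by positivity) (by positivity)
        apply Real.sqrt_le_sqrt
        rw [abs_neg, abs_mul, abs_of_pos (by positivity : 0 < 2 * pi), hk]
        nlinarith
  have hb : ∀ m : ℤ, ‖pm K m * ∫ u in (-(log α / L))..c, ee (m * (α * exp (L * u))) * ee (-(n*u))‖ ≤ ‖pm K m‖ * R := by
    intro m
    rw [norm_mul]
    gcongr
    rcases le_total 0 m with hm | hm
    · have hm' : (0:ℝ) ≤ m := by exact_mod_cast hm
      have := hv (m * α) n (by positivity) rfl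
      simpa only [mul_assoc] using this
    · have hm' : (0:ℝ) ≤ -(m:ℝ) := by have : (m:ℝ) ≤ 0 := by exact_mod_cast hm
                                      linarith
      have := hv (-m * α) (-n) (by positivity) (by simp)
      rw [← Complex.norm_conj, ← intervalIntegral.intervalIntegral_conj] at this
      simp only [map_mul, ee_conj] at this
      have e : (fun u : ℝ => ee (m * (α * exp (L * u))) * ee (-(n*u))) = fun x : ℝ => ee (-(-(m:ℝ) * α * exp (L * x))) * ee (- -(((-n : ℤ):ℝ) * x)) := by
        funext u
        rw [show -(-(m:ℝ) * α * exp (L * u)) = m * (α * exp (L * u)) by ring,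
          show - -(((-n : ℤ):ℝ) * u) = -(n*u) by push_cast; ring]
      rw [e]
      exact this
  have h3 := tsum_of_norm_bounded ((pm_summable K hK).mul_right R).hasSum hb
  rw [hs.tsum_eq, tsum_mul_right] at h3
  rw [FI]
  refine h3.trans ?_
  rw [hR, add_div _ (1:ℝ), mul_div_assoc]
  have : 0 ≤ 1 / sqrt |(n:ℝ)| := by positivity
  linarith

noncomputable def BB (K : ℕ) (L lam : ℝ) (N : ℕ) : ℂ :=
  ∫ u in (-(1/2):ℝ)..(1/2), (PB K (lam * exp (L * u)) : ℂ) * (Dk N u : ℂ)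

lemma AA_conj (L Λ : ℝ) (N : ℕ) : AA L (-Λ) N = (starRingEnd ℂ) (AA L Λ N) := by
  unfold AA
  rw [← intervalIntegral.intervalIntegral_conj]
  congr 1
  ext u
  rw [map_mul, ee_conj, Complex.conj_ofReal, neg_mul]

lemma AA_bounds' (L : ℝ) (hL : L ≠ 0) : ∃ C : ℝ, 0 < C ∧ ∀ Λ : ℝ, 1 ≤ |Λ| → ∀ N : ℕ, 1 ≤ N →
    ‖AA L Λ N - ee Λ‖ ≤ C * sqrt (|Λ| / N) ∧ ‖AA L Λ N‖ ≤ C * (N / |Λ|) := by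
  obtain ⟨C, hC, h⟩ := AA_bounds L hL
  refine ⟨C, hC, ?_⟩
  intro Λ hΛ N hN
  rcases le_total 0 Λ with h0 | h0
  · rw [abs_of_nonneg h0] at hΛ ⊢
    exact h Λ hΛ N hN
  · rw [abs_of_nonpos h0] at hΛ ⊢
    have := h (-Λ) hΛ N hN
    rw [AA_conj, Complex.norm_conj, ← ee_conj, ← map_sub, Complex.norm_conj] at this
    exact this

lemma BB_bounds (K : ℕ) (hK : 2 ≤ K) (L : ℝ) (hL : L ≠ 0) : ∃ C : ℝ, 0 < C ∧ ∀ lam : ℝ, 1 ≤ lam → ∀ N : ℕ, 1 ≤ N →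
    ‖BB K L lam N - (PB K lam : ℂ)‖ ≤ C * sqrt (lam / N) ∧ ‖BB K L lam N‖ ≤ C * (N / lam) := by
  obtain ⟨C, hC, h⟩ := AA_bounds' L hL
  have t1 : 0 ≤ ∑' m : ℤ, ‖pm K m‖ := tsum_nonneg fun _ => norm_nonneg _
  have t2 : 0 ≤ ∑' m : ℤ, ‖pm K m‖ * sqrt |(m:ℝ)| := tsum_nonneg fun _ => by positivity
  refine ⟨C * (∑' m : ℤ, ‖pm K m‖) + C * (∑' m : ℤ, ‖pm K m‖ * sqrt |(m:ℝ)|) + 1, by positivity, ?_⟩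
  intro lam hl N hN
  have hl0 : 0 < lam := by linarith
  have hs := PB_int_hasSum K hK (fun u => (Dk N u : ℂ)) (Complex.continuous_ofReal.comp (continuous_Dk N)) lam L (-(1/2)) (1/2)
  have hs2 := PB_hasSum K hK lam
  have e : ∀ m : ℤ, ∫ u in (-(1/2):ℝ)..(1/2), ee (m * (lam * exp (L * u))) * (Dk N u : ℂ) = AA L (m * lam) N := by
    intro m; unfold AA; simp only [mul_assoc]
  simp only [e] at hs
  have hm : ∀ m : ℤ, m ≠ 0 → 1 ≤ |(m:ℝ) * lam| ∧ |(m:ℝ) * lam| = |(m:ℝ)| * lam ∧ (1:ℝ) ≤ |(m:ℝ)| := by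
    intro m hm
    have hn1 : (1:ℝ) ≤ |(m:ℝ)| := by exact_mod_cast Int.one_le_abs hm
    have : |(m:ℝ) * lam| = |(m:ℝ)| * lam := by rw [abs_mul, abs_of_pos hl0]
    refine ⟨?_, this, hn1⟩
    rw [this]; nlinarith
  constructor
  · have hs3 := hs.sub hs2
    have hb : ∀ m : ℤ, ‖pm K m * AA L (m * lam) N - pm K m * ee (m * lam)‖ ≤ ‖pm K m‖ * sqrt |(m:ℝ)| * (C * sqrt (lam / N)) := by
      intro m
      rw [← mul_sub, norm_mul, mul_assoc]
      rcases eq_or_ne m 0 with rfl | hm0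
      · simp [pm, show K ≠ 0 by omega]
      obtain ⟨a1, a2, a3⟩ := hm m hm0
      gcongr
      refine (h _ a1 N hN).1.trans (le_of_eq ?_)
      rw [a2, mul_div_assoc, Real.sqrt_mul (abs_nonneg _)]
      ring
    have h3 := tsum_of_norm_bounded ((pm_summable' K hK).mul_right (C * sqrt (lam / N))).hasSum hb
    rw [hs3.tsum_eq, tsum_mul_right] at h3
    refine h3.trans ?_
    have : 0 ≤ sqrt (lam / N) := by positivity
    have : 0 ≤ C * (∑' m : ℤ, ‖pm K m‖) := by positivity
    nlinarith
  · have hb : ∀ m : ℤ, ‖pm K m * AA L (m * lam) N‖ ≤ ‖pm K m‖ * (C * (N / lam)) := by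
      intro m
      rw [norm_mul]
      rcases eq_or_ne m 0 with rfl | hm0
      · simp [pm, show K ≠ 0 by omega]
      obtain ⟨a1, a2, a3⟩ := hm m hm0
      gcongr
      refine (h _ a1 N hN).2.trans ?_
      rw [a2]
      gcongr
      nlinarith
    have h3 := tsum_of_norm_bounded ((pm_summable K hK).mul_right (C * (N / lam))).hasSum hb
    rw [hs.tsum_eq, tsum_mul_right] at h3
    refine h3.trans ?_
    have : 0 ≤ (N:ℝ) / lam := by positivity
    have : 0 ≤ C * (∑' m : ℤ, ‖pm K m‖ * sqrt |(m:ℝ)|) := by positivity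
    nlinarith

noncomputable def SS (k : ℕ) (L α : ℝ) (N : ℕ) : ℂ :=
  ∑ n ∈ (Finset.Icc (-(N : ℤ)) (N : ℤ)).erase 0,
                riemannZeta (-(k : ℂ) + 2 * (pi : ℂ) * I * (n : ℂ) /
                    (L : ℂ)) *
                  Complex.exp (2 * (pi : ℂ) * I * (n : ℂ) * (log α : ℂ) /
                    (L : ℂ)) / (n : ℂ) ^ (k + 1)

lemma f_int (K : ℕ) (L α a c : ℝ) (w : ℝ → ℂ) (hw : Continuous w) :
    IntervalIntegrable (fun u => (PB K (α * exp (L * u)) : ℂ) * w u) volume a c := by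
  obtain ⟨C, hC0, hC⟩ := PB_bdd K
  have h1 : IntervalIntegrable w volume a c := hw.intervalIntegrable a c
  rw [intervalIntegrable_iff] at h1 ⊢
  apply h1.bdd_mul (c := C)
  · apply Measurable.aestronglyMeasurable
    apply Complex.measurable_ofReal.comp
    apply (PB_meas K).comp
    fun_prop
  · exact Eventually.of_forall fun u => by simpa using hC _

lemma Dk_add_one (N : ℕ) (u : ℝ) (l : ℕ) : Dk N (u + l) = Dk N u := by
  unfold Dk
  congr 2
  apply Finset.sum_congr rfl
  intro n _
  rw [show 2 * pi * ((n:ℝ)+1) * (u + l) = 2 * pi * (n+1) * u + (((n+1)*l : ℕ):ℝ) * (2 * pi) by push_cast; ring, Real.cos_add_nat_mul_two_pi]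

lemma block_sum (K : ℕ) (L α : ℝ) (N J : ℕ) :
    ∫ u in (-(1/2):ℝ)..((J:ℝ) - 1/2), (PB K (α * exp (L * u)) : ℂ) * (Dk N u : ℂ) =
      ∑ l ∈ range J, BB K L (α * exp (L * l)) N := by
  have hD : Continuous (fun u => (Dk N u : ℂ)) := Complex.continuous_ofReal.comp (continuous_Dk N)
  induction J with
  | zero => simp
  | succ J ih =>
    rw [Finset.sum_range_succ, ← ih, ← intervalIntegral.integral_add_adjacent_intervals (f_int K L α _ ((J:ℝ)-1/2) _ hD) (f_int K L α _ _ _ hD)]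
    congr 1
    rw [BB]
    have := intervalIntegral.integral_comp_add_right (a := (-(1/2):ℝ)) (b := 1/2) (fun u => (PB K (α * exp (L * u)) : ℂ) * (Dk N u : ℂ)) (J:ℝ)
    rw [show (-(1/2):ℝ) + J = J - 1/2 by ring, show (1/2:ℝ) + J = ((J+1:ℕ):ℝ) - 1/2 by push_cast; ring] at this
    rw [← this]
    apply intervalIntegral.integral_congr
    intro u _
    simp only [Dk_add_one]
    rw [mul_add, Real.exp_add]
    congr 3
    ring

lemma leftover (K : ℕ) (L θ α : ℝ) (h0 : 0 < θ) (h1 : θ < 1) : ∃ C : ℝ, ∀ N : ℕ,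
    ‖∫ u in (-θ)..(-(1/2):ℝ), (PB K (α * exp (L * u)) : ℂ) * (Dk N u : ℂ)‖ ≤ C := by
  obtain ⟨C, hC0, hC⟩ := PB_bdd K
  have hne : ∀ u ∈ uIcc (-θ) (-(1/2):ℝ), sin (pi * u) ≠ 0 := by
    intro u hu
    have h2 : u < 0 ∧ -1 < u := by
      rcases le_total (-θ) (-(1/2):ℝ) with h | h
      · rw [uIcc_of_le h] at hu; constructor <;> linarith [hu.1, hu.2]
      · rw [uIcc_of_ge h] at hu; constructor <;> linarith [hu.1, hu.2]
    have hp := Real.pi_pos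
    exact (Real.sin_neg_of_neg_of_neg_pi_lt (by nlinarith) (by nlinarith)).ne
  obtain ⟨M, hM⟩ := (isCompact_uIcc (a := -θ) (b := (-(1/2):ℝ))).exists_bound_of_continuousOn (f := fun u => 1 / sin (pi * u))
    (by apply ContinuousOn.div continuousOn_const (by fun_prop) hne)
  refine ⟨C * M * |(-(1/2):ℝ) - (-θ)|, fun N => ?_⟩
  apply intervalIntegral.norm_integral_le_of_norm_le_const
  intro u hu
  have hu' := uIoc_subset_uIcc hu
  rw [norm_mul, Complex.norm_real, Complex.norm_real]
  have h3 := hM u hu'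
  have h4 : ‖Dk N u‖ ≤ M := by
    have h5 := Dk_mul_sin N u
    have h6 : Dk N u = sin (nu N * u) * (1 / sin (pi * u)) := by
      rw [← h5]; field_simp [hne u hu']
    rw [h6, norm_mul]
    have : ‖sin (nu N * u)‖ ≤ 1 := Real.abs_sin_le_one _
    have h7 := norm_nonneg (1 / sin (pi * u))
    nlinarith
  exact mul_le_mul (hC _) h4 (norm_nonneg _) hC0.le

lemma FI_zero_bdd (k : ℕ) (L α : ℝ) (hL : 0 < L) (hα : 0 < α) : ∃ C : ℝ, ∀ᶠ J : ℕ in atTop, ‖FI (k+1) L α 0 (J - 1/2)‖ ≤ C := by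
  have h := trunc_tendsto (k+1) (by omega) (-(k:ℂ)) (by simp)
  have hX : Tendsto (fun J : ℕ => α * exp (L * ((J:ℝ) - 1/2))) atTop atTop := by
    apply Tendsto.const_mul_atTop hα
    apply Real.tendsto_exp_atTop.comp
    apply Tendsto.const_mul_atTop hL
    exact tendsto_atTop_add_const_right _ _ tendsto_natCast_atTop_atTop
  have h2 := (h.comp hX).norm
  obtain ⟨M, hM⟩ := h2.bddAbove_range
  have hev : ∀ᶠ J : ℕ in atTop, -(log α / L) ≤ (J:ℝ) - 1/2 := by
    have := (tendsto_natCast_atTop_atTop (R := ℝ)).eventually_ge_atTop (-(log α / L) + 1/2)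
    filter_upwards [this] with J hJ
    linarith
  refine ⟨M / L, ?_⟩
  filter_upwards [hev] with J hJ
  have h4 := cv k L α hL hα 0 _ hJ
  have h5 := hM ⟨J, rfl⟩
  simp only [Function.comp] at h5
  simp only [Int.cast_zero, mul_zero, zero_div, add_zero, zero_mul, neg_zero] at h4
  rw [h4, norm_mul, norm_mul, norm_ee, mul_one, Complex.norm_real, Real.norm_eq_abs, abs_of_pos hL] at h5
  rw [le_div_iff₀ hL]; linarith

lemma reduction (k : ℕ) (L α : ℝ) (hL : 0 < L) (hα : 1 < α) (hαL : log α < L) :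
    ∃ κ : ℂ, κ ≠ 0 ∧ ∃ C : ℝ, ∀ N : ℕ, ∀ᶠ J : ℕ in atTop,
      ‖SS k L α N - κ * ∑ l ∈ range J, BB (k+1) L (α * exp (L * l)) N‖ ≤ C := by
  have hα0 : 0 < α := by linarith
  have hlα : 0 < log α := Real.log_pos hα
  have hpi := Real.pi_pos
  set θ := log α / L with hθ
  have hθ0 : 0 < θ := by positivity
  have hθ1 : θ < 1 := by rw [hθ, div_lt_one hL]; exact hαL
  obtain ⟨p, hp, hlim⟩ := zeta_lim k
  obtain ⟨C1, hC1⟩ := elem_terms k L hL p hp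
  obtain ⟨C2, hC2⟩ := leftover (k+1) L θ α hθ0 hθ1
  obtain ⟨C3, hC3⟩ := FI_zero_bdd k L α hL hα0
  set lin : Polynomial ℂ := (Polynomial.C (2 * (pi : ℂ) * I / L) * Polynomial.X + Polynomial.C (-(k:ℂ))) with hlin
  have hane : (2 * (pi : ℂ) * I / L) ≠ 0 := by
    have h1 : (pi : ℂ) ≠ 0 := by exact_mod_cast hpi.ne'
    have h2 : (L : ℂ) ≠ 0 := by exact_mod_cast hL.ne'
    simp [h1, h2]
  have hlind : lin.natDegree = 1 := Polynomial.natDegree_linear hane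
  set q : Polynomial ℂ := (ascPochhammer ℂ (k+1)).comp lin with hq
  have hqd : q.natDegree = k + 1 := by rw [hq, Polynomial.natDegree_comp, ascPochhammer_natDegree, hlind, mul_one]
  have hqe : ∀ n : ℤ, (ascPochhammer ℂ (k+1)).eval (-(k : ℂ) + 2 * (pi : ℂ) * I * (n : ℂ) / (L : ℂ)) = q.eval (n:ℂ) := by
    intro n
    rw [hq, hlin]; simp only [Polynomial.eval_comp, Polynomial.eval_add, Polynomial.eval_mul, Polynomial.eval_C, Polynomial.eval_X]
    congr 1; ring
  set A := q.coeff (k+1) with hA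
  have hAne : A ≠ 0 := by
    rw [hA, ← hqd]
    show q.leadingCoeff ≠ 0
    rw [Polynomial.leadingCoeff_ne_zero]
    intro h0
    rw [h0] at hqd; simp at hqd
  have hfac : ((k+1).factorial : ℂ) ≠ 0 := by exact_mod_cast (k+1).factorial_ne_zero
  have hLc : (L:ℂ) ≠ 0 := by exact_mod_cast hL.ne'
  set E : ℂ := L / (k+1).factorial with hE
  have hEne : E ≠ 0 := div_ne_zero hLc hfac
  -- error sum
  have herr : ∃ C4 : ℝ, ∀ N J : ℕ, 1 ≤ J → ‖∑ n ∈ (Finset.Icc (-(N : ℤ)) (N : ℤ)).erase 0,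
      (q.eval (n:ℂ) / (n:ℂ)^(k+1) - A) * FI (k+1) L α n (J - 1/2)‖ ≤ C4 := by
    rcases Nat.eq_zero_or_pos k with hk | hk
    · refine ⟨0, fun N J _ => ?_⟩
      rw [norm_le_zero_iff]
      apply Finset.sum_eq_zero
      intro n hn
      have hn0 : (n:ℂ) ≠ 0 := by exact_mod_cast (Finset.mem_erase.1 hn).1
      have : q = Polynomial.C (2 * (pi : ℂ) * I / L) * Polynomial.X := by
        rw [hq, hlin, hk]; simp
      rw [hA, this, hk]
      simp [hn0]
    · obtain ⟨C5, hC5, h5⟩ := poly_asym q (k+1) hqd.le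
      obtain ⟨C6, hC6, h6⟩ := FI_decay (k+1) (by omega) L hL
      obtain ⟨D, hD, h7⟩ := sum_NZ_small
      refine ⟨D * (C5 * C6), fun N J hJ => ?_⟩
      apply h7 N _ _ (by positivity)
      intro n hn
      have hn1 : (1:ℝ) ≤ |(n:ℝ)| := by exact_mod_cast Int.one_le_abs hn
      have hn0 : 0 < |(n:ℝ)| := by linarith
      have hJ' : (1:ℝ) ≤ J := by exact_mod_cast hJ
      rw [norm_mul]
      calc _ ≤ (C5 / |(n:ℝ)|) * (C6 / sqrt |(n:ℝ)|) := by
            apply mul_le_mul (h5 n hn) _ (norm_nonneg _) (by positivity)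
            exact h6 α hα0 n hn _ (by linarith)
        _ = C5 * C6 * |(n:ℝ)| ^ (-(3/2):ℝ) := by
            rw [Real.sqrt_eq_rpow, show (-(3/2):ℝ) = -1 + -(1/2) by norm_num, Real.rpow_add hn0, Real.rpow_neg hn0.le, Real.rpow_neg hn0.le, Real.rpow_one]
            field_simp
  obtain ⟨C4, hC4⟩ := herr
  refine ⟨-(A * E), neg_ne_zero.2 (mul_ne_zero hAne hEne), C1 + ‖E‖ * (‖A‖ * (C2 + C3) + C4) + 1, ?_⟩
  intro N
  have hT := tendsto_finsetSum (Finset.erase (Finset.Icc (-(N : ℤ)) (N : ℤ)) 0) (fun n hn => hlim L α hL hα0 n (Finset.mem_erase.1 hn).1)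
  rw [show (∑ n ∈ (Finset.Icc (-(N : ℤ)) (N : ℤ)).erase 0,
                riemannZeta (-(k : ℂ) + 2 * (pi : ℂ) * I * (n : ℂ) /
                    (L : ℂ)) *
                  Complex.exp (2 * (pi : ℂ) * I * (n : ℂ) * (log α : ℂ) /
                    (L : ℂ)) / (n : ℂ) ^ (k + 1)) = SS k L α N from rfl] at hT
  have hclose := (Metric.tendsto_nhds.1 hT) 1 one_pos
  filter_upwards [hclose, hC3, eventually_ge_atTop 1] with J hJ1 hJ2 hJ3
  have hJ' : (1:ℝ) ≤ J := by exact_mod_cast hJ3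
  rw [Finset.sum_sub_distrib] at hJ1
  simp only [hqe, ← hE] at hJ1
  have hb : ∑ l ∈ range J, BB (k+1) L (α * exp (L * l)) N =
      (∑ n ∈ (Finset.Icc (-(N : ℤ)) (N : ℤ)).erase 0, FI (k+1) L α n (J - 1/2)) + FI (k+1) L α 0 (J - 1/2) -
      ∫ u in (-θ)..(-(1/2):ℝ), (PB (k+1) (α * exp (L * u)) : ℂ) * (Dk N u : ℂ) := by
    have hD : Continuous (fun u => (Dk N u : ℂ)) := Complex.continuous_ofReal.comp (continuous_Dk N)
    have hce := continuous_ee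
    rw [← block_sum, eq_sub_iff_add_eq, add_comm, intervalIntegral.integral_add_adjacent_intervals (f_int _ L α _ _ _ hD) (f_int _ L α _ _ _ hD)]
    unfold FI
    rw [← hθ, ← intervalIntegral.integral_finsetSum (fun (n:ℤ) _ => f_int (k+1) L α _ _ (fun u => ee (-(n*u))) (by fun_prop)), ← intervalIntegral.integral_add]
    · apply intervalIntegral.integral_congr
      intro u _
      simp only [← Finset.mul_sum]
      have h8 := sum_NZ_ee N u
      rw [h8]
      have : ee (-(((0:ℤ):ℝ) * u)) = 1 := by simp [ee]
      rw [this]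
      ring
    · have h9 := f_int (k+1) L α (-θ) ((J:ℝ)-1/2) (fun u => ∑ n ∈ (Finset.Icc (-(N : ℤ)) (N : ℤ)).erase 0, ee (-(n*u))) (by fun_prop)
      simpa only [Finset.mul_sum] using h9
    · exact f_int (k+1) L α _ _ (fun u => ee (-(((0:ℤ):ℝ)*u))) (by fun_prop)
  have hsum : ∑ n ∈ (Finset.Icc (-(N : ℤ)) (N : ℤ)).erase 0, q.eval (n:ℂ) / (n:ℂ)^(k+1) * E * FI (k+1) L α n (J - 1/2) =
      E * (A * (∑ n ∈ (Finset.Icc (-(N : ℤ)) (N : ℤ)).erase 0, FI (k+1) L α n (J - 1/2)) + ∑ n ∈ (Finset.Icc (-(N : ℤ)) (N : ℤ)).erase 0,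
      (q.eval (n:ℂ) / (n:ℂ)^(k+1) - A) * FI (k+1) L α n (J - 1/2)) := by
    rw [Finset.mul_sum, ← Finset.sum_add_distrib, Finset.mul_sum]
    apply Finset.sum_congr rfl
    intro n _
    ring
  rw [hsum, dist_comm, dist_eq_norm] at hJ1
  rw [hb]
  have a1 := hC1 θ N
  have a2 := hC2 N
  have a4 := hC4 N J hJ3
  set X1 := ∑ n ∈ (Finset.Icc (-(N : ℤ)) (N : ℤ)).erase 0,
      (1 / (-(k : ℂ) + 2 * (pi : ℂ) * I * (n : ℂ) / (L : ℂ) - 1) +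
        p.eval (-(k : ℂ) + 2 * (pi : ℂ) * I * (n : ℂ) / (L : ℂ))) * ee (n * θ) / (n:ℂ)^(k+1)
  set X2 := ∫ u in (-θ)..(-(1/2):ℝ), (PB (k+1) (α * exp (L * u)) : ℂ) * (Dk N u : ℂ)
  set X3 := FI (k+1) L α 0 (J - 1/2)
  set X4 := ∑ n ∈ (Finset.Icc (-(N : ℤ)) (N : ℤ)).erase 0, (q.eval (n:ℂ) / (n:ℂ)^(k+1) - A) * FI (k+1) L α n (J - 1/2)
  set X5 := ∑ n ∈ (Finset.Icc (-(N : ℤ)) (N : ℤ)).erase 0, FI (k+1) L α n (J - 1/2)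
  have e : SS k L α N - -(A * E) * (X5 + X3 - X2) = (SS k L α N - (X1 - E * (A * X5 + X4))) + X1 + E * (A * (X3 - X2) - X4) := by ring
  rw [e]
  have b1 : ‖E * (A * (X3 - X2) - X4)‖ ≤ ‖E‖ * (‖A‖ * (C2 + C3) + C4) := by
    rw [norm_mul]
    gcongr
    refine (norm_sub_le _ _).trans (add_le_add ?_ a4)
    rw [norm_mul]
    gcongr
    refine (norm_sub_le _ _).trans ?_
    linarith
  have b2 := norm_add_le (SS k L α N - (X1 - E * (A * X5 + X4)) + X1) (E * (A * (X3 - X2) - X4))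
  have b3 := norm_add_le (SS k L α N - (X1 - E * (A * X5 + X4))) X1
  linarith

lemma geo1 (b N : ℕ) (hb : 2 ≤ b) (hN : 1 ≤ N) : ∑ l ∈ range (Nat.log b N + 1), sqrt ((b:ℝ)^l / N) ≤ 4 := by
  set T := Nat.log b N with hT
  have h1 : b ^ T ≤ N := Nat.pow_log_le_self b (by omega)
  have h1' : (b:ℝ)^T ≤ N := by exact_mod_cast h1
  have hb' : (2:ℝ) ≤ b := by exact_mod_cast hb
  have hr : sqrt (1/2) ≤ 3/4 := by
    rw [Real.sqrt_le_left (by norm_num)]; norm_num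
  have h2 : ∀ l ∈ range (T+1), sqrt ((b:ℝ)^l / N) ≤ (3/4)^(T + 1 - 1 - l) := by
    intro l hl
    have hl : l ≤ T := by rw [Finset.mem_range] at hl; omega
    obtain ⟨d, hd⟩ := Nat.exists_eq_add_of_le hl
    rw [show T + 1 - 1 - l = d by omega]
    have h3 : (b:ℝ)^l / N ≤ (1/2)^d := by
      rw [div_le_iff₀ (by exact_mod_cast hN)]
      rw [hd, pow_add] at h1'
      have h4 : (2:ℝ)^d ≤ (b:ℝ)^d := by gcongr
      rw [one_div, inv_pow, ← div_eq_inv_mul, le_div_iff₀ (by positivity)]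
      calc (b:ℝ)^l * 2^d ≤ (b:ℝ)^l * (b:ℝ)^d := by gcongr
        _ ≤ N := h1'
    calc _ ≤ sqrt ((1/2)^d) := Real.sqrt_le_sqrt h3
      _ = sqrt (1/2) ^ d := by
        rw [Real.sqrt_eq_iff_mul_self_eq (by positivity) (by positivity), ← mul_pow, Real.mul_self_sqrt (by norm_num)]
      _ ≤ _ := by gcongr
  refine (Finset.sum_le_sum h2).trans ?_
  rw [Finset.sum_range_reflect (fun j => ((3:ℝ)/4)^j)]
  refine (Summable.sum_le_tsum _ (fun i _ => by positivity) (summable_geometric_of_lt_one (by norm_num) (by norm_num))).trans ?_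
  rw [tsum_geometric_of_lt_one (by norm_num) (by norm_num)]; norm_num

lemma geo2 (b N J : ℕ) (hb : 2 ≤ b) : ∑ l ∈ Finset.Ico (Nat.log b N + 1) J, (N:ℝ) / (b:ℝ)^l ≤ 2 := by
  set T := Nat.log b N with hT
  have h1 : N < b ^ (T+1) := Nat.lt_pow_succ_log_self (by omega) N
  have h1' : (N:ℝ) ≤ (b:ℝ)^(T+1) := by exact_mod_cast h1.le
  have hb' : (2:ℝ) ≤ b := by exact_mod_cast hb
  rw [Finset.sum_Ico_eq_sum_range]
  have h2 : ∀ i ∈ range (J - (T+1)), (N:ℝ) / (b:ℝ)^(T + 1 + i) ≤ (1/2)^i := by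
    intro i _
    rw [pow_add, ← div_div]
    calc (N:ℝ) / (b:ℝ)^(T+1) / (b:ℝ)^i ≤ 1 / 2^i := by
          gcongr
          rw [div_le_one (by positivity)]; exact h1'
      _ = _ := by rw [one_div, one_div, inv_pow]
  refine (Finset.sum_le_sum h2).trans ?_
  refine (Summable.sum_le_tsum _ (fun i _ => by positivity) (summable_geometric_of_lt_one (by norm_num) (by norm_num))).trans ?_
  rw [tsum_geometric_of_lt_one (by norm_num) (by norm_num)]; norm_num

lemma exp_log_mul (b : ℕ) (hb : 2 ≤ b) (l : ℕ) : exp (log b * l) = (b:ℝ)^l := by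
  have hb0 : (0:ℝ) < b := by exact_mod_cast (by omega : 0 < b)
  rw [mul_comm, Real.exp_nat_mul, Real.exp_log hb0]

lemma SS_pos (k : ℕ) (hk : 1 ≤ k) (b : ℕ) (hb : 2 ≤ b) (α : ℝ) (hα : 1 < α) (hαb : α < b) :
    ∃ κ : ℂ, κ ≠ 0 ∧ ∃ C : ℝ, ∀ N : ℕ, 1 ≤ N →
      ‖SS k (log b) α N - κ * ∑ l ∈ range (Nat.log b N + 1), (PB (k+1) (α * (b:ℝ)^l) : ℂ)‖ ≤ C := by
  have hb1 : (1:ℝ) < b := by exact_mod_cast (by omega : 1 < b)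
  have hL : 0 < log b := Real.log_pos hb1
  obtain ⟨κ, hκ, C1, h1⟩ := reduction k (log b) α hL hα (Real.log_lt_log (by linarith) hαb)
  obtain ⟨C2, hC2, h2⟩ := BB_bounds (k+1) (by omega) (log b) hL.ne'
  refine ⟨κ, hκ, C1 + ‖κ‖ * (C2 * sqrt α * 4 + C2 * 2), fun N hN => ?_⟩
  obtain ⟨J, hJ1, hJ2⟩ := ((h1 N).and (eventually_ge_atTop (Nat.log b N + 1))).exists
  simp only [exp_log_mul b hb] at hJ1
  set T := Nat.log b N with hT
  have hlam : ∀ l : ℕ, 1 ≤ α * (b:ℝ)^l := fun l => by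
    have : 1 ≤ (b:ℝ)^l := one_le_pow₀ hb1.le
    nlinarith
  have hN0 : (0:ℝ) < N := by exact_mod_cast hN
  have hsplit := Finset.sum_range_add_sum_Ico (fun l => BB (k+1) (log b) (α * (b:ℝ)^l) N) hJ2
  have g1 : ‖∑ l ∈ range (T+1), (BB (k+1) (log b) (α * (b:ℝ)^l) N - (PB (k+1) (α * (b:ℝ)^l) : ℂ))‖ ≤ C2 * sqrt α * 4 := by
    refine (norm_sum_le_of_le (f := fun l => BB (k+1) (log b) (α * (b:ℝ)^l) N - (PB (k+1) (α * (b:ℝ)^l) : ℂ)) (n := fun l => C2 * sqrt α * sqrt ((b:ℝ)^l / N)) _ ?_).trans ?_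
    · intro l _
      refine (h2 _ (hlam l) N hN).1.trans (le_of_eq ?_)
      rw [mul_div_assoc, Real.sqrt_mul (by linarith)]; ring
    · rw [← Finset.mul_sum]
      gcongr
      exact geo1 b N hb hN
  have g2 : ‖∑ l ∈ Finset.Ico (T+1) J, BB (k+1) (log b) (α * (b:ℝ)^l) N‖ ≤ C2 * 2 := by
    refine (norm_sum_le_of_le (n := fun l => C2 * ((N:ℝ) / (b:ℝ)^l)) _ ?_).trans ?_
    · intro l _
      refine (h2 _ (hlam l) N hN).2.trans ?_
      have : (0:ℝ) < (b:ℝ)^l := by positivity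
      gcongr
      nlinarith
    · rw [← Finset.mul_sum]
      gcongr
      exact geo2 b N J hb
  rw [Finset.sum_sub_distrib] at g1
  rw [← hsplit] at hJ1
  set X1 := ∑ l ∈ range (T+1), BB (k+1) (log b) (α * (b:ℝ)^l) N
  set X2 := ∑ l ∈ Finset.Ico (T+1) J, BB (k+1) (log b) (α * (b:ℝ)^l) N
  set X3 := ∑ l ∈ range (T+1), (PB (k+1) (α * (b:ℝ)^l) : ℂ)
  have e : SS k (log b) α N - κ * X3 = (SS k (log b) α N - κ * (X1 + X2)) + κ * ((X1 - X3) + X2) := by ring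
  rw [e]
  refine (norm_add_le _ _).trans (add_le_add hJ1 ?_)
  rw [norm_mul]
  gcongr
  exact (norm_add_le _ _).trans (add_le_add g1 g2)

lemma PB_one (x : ℝ) : PB 1 x = Int.fract x - 1/2 := by
  unfold PB; rw [bernoulliFun_one]

lemma sn_lim (x : ℝ) (hx : Int.fract x ≠ 0) :
    Tendsto (fun M : ℕ => ∑ n ∈ range M, sin (2 * pi * (n + 1) * x) / (pi * (n + 1))) atTop (𝓝 (-PB 1 x)) := by
  have key : ∀ y : ℝ, 0 < y → y ≤ 1/2 → Tendsto (fun M : ℕ => ∑ n ∈ range M, sin (2 * pi * (n + 1) * y) / (pi * (n + 1))) atTop (𝓝 (1/2 - y)) := by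
    intro y h0 h1
    have h2 : Tendsto (fun M : ℕ => Psi M y) atTop (𝓝 0) := by
      apply squeeze_zero_norm' (a := fun M : ℕ => (1 / (3 * y)) * ((M:ℝ))⁻¹)
      · filter_upwards [eventually_ge_atTop 1] with M hM
        rw [Real.norm_eq_abs]
        refine (Psi_le' M y hM h0 h1).trans (le_of_eq ?_)
        have : (M:ℝ) ≠ 0 := by positivity
        field_simp
      · simpa using (tendsto_inv_atTop_nhds_zero_nat (𝕜 := ℝ)).const_mul (1 / (3*y))
    have h3 := (tendsto_const_nhds (x := 1/2 - y)).sub h2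
    rw [sub_zero] at h3
    refine h3.congr fun M => ?_
    rw [Psi_eq, int_Dk]; ring
  have e : ∀ M : ℕ, ∑ n ∈ range M, sin (2 * pi * (n + 1) * x) / (pi * (n + 1)) = ∑ n ∈ range M, sin (2 * pi * (n + 1) * Int.fract x) / (pi * (n + 1)) := by
    intro M
    apply Finset.sum_congr rfl
    intro n _
    congr 1
    conv_lhs => rw [← Int.floor_add_fract x]
    rw [show 2 * pi * ((n:ℝ) + 1) * (⌊x⌋ + Int.fract x) = 2 * pi * (n + 1) * Int.fract x + ((((n+1:ℕ):ℤ) * ⌊x⌋ : ℤ) : ℝ) * (2 * pi) by push_cast; ring, Real.sin_add_int_mul_two_pi]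
  simp only [e]
  rw [PB_one]
  have hf0 : 0 < Int.fract x := lt_of_le_of_ne (Int.fract_nonneg x) (Ne.symm hx)
  have hf1 := Int.fract_lt_one x
  set y := Int.fract x
  rcases le_total y (1/2) with h | h
  · rw [neg_sub]; exact key y hf0 h
  · have h4 := (key (1 - y) (by linarith) (by linarith)).neg
    rw [show -(1/2 - (1 - y)) = -(y - 1/2) by ring] at h4
    refine h4.congr fun M => ?_
    rw [← Finset.sum_neg_distrib]
    apply Finset.sum_congr rfl
    intro n _
    rw [← neg_div]
    congr 1
    rw [show 2 * pi * ((n:ℝ) + 1) * (1 - y) = ((n+1:ℕ):ℝ) * (2 * pi) - 2 * pi * (n + 1) * y by push_cast; ring, Real.sin_nat_mul_two_pi_sub, neg_neg]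

lemma ee_im (x : ℝ) : (ee x).im = sin (2 * pi * x) := by
  unfold ee; rw [Complex.exp_ofReal_mul_I_im]

lemma AA_im (L Λ : ℝ) (N : ℕ) : ((AA L Λ N).im : ℂ) = ∫ u in (-(1/2):ℝ)..(1/2), (sin (2 * pi * (Λ * exp (L * u))) : ℂ) * (Dk N u : ℂ) := by
  have hc : Continuous fun u : ℝ => ee (Λ * exp (L * u)) * (Dk N u : ℂ) :=
    (continuous_ee.comp (by fun_prop)).mul (Complex.continuous_ofReal.comp (continuous_Dk N))
  have h := Complex.imCLM.intervalIntegral_comp_comm (hc.intervalIntegrable (μ := volume) (-(1/2)) (1/2))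
  simp only [Complex.imCLM_apply] at h
  unfold AA
  rw [← h, ← intervalIntegral.integral_ofReal]
  congr 1; ext u
  rw [Complex.im_mul_ofReal, ee_im]; push_cast; rfl

lemma count_int (L lam : ℝ) (hL : L ≠ 0) (hl : lam ≠ 0) : ∀ᵐ u : ℝ, Int.fract (lam * exp (L * u)) ≠ 0 := by
  have hc : (⋃ m : ℤ, {u : ℝ | lam * exp (L * u) = m}).Countable := by
    apply Set.countable_iUnion
    intro m
    apply Set.Subsingleton.countable
    intro u hu v hv
    have h1 : lam * exp (L * u) = lam * exp (L * v) := by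
      have hu' : lam * exp (L * u) = m := hu
      have hv' : lam * exp (L * v) = m := hv
      rw [hu', hv']
    have h2 := Real.exp_injective (mul_left_cancel₀ hl h1)
    exact mul_left_cancel₀ hL h2
  have h0 := hc.measure_zero volume
  rw [ae_iff]
  refine measure_mono_null ?_ h0
  intro u hu
  have hu : ¬ (Int.fract (lam * exp (L * u)) ≠ 0) := hu
  push Not at hu
  rw [mem_iUnion]
  exact ⟨⌊lam * exp (L * u)⌋, by show _ = _; have := Int.floor_add_fract (lam * exp (L * u)); rw [hu, add_zero] at this; exact this.symm⟩

lemma BB_one_lim (L lam : ℝ) (hL : L ≠ 0) (hl : lam ≠ 0) (N : ℕ) :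
    Tendsto (fun M : ℕ => ((∑ n ∈ range M, (AA L ((n+1)*lam) N).im / (pi * (n + 1)) : ℝ) : ℂ)) atTop (𝓝 (-BB 1 L lam N)) := by
  have hcD : Continuous fun u => (Dk N u : ℂ) := Complex.continuous_ofReal.comp (continuous_Dk N)
  have h := intervalIntegral.tendsto_integral_filter_of_dominated_convergence (a := (-(1/2):ℝ)) (b := 1/2) (μ := volume) (l := atTop)
    (F := fun (M : ℕ) (u:ℝ) => ((∑ n ∈ range M, sin (2 * pi * (n + 1) * (lam * exp (L * u))) / (pi * (n + 1)) : ℝ) : ℂ) * (Dk N u : ℂ))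
    (f := fun u => ((-PB 1 (lam * exp (L * u)) : ℝ) : ℂ) * (Dk N u : ℂ)) (fun u => 3 * ‖(Dk N u : ℂ)‖)
    (Eventually.of_forall fun M => by
      apply Continuous.aestronglyMeasurable
      refine Continuous.mul ?_ hcD
      apply Complex.continuous_ofReal.comp
      fun_prop)
    (Eventually.of_forall fun M => Eventually.of_forall fun u _ => by
      rw [norm_mul, Complex.norm_real, Real.norm_eq_abs]
      gcongr
      exact sin_sum_bdd M _)
    ((hcD.norm.const_mul 3).intervalIntegrable _ _)
    (by
      filter_upwards [count_int L lam hL hl] with u hu _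
      refine Tendsto.mul_const _ ?_
      exact (Complex.continuous_ofReal.tendsto _).comp (sn_lim _ hu))
  have e1 : ∫ u in (-(1/2):ℝ)..(1/2), ((-PB 1 (lam * exp (L * u)) : ℝ) : ℂ) * (Dk N u : ℂ) = -BB 1 L lam N := by
    unfold BB
    rw [← intervalIntegral.integral_neg]
    congr 1; ext u; push_cast; ring
  rw [e1] at h
  refine h.congr fun M => ?_
  simp only [Complex.ofReal_sum, Finset.sum_mul]
  rw [intervalIntegral.integral_finsetSum]
  · apply Finset.sum_congr rfl
    intro n _
    rw [Complex.ofReal_div, AA_im, ← intervalIntegral.integral_div]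
    congr 1; ext u
    push_cast
    rw [show 2 * (pi:ℂ) * ((n:ℂ) + 1) * (lam * Complex.exp (L * u)) = 2 * pi * (((n:ℂ)+1) * lam * Complex.exp (L * u)) by ring]
    ring
  · intro n _
    apply Continuous.intervalIntegrable
    refine Continuous.mul ?_ hcD
    fun_prop

lemma sum_inv_sq (P M : ℕ) : ∑ n ∈ Finset.Ico P M, 1 / ((n:ℝ) + 1)^2 ≤ 2 / ((P:ℝ) + 1) := by
  have h := sum_Ioo_inv_sq_le (α := ℝ) P (M+1)
  refine le_trans (le_of_eq ?_) h
  have := Finset.sum_Ico_add' (fun i : ℕ => ((i:ℝ)^2)⁻¹) P M 1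
  rw [show Finset.Ioo P (M+1) = Finset.Ico (P+1) (M+1) from rfl, ← this]
  apply Finset.sum_congr rfl
  intro n _
  push_cast; rw [one_div]

lemma sum_inv_sqrt (P : ℕ) : ∑ n ∈ range P, 1 / sqrt ((n:ℝ) + 1) ≤ 2 * sqrt P := by
  induction P with
  | zero => simp
  | succ P ih =>
    rw [Finset.sum_range_succ]
    have h1 : 0 < sqrt ((P:ℝ)+1) := Real.sqrt_pos.2 (by positivity)
    have h2 : 0 ≤ sqrt (P:ℝ) := Real.sqrt_nonneg _
    have h3 := Real.mul_self_sqrt (show (0:ℝ) ≤ P by positivity)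
    have h4 := Real.mul_self_sqrt (show (0:ℝ) ≤ P + 1 by positivity)
    push_cast
    have : 1 / sqrt ((P:ℝ)+1) ≤ 2 * sqrt ((P:ℝ)+1) - 2 * sqrt P := by
      rw [div_le_iff₀ h1]
      nlinarith [sq_nonneg (sqrt ((P:ℝ)+1) - sqrt P)]
    linarith

lemma BB_one_bound (L : ℝ) (hL : L ≠ 0) : ∃ C : ℝ, 0 < C ∧ ∀ lam : ℝ, 1 ≤ lam → ∀ N : ℕ, 1 ≤ N →
    ‖BB 1 L lam N‖ ≤ C * (N / lam) ∧ (lam ≤ N → ‖BB 1 L lam N‖ ≤ C) := by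
  obtain ⟨C, hC, h⟩ := AA_bounds' L hL
  refine ⟨4 * C + 3, by positivity, ?_⟩
  intro lam hl N hN
  have hpi := Real.pi_gt_three
  have hl0 : 0 < lam := by linarith
  have hN0 : (0:ℝ) < N := by exact_mod_cast hN
  have hlim := (BB_one_lim L lam hL hl0.ne' N).norm
  rw [norm_neg] at hlim
  have hA : ∀ n : ℕ, 1 ≤ |((n:ℝ)+1) * lam| ∧ |((n:ℝ)+1) * lam| = (n+1) * lam := by
    intro n
    have h1 : 0 ≤ (n:ℝ) := by positivity
    have h2 : |((n:ℝ)+1) * lam| = (n+1) * lam := abs_of_pos (by positivity)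
    refine ⟨?_, h2⟩
    rw [h2]; nlinarith
  have hA2 : ∀ n : ℕ, |(AA L ((n+1)*lam) N).im / (pi * (n + 1))| ≤ C * (N / lam) * (1 / ((n:ℝ)+1)^2) := by
    intro n
    have h1 := (h _ (hA n).1 N hN).2
    rw [(hA n).2] at h1
    have h2 := (Complex.abs_im_le_norm _).trans h1
    rw [abs_div, abs_of_pos (by positivity : 0 < pi * ((n:ℝ)+1)), div_le_iff₀ (by positivity)]
    refine h2.trans ?_
    have h3 : C * (N / lam) * (1 / ((n:ℝ)+1)^2) * (pi * (n+1)) = C * (N / ((n+1) * lam)) * pi := by field_simp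
    rw [h3]
    have : 0 ≤ C * (N / (((n:ℝ)+1) * lam)) := by positivity
    nlinarith
  have hA2s : ∀ P M : ℕ, |∑ n ∈ Finset.Ico P M, (AA L ((n+1)*lam) N).im / (pi * (n + 1))| ≤ C * (N / lam) * (2 / ((P:ℝ)+1)) := by
    intro P M
    refine (Finset.abs_sum_le_sum_abs _ _).trans ((Finset.sum_le_sum fun n _ => hA2 n).trans ?_)
    rw [← Finset.mul_sum]
    gcongr
    exact sum_inv_sq P M
  constructor
  · refine le_of_tendsto' hlim fun M => ?_
    rw [Complex.norm_real, Real.norm_eq_abs, Finset.range_eq_Ico]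
    refine (hA2s 0 M).trans ?_
    have : 0 ≤ (N:ℝ) / lam := by positivity
    norm_num
    nlinarith
  · intro hlN
    set P := ⌊(N:ℝ) / lam⌋₊ with hP
    have hP1 : (P:ℝ) ≤ N / lam := Nat.floor_le (by positivity)
    have hP2 : (N:ℝ) / lam < P + 1 := Nat.lt_floor_add_one _
    refine le_of_tendsto hlim ?_
    filter_upwards [eventually_ge_atTop P] with M hM
    rw [Complex.norm_real, Real.norm_eq_abs, ← Finset.sum_range_add_sum_Ico _ hM]
    refine (abs_add_le _ _).trans ?_
    have g2 : |∑ n ∈ Finset.Ico P M, (AA L ((n+1)*lam) N).im / (pi * (n + 1))| ≤ 2 * C := by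
      refine (hA2s P M).trans ?_
      have : N / lam * (2 / ((P:ℝ)+1)) ≤ 2 := by
        rw [mul_div_assoc', div_le_iff₀ (by positivity)]; nlinarith
      nlinarith
    have g1 : |∑ n ∈ range P, ((AA L ((n+1)*lam) N).im / (pi * (n + 1)) - sin (2 * pi * (n + 1) * lam) / (pi * (n + 1)))| ≤ 2 * C := by
      have hb : ∀ n ∈ range P, |(AA L ((n+1)*lam) N).im / (pi * (n + 1)) - sin (2 * pi * (n + 1) * lam) / (pi * (n + 1))| ≤ C * sqrt (lam / N) * (1 / sqrt ((n:ℝ)+1)) := by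
        intro n _
        have h1 := (h _ (hA n).1 N hN).1
        rw [(hA n).2] at h1
        have h2 := (Complex.abs_im_le_norm _).trans h1
        rw [Complex.sub_im, ee_im, ← mul_assoc] at h2
        rw [← sub_div, abs_div, abs_of_pos (by positivity : 0 < pi * ((n:ℝ)+1)), div_le_iff₀ (by positivity)]
        refine h2.trans ?_
        rw [mul_div_assoc, Real.sqrt_mul (by positivity)]
        have h3 : 0 < sqrt ((n:ℝ)+1) := Real.sqrt_pos.2 (by positivity)
        have h4 := Real.mul_self_sqrt (show (0:ℝ) ≤ n + 1 by positivity)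
        have h5 : C * sqrt (lam / N) * (1 / sqrt ((n:ℝ)+1)) * (pi * (n+1)) = C * (sqrt ((n:ℝ)+1) * sqrt (lam / N)) * pi := by
          nth_rewrite 2 [← h4]
          field_simp
        rw [h5]
        have : 0 ≤ C * (sqrt ((n:ℝ)+1) * sqrt (lam / N)) := by positivity
        nlinarith
      refine (Finset.abs_sum_le_sum_abs _ _).trans ((Finset.sum_le_sum hb).trans ?_)
      rw [← Finset.mul_sum]
      have h6 : sqrt (lam / N) * sqrt P ≤ 1 := by
        rw [← Real.sqrt_mul (by positivity), Real.sqrt_le_left (by norm_num), one_pow]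
        rw [le_div_iff₀ hl0] at hP1
        rw [div_mul_eq_mul_div, div_le_one hN0]; linarith
      have h7 := sum_inv_sqrt P
      have h8 : 0 ≤ sqrt (lam / N) := Real.sqrt_nonneg _
      calc _ ≤ C * sqrt (lam / N) * (2 * sqrt P) := by gcongr
        _ = 2 * C * (sqrt (lam / N) * sqrt P) := by ring
        _ ≤ 2 * C * 1 := by gcongr
        _ = 2 * C := by ring
    rw [Finset.sum_sub_distrib] at g1
    have g3 := sin_sum_bdd P lam
    rw [abs_le] at g1 g3
    have : |∑ n ∈ range P, (AA L ((n+1)*lam) N).im / (pi * (n + 1))| ≤ 2 * C + 3 := by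
      rw [abs_le]; constructor <;> linarith
    linarith

lemma Psi_cont (N : ℕ) : Continuous (Psi N) :=
  continuous_iff_continuousAt.2 fun u => (Psi_deriv N u).continuousAt

lemma int_Psi (N : ℕ) (hN : 1 ≤ N) : ∫ u in (0:ℝ)..(1/2), |Psi N u| ≤ 4 / N * (1 + log N) := by
  have hN1 : (1:ℝ) ≤ N := by exact_mod_cast hN
  have hN0 : (0:ℝ) < N := by linarith
  have hpos : ∀ u : ℝ, u ∈ uIcc (0:ℝ) (1/2) → 0 < 1 + N * u := by
    intro u hu
    rw [uIcc_of_le (by norm_num)] at hu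
    have := hu.1
    positivity
  have hd : ∀ u ∈ uIcc (0:ℝ) (1/2), HasDerivAt (fun u : ℝ => 4 / N * log (1 + N * u)) (4 / (1 + N * u)) u := by
    intro u hu
    have h1 : HasDerivAt (fun u : ℝ => 1 + N * u) (N:ℝ) u := by
      simpa using ((hasDerivAt_id u).const_mul (N:ℝ)).const_add 1
    refine ((h1.log (hpos u hu).ne').const_mul (4 / (N:ℝ))).congr_deriv ?_
    have := (hpos u hu).ne'
    field_simp
  have hc : ContinuousOn (fun u : ℝ => 4 / (1 + N * u)) (uIcc (0:ℝ) (1/2)) :=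
    ContinuousOn.div (by fun_prop) (by fun_prop) fun u hu => (hpos u hu).ne'
  have hi := intervalIntegral.integral_eq_sub_of_hasDerivAt hd hc.intervalIntegrable
  have h2 : ∫ u in (0:ℝ)..(1/2), |Psi N u| ≤ ∫ u in (0:ℝ)..(1/2), 4 / (1 + N * u) := by
    apply intervalIntegral.integral_mono_on (by norm_num) ((Psi_cont N).abs.intervalIntegrable _ _) hc.intervalIntegrable
    intro u hu
    have hp := hpos u (by rw [uIcc_of_le (by norm_num)]; exact hu)
    rcases le_total (N * u) (1/3) with h | h
    · refine (Psi_le N u hu.1 hu.2).trans ?_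
      rw [le_div_iff₀ hp]; linarith
    · have hu0 : 0 < u := by
        rcases hu.1.lt_or_eq with h0 | h0
        · exact h0
        · rw [← h0] at h; norm_num at h
      refine (Psi_le' N u hN hu0 hu.2).trans ?_
      rw [div_le_div_iff₀ (by positivity) hp]; nlinarith
  refine h2.trans ?_
  rw [hi]
  simp only [mul_zero, add_zero, Real.log_one, sub_zero]
  gcongr
  have : log (1 + N * (1/2)) ≤ log (exp 1 * N) := by
    apply Real.log_le_log (by positivity)
    have := Real.add_one_le_exp 1
    nlinarith
  rw [Real.log_mul (Real.exp_pos 1).ne' hN0.ne', Real.log_exp] at this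
  exact this

lemma smooth_half (L : ℝ) (N : ℕ) (hN : 1 ≤ N) : |∫ u in (0:ℝ)..(1/2), (exp (L * u) - 1) * Dk N u| ≤ |L| * exp |L| * (4 / N * (1 + log N)) := by
  have h1 : ∀ u ∈ uIcc (0:ℝ) (1/2), HasDerivAt (fun u => exp (L * u) - 1) (L * exp (L * u)) u := by
    intro u _
    have : HasDerivAt (fun u : ℝ => L * u) L u := by simpa using (hasDerivAt_id u).const_mul L
    exact (this.exp.sub_const 1).congr_deriv (by ring)
  have h2 : ∀ u ∈ uIcc (0:ℝ) (1/2), HasDerivAt (fun u => -Psi N u) (Dk N u) u := by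
    intro u _
    exact (Psi_deriv N u).neg.congr_deriv (by ring)
  have h := intervalIntegral.integral_mul_deriv_eq_deriv_mul h1 h2 (Continuous.intervalIntegrable (by fun_prop) _ _) ((continuous_Dk N).intervalIntegrable _ _)
  have hz : Psi N (1/2) = 0 := by unfold Psi; simp
  rw [h, hz]
  simp only [neg_zero, mul_zero, Real.exp_zero, sub_self, zero_mul, zero_sub, abs_neg]
  have := intervalIntegral.norm_integral_le_of_norm_le (a := (0:ℝ)) (b := 1/2) (μ := volume) (f := fun u => L * exp (L * u) * -Psi N u) (g := fun u => |L| * exp |L| * |Psi N u|) (by norm_num)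
    (Eventually.of_forall fun u hu => by
      rw [Real.norm_eq_abs, abs_mul, abs_mul, abs_neg, Real.abs_exp]
      gcongr
      have h0 := hu.1
      calc L * u ≤ |L| * u := by gcongr; exact le_abs_self L
        _ ≤ |L| * 1 := by gcongr; linarith [hu.2]
        _ = |L| := mul_one _)
    (((Psi_cont N).abs.const_mul _).intervalIntegrable _ _)
  rw [intervalIntegral.integral_const_mul] at this
  refine this.trans ?_
  gcongr
  exact int_Psi N hN

lemma Dk_split (N : ℕ) (f : ℝ → ℝ) (hf : Continuous f) : ∫ u in (-(1/2):ℝ)..(1/2), f u * Dk N u =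
    (∫ u in (0:ℝ)..(1/2), f u * Dk N u) + ∫ u in (0:ℝ)..(1/2), f (-u) * Dk N u := by
  have hi : ∀ a c : ℝ, IntervalIntegrable (fun u => f u * Dk N u) volume a c := fun a c => (hf.mul (continuous_Dk N)).intervalIntegrable a c
  rw [← intervalIntegral.integral_add_adjacent_intervals (hi (-(1/2)) 0) (hi 0 (1/2)), add_comm]
  congr 1
  have := intervalIntegral.integral_comp_neg (a := (0:ℝ)) (b := 1/2) (fun u => f u * Dk N u)
  rw [neg_zero] at this
  rw [← this]
  congr 1; ext u; rw [Dk_neg]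

lemma smooth_full (L : ℝ) (N : ℕ) (hN : 1 ≤ N) : |(∫ u in (-(1/2):ℝ)..(1/2), exp (L * u) * Dk N u) - 1| ≤ 2 * (|L| * exp |L| * (4 / N * (1 + log N))) := by
  have e : ∀ L : ℝ, ∫ u in (0:ℝ)..(1/2), (exp (L * u) - 1) * Dk N u = (∫ u in (0:ℝ)..(1/2), exp (L * u) * Dk N u) - 1/2 := by
    intro L
    have e2 : ∀ y : ℝ, y - 1/2 = y - ∫ u in (0:ℝ)..(1/2), Dk N u := fun y => by rw [int_Dk_half]
    rw [e2, ← intervalIntegral.integral_sub]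
    · congr 1; ext u; ring
    · exact ((by fun_prop : Continuous fun u : ℝ => exp (L * u)).mul (continuous_Dk N)).intervalIntegrable _ _
    · exact (continuous_Dk N).intervalIntegrable _ _
  have h1 := smooth_half L N hN
  have h2 := smooth_half (-L) N hN
  rw [e] at h1 h2
  rw [abs_neg] at h2
  rw [Dk_split N (fun u => exp (L * u)) (by fun_prop)]
  simp only [mul_neg]
  simp only [neg_mul] at h2
  rw [abs_le] at *
  constructor <;> linarith [h1.1, h1.2, h2.1, h2.2]

lemma Psi_neg (N : ℕ) (u : ℝ) : Psi N (-u) = 1 - Psi N u := by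
  have h : ∫ v in (0:ℝ)..(-u), Dk N v = - ∫ v in (0:ℝ)..u, Dk N v := by
    have := intervalIntegral.integral_comp_neg (a := (0:ℝ)) (b := u) (fun u => Dk N u)
    rw [neg_zero] at this
    simp only [Dk_neg] at this
    rw [this, intervalIntegral.integral_symm]
  rw [Psi_eq, Psi_eq, h]; ring

lemma step_ii (N : ℕ) (c a d : ℝ) : IntervalIntegrable (fun u => (if c ≤ u then (1:ℝ) else 0) * Dk N u) volume a d := by
  have h := (continuous_Dk N).intervalIntegrable (μ := volume) a d
  rw [intervalIntegrable_iff] at h ⊢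
  apply h.bdd_mul (c := 1)
  · exact (Measurable.ite measurableSet_Ici measurable_const measurable_const).aestronglyMeasurable
  · refine Eventually.of_forall fun u => ?_
    split_ifs <;> simp

lemma step_int (N : ℕ) (hN : 1 ≤ N) (c : ℝ) (hc : c ≠ 0) :
    |(∫ u in (-(1/2):ℝ)..(1/2), (if c ≤ u then (1:ℝ) else 0) * Dk N u) - (if c ≤ 0 then 1 else 0)| ≤ 1 / (3 * N * |c|) := by
  have hR : 0 ≤ 1 / (3 * N * |c|) := by positivity
  have key1 : ∀ a d : ℝ, a ≤ d → d ≤ c → ∫ u in a..d, (if c ≤ u then (1:ℝ) else 0) * Dk N u = 0 := by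
    intro a d had hdc
    apply intervalIntegral.integral_zero_ae
    have : ∀ᵐ u : ℝ, u ≠ c := by simp [ae_iff]
    filter_upwards [this] with u hu hu2
    rw [uIoc_of_le had] at hu2
    rw [if_neg, zero_mul]
    intro h
    exact hu (le_antisymm (hu2.2.trans hdc) h)
  have key2 : ∀ a d : ℝ, a ≤ d → c ≤ a → ∫ u in a..d, (if c ≤ u then (1:ℝ) else 0) * Dk N u = ∫ u in a..d, Dk N u := by
    intro a d had hca
    apply intervalIntegral.integral_congr
    intro u hu
    rw [uIcc_of_le had] at hu
    simp only
    rw [if_pos (hca.trans hu.1), one_mul]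
  rcases le_or_gt c (-(1/2)) with h1 | h1
  · rw [key2 _ _ (by norm_num) h1, if_pos (by linarith)]
    have h0 := Psi_neg N (1/2)
    have hz : Psi N (1/2) = 0 := by unfold Psi; simp
    rw [hz] at h0
    unfold Psi at h0
    rw [h0]; simpa using hR
  rcases le_or_gt c (1/2) with h2 | h2
  · rw [← intervalIntegral.integral_add_adjacent_intervals (step_ii N c (-(1/2)) c) (step_ii N c c (1/2)), key1 _ _ h1.le le_rfl,
      key2 _ _ h2 le_rfl, zero_add]
    change |Psi N c - _| ≤ _
    rcases lt_or_gt_of_ne hc with h3 | h3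
    · rw [if_pos h3.le]
      have := Psi_neg N c
      have h4 := Psi_le' N (-c) hN (by linarith) (by linarith)
      rw [this] at h4
      rw [abs_of_neg h3, abs_sub_comm]; exact h4
    · rw [if_neg (not_le.2 h3), sub_zero, abs_of_pos h3]
      exact Psi_le' N c hN h3 h2
  · rw [key1 _ _ (by norm_num) h2.le, if_neg (by linarith)]
    simpa using hR

lemma floor_sum (x : ℝ) (h0 : 0 ≤ x) (X : ℕ) (hX : x < X + 1) : (⌊x⌋ : ℝ) = ∑ m ∈ range X, if ((m+1:ℕ):ℝ) ≤ x then (1:ℝ) else 0 := by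
  have h1 : (⌊x⌋ : ℝ) = (⌊x⌋₊ : ℝ) := by
    rw [natCast_floor_eq_intCast_floor h0]
  have hF : ⌊x⌋₊ ≤ X := by
    have := Nat.floor_le h0
    have h3 : (⌊x⌋₊:ℝ) < X + 1 := by linarith
    exact Nat.lt_succ_iff.1 (by exact_mod_cast h3)
  rw [h1, ← Finset.sum_filter, Finset.sum_const, nsmul_one]
  congr 1
  have : (range X).filter (fun m => ((m+1:ℕ):ℝ) ≤ x) = range ⌊x⌋₊ := by
    ext m
    rw [Finset.mem_filter, Finset.mem_range, Finset.mem_range, ← Nat.le_floor_iff h0]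
    omega
  rw [this, Finset.card_range]

lemma harm_bound (P : ℕ) (δ B : ℝ) (hδ : 0 < δ) (hB : 0 ≤ B) (hP : log P ≤ B) (g : ℕ → ℝ) (h0 : δ ≤ g 0) (h1 : ∀ j : ℕ, (j:ℝ) ≤ g j) :
    ∑ j ∈ range P, 1 / g j ≤ 1/δ + (1 + B) := by
  have hr : 0 ≤ 1/δ + (1 + B) := by positivity
  cases P with
  | zero => simpa using hr
  | succ P =>
    rw [Finset.sum_range_succ']
    have a1 : 1 / g 0 ≤ 1 / δ := one_div_le_one_div_of_le hδ h0
    have a2 : ∑ j ∈ range P, 1 / g (j+1) ≤ ((harmonic P : ℚ) : ℝ) := by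
      unfold harmonic
      push_cast
      apply Finset.sum_le_sum
      intro j _
      have := h1 (j+1)
      push_cast at this
      rw [← one_div]
      exact one_div_le_one_div_of_le (by positivity) this
    have a3 := harmonic_le_one_add_log P
    have a4 : log P ≤ B := by
      rcases Nat.eq_zero_or_pos P with rfl | h
      · simpa using hB
      · refine le_trans (Real.log_le_log (by exact_mod_cast h) ?_) hP
        push_cast; linarith
    linarith

lemma jump_sum (lam δ B : ℝ) (X : ℕ) (hl : 1 ≤ lam) (hδ : 0 < δ) (hB : 0 ≤ B) (h1 : δ ≤ Int.fract lam) (h2 : Int.fract lam ≤ 1 - δ)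
    (hX : lam < X + 1) (hlog : log X ≤ B) : ∑ m ∈ range X, 1 / |((m+1:ℕ):ℝ) - lam| ≤ 2 * (1/δ + (1 + B)) := by
  set F := ⌊lam⌋₊ with hF
  have e1 : (⌊lam⌋ : ℝ) = (F : ℝ) := by rw [hF, natCast_floor_eq_intCast_floor (by linarith)]
  have e2 : lam = F + Int.fract lam := by rw [← e1]; exact (Int.floor_add_fract lam).symm
  have hF1 : 1 ≤ F := Nat.le_floor (by simpa using hl)
  have hFX : F ≤ X := by
    have h3 : (F:ℝ) < X + 1 := by linarith
    exact Nat.lt_succ_iff.1 (by exact_mod_cast h3)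
  have hX1 : (1:ℝ) ≤ X := by exact_mod_cast hF1.trans hFX
  rw [← Finset.sum_range_add_sum_Ico _ hFX, two_mul]
  apply add_le_add
  · rw [← Finset.sum_range_reflect]
    have := harm_bound F δ B hδ hB ((Real.log_le_log (by exact_mod_cast hF1) (by exact_mod_cast hFX)).trans hlog) (fun j => j + Int.fract lam) (by simpa using h1) (fun j => by linarith)
    refine le_trans (Finset.sum_le_sum fun j hj => le_of_eq ?_) this
    rw [Finset.mem_range] at hj
    congr 1
    have : ((F - 1 - j + 1 : ℕ):ℝ) = F - j := by
      rw [show F - 1 - j + 1 = F - j by omega, Nat.cast_sub hj.le]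
    rw [this, abs_of_nonpos]
    · linarith
    · have : (0:ℝ) ≤ j := by positivity
      linarith
  · rw [Finset.sum_Ico_eq_sum_range]
    have hlX : log ((X - F : ℕ):ℝ) ≤ B := by
      rcases Nat.eq_zero_or_pos (X - F) with h | h
      · rw [h]; simpa using hB
      · refine le_trans (Real.log_le_log (by exact_mod_cast h) ?_) hlog
        exact_mod_cast Nat.sub_le _ _
    have := harm_bound (X - F) δ B hδ hB hlX (fun j => j + (1 - Int.fract lam)) (by simp; linarith) (fun j => by linarith)
    refine le_trans (Finset.sum_le_sum fun j hj => le_of_eq ?_) this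
    congr 1
    push_cast
    have : (0:ℝ) ≤ j := by positivity
    rw [abs_of_nonneg] <;> linarith

lemma log_ratio (L lam y : ℝ) (hL : 0 < L) (hl : 0 < lam) (hy : 0 < y) (hy2 : y ≤ lam * exp L) :
    |y - lam| ≤ L * exp L * lam * |log (y / lam) / L| := by
  have h1 : 1 ≤ exp L := Real.one_le_exp hL.le
  rw [abs_div, abs_of_pos hL]
  have e : L * exp L * lam * (|log (y / lam)| / L) = exp L * lam * |log (y / lam)| := by field_simp
  rw [e]
  rcases le_total y lam with h | h
  · have h2 := Real.add_one_le_exp (log (y / lam))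
    rw [Real.exp_log (by positivity), le_div_iff₀ hl] at h2
    have h3 : log (y / lam) ≤ 0 := Real.log_nonpos (by positivity) ((div_le_one hl).2 h)
    rw [abs_of_nonpos h3, abs_of_nonpos (by linarith)]
    have : 0 ≤ lam * -log (y / lam) := mul_nonneg hl.le (by linarith)
    nlinarith
  · have h2 := Real.one_sub_inv_le_log_of_pos (show 0 < y / lam by positivity)
    have h3 : 0 ≤ log (y / lam) := Real.log_nonneg ((one_le_div hl).2 h)
    rw [abs_of_nonneg h3, abs_of_nonneg (by linarith)]
    have h4 : y * (1 - (y / lam)⁻¹) = y - lam := by field_simp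
    have h5 : y - lam ≤ y * log (y / lam) := by rw [← h4]; gcongr
    refine h5.trans ?_
    rw [mul_comm (exp L)]
    gcongr

lemma BB_one_near (L : ℝ) (hL : 0 < L) : ∃ C : ℝ, 0 < C ∧ ∀ lam : ℝ, 1 ≤ lam → ∀ N : ℕ, 1 ≤ N → lam ≤ N → ∀ δ : ℝ, 0 < δ →
    δ ≤ Int.fract lam → Int.fract lam ≤ 1 - δ → ‖BB 1 L lam N - (PB 1 lam : ℂ)‖ ≤ C * (lam / N) * (1 / δ + 1 + log N) := by
  refine ⟨8 * (L * exp L) + 2 * (L * exp L) * (1 + L), by positivity, ?_⟩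
  intro lam hl N hN hlN δ hδ hf1 hf2
  have hl0 : 0 < lam := by linarith
  have hN0 : (0:ℝ) < N := by exact_mod_cast hN
  have hlogN : 0 ≤ log N := Real.log_natCast_nonneg N
  set X := ⌊lam * exp L⌋₊ with hX
  have hx1 : (X:ℝ) ≤ lam * exp L := Nat.floor_le (by positivity)
  have hx2 : lam * exp L < X + 1 := Nat.lt_floor_add_one _
  have hlX : lam < X + 1 := by
    have : 1 ≤ exp L := Real.one_le_exp hL.le
    nlinarith
  have hX1 : 1 ≤ X := Nat.le_floor (by have : 1 ≤ exp L := Real.one_le_exp hL.le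
                                       push_cast; nlinarith)
  have hlogX : log X ≤ log N + L := by
    have h := Real.log_le_log (by exact_mod_cast hX1) (hx1.trans (mul_le_mul_of_nonneg_right hlN (Real.exp_pos L).le))
    rwa [Real.log_mul hN0.ne' (Real.exp_pos L).ne', Real.log_exp] at h
  let c : ℕ → ℝ := fun m => log (((m+1:ℕ):ℝ) / lam) / L
  have hc : ∀ m : ℕ, ∀ u : ℝ, ((m+1:ℕ):ℝ) ≤ lam * exp (L * u) ↔ c m ≤ u := by
    intro m u
    rw [div_le_iff₀ hL, Real.log_le_iff_le_exp (by positivity), div_le_iff₀ hl0, mul_comm u, mul_comm lam]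
  have hne : ∀ m : ℕ, ((m+1:ℕ):ℝ) - lam ≠ 0 := by
    intro m h
    have : lam = ((m+1:ℕ):ℝ) := by linarith
    rw [this, Int.fract_natCast] at hf1
    linarith
  have hPBe : ∀ u : ℝ, u ≤ 1/2 → PB 1 (lam * exp (L * u)) = lam * exp (L * u) - 1/2 - ∑ m ∈ range X, if c m ≤ u then (1:ℝ) else 0 := by
    intro u hu
    have : lam * exp (L * u) < X + 1 := by
      refine lt_of_le_of_lt ?_ hx2
      gcongr
      nlinarith
    have h2 := floor_sum _ (by positivity) X this
    simp only [hc] at h2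
    rw [← h2, PB_one, ← Int.self_sub_floor]; ring
  have hPB0 := hPBe 0 (by norm_num)
  rw [mul_zero, Real.exp_zero, mul_one] at hPB0
  have hBB : BB 1 L lam N = ((lam * (∫ u in (-(1/2):ℝ)..(1/2), exp (L * u) * Dk N u) - 1/2
      - ∑ m ∈ range X, ∫ u in (-(1/2):ℝ)..(1/2), (if c m ≤ u then (1:ℝ) else 0) * Dk N u : ℝ) : ℂ) := by
    have h1 : ∫ u in (-(1/2):ℝ)..(1/2), Dk N u = 1 := by
      have := Dk_split N (fun _ => 1) continuous_const
      simp only [one_mul] at this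
      rw [this, int_Dk_half]; norm_num
    have h2 : BB 1 L lam N = ((∫ u in (-(1/2):ℝ)..(1/2), PB 1 (lam * exp (L * u)) * Dk N u : ℝ) : ℂ) := by
      unfold BB
      rw [← intervalIntegral.integral_ofReal]
      congr 1; ext u; push_cast; rfl
    have h3 : ∫ u in (-(1/2):ℝ)..(1/2), PB 1 (lam * exp (L * u)) * Dk N u = ∫ u in (-(1/2):ℝ)..(1/2), (lam * (exp (L * u) * Dk N u) - 1/2 * Dk N u - ∑ m ∈ range X, (if c m ≤ u then (1:ℝ) else 0) * Dk N u) := by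
      apply intervalIntegral.integral_congr
      intro u hu
      rw [uIcc_of_le (by norm_num)] at hu
      simp only
      rw [hPBe u hu.2, sub_mul, Finset.sum_mul]; ring
    have i1 : IntervalIntegrable (fun u => lam * (exp (L * u) * Dk N u)) volume (-(1/2)) (1/2) :=
      (((by fun_prop : Continuous fun u : ℝ => exp (L * u)).mul (continuous_Dk N)).const_mul lam).intervalIntegrable _ _
    have i2 : IntervalIntegrable (fun u => 1/2 * Dk N u) volume (-(1/2)) (1/2) :=
      ((continuous_Dk N).const_mul (1/2)).intervalIntegrable _ _
    rw [h2, h3, intervalIntegral.integral_sub (i1.sub i2), intervalIntegral.integral_sub i1 i2,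
      intervalIntegral.integral_finsetSum (fun m _ => step_ii N (c m) _ _), intervalIntegral.integral_const_mul, intervalIntegral.integral_const_mul, h1, mul_one]
    have := IntervalIntegrable.sum (range X) (fun m _ => step_ii N (c m) (-(1/2)) (1/2))
    rw [show (∑ i ∈ range X, fun u => (if c i ≤ u then (1:ℝ) else 0) * Dk N u) = fun u => ∑ i ∈ range X, (if c i ≤ u then (1:ℝ) else 0) * Dk N u from funext fun u => Finset.sum_apply u _ _] at this
    exact this
  rw [hBB, hPB0, ← Complex.ofReal_sub, Complex.norm_real, Real.norm_eq_abs]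
  set I1 := ∫ u in (-(1/2):ℝ)..(1/2), exp (L * u) * Dk N u
  have hs := smooth_full L N hN
  change |I1 - 1| ≤ _ at hs
  rw [abs_of_pos hL] at hs
  have hj : |∑ m ∈ range X, ((∫ u in (-(1/2):ℝ)..(1/2), (if c m ≤ u then (1:ℝ) else 0) * Dk N u) - (if c m ≤ 0 then 1 else 0))| ≤ L * exp L * (lam / N) * (2 * (1/δ + (1 + (log N + L)))) := by
    refine (Finset.abs_sum_le_sum_abs _ _).trans ?_
    have hb : ∀ m ∈ range X, |(∫ u in (-(1/2):ℝ)..(1/2), (if c m ≤ u then (1:ℝ) else 0) * Dk N u) - (if c m ≤ 0 then 1 else 0)| ≤ L * exp L * (lam / N) * (1 / |((m+1:ℕ):ℝ) - lam|) := by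
      intro m hm
      rw [Finset.mem_range] at hm
      have hr := log_ratio L lam ((m+1:ℕ):ℝ) hL hl0 (by positivity) ((by exact_mod_cast hm : ((m+1:ℕ):ℝ) ≤ X).trans hx1)
      change _ ≤ _ * |c m| at hr
      have hpos := abs_pos.2 (hne m)
      have hc0 : c m ≠ 0 := by
        intro h
        rw [h, abs_zero, mul_zero] at hr
        linarith
      have hcp := abs_pos.2 hc0
      refine (step_int N hN (c m) hc0).trans ?_
      rw [← mul_div_assoc, mul_one, ← mul_div_assoc, div_div, div_le_div_iff₀ (by positivity) (by positivity)]
      have : 0 ≤ L * exp L * lam * |c m| := by positivity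
      nlinarith
    refine (Finset.sum_le_sum hb).trans ?_
    rw [← Finset.mul_sum]
    gcongr
    exact jump_sum lam δ _ X hl hδ (by positivity) hf1 hf2 hlX hlogX
  rw [Finset.sum_sub_distrib] at hj
  set S1 := ∑ m ∈ range X, ∫ u in (-(1/2):ℝ)..(1/2), (if c m ≤ u then (1:ℝ) else 0) * Dk N u
  set S2 := ∑ m ∈ range X, if c m ≤ 0 then (1:ℝ) else 0
  have e : lam * I1 - 1/2 - S1 - (lam - 1/2 - S2) = lam * (I1 - 1) - (S1 - S2) := by ring
  rw [e]
  refine (abs_sub _ _).trans ?_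
  rw [abs_mul, abs_of_pos hl0]
  have hδ1 : 0 < 1/δ := by positivity
  have hE : 0 < L * exp L * (lam / N) := by positivity
  calc lam * |I1 - 1| + |S1 - S2| ≤ lam * (2 * (L * exp L * (4 / N * (1 + log N)))) + L * exp L * (lam / N) * (2 * (1/δ + (1 + (log N + L)))) := by gcongr
    _ = L * exp L * (lam / N) * (8 * (1 + log N) + 2 * (1/δ + (1 + (log N + L)))) := by ring
    _ ≤ L * exp L * (lam / N) * ((8 + 2 * (1 + L)) * (1/δ + 1 + log N)) := by
      gcongr
      nlinarith [mul_pos hL hδ1, mul_nonneg hL.le hlogN]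
    _ = _ := by ring

lemma geo3 (b n : ℕ) (hb : 2 ≤ b) : ∑ l ∈ range n, (b:ℝ)^l ≤ (b:ℝ)^n := by
  have hb' : (2:ℝ) ≤ b := by exact_mod_cast hb
  induction n with
  | zero => simp
  | succ n ih =>
    rw [Finset.sum_range_succ, pow_succ]
    have : 0 < (b:ℝ)^n := by positivity
    nlinarith

set_option maxHeartbeats 1000000 in
open Classical in
lemma SS_zero (b : ℕ) (hb : 2 ≤ b) (α : ℝ) (hα : 1 < α) (hαb : α < b) :
    ∃ κ : ℂ, ∃ C : ℝ, 0 < C ∧ ∀ δ : ℝ, 0 < δ → ∀ G N : ℕ, 1 ≤ N →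
      ‖SS 0 (log b) α N - κ * ∑ l ∈ range (Nat.log b N + 1), (PB 1 (α * (b:ℝ)^l) : ℂ)‖ ≤
        C * (1 + ∑ l ∈ range (Nat.log b N + 1), (if Int.fract (α * (b:ℝ)^l) < δ ∨ 1 - δ < Int.fract (α * (b:ℝ)^l) then (1:ℝ) else 0) + G + 1 / (b:ℝ)^G * (1 / δ + 1 + log N)) := by
  have hb1 : (1:ℝ) < b := by exact_mod_cast (by omega : 1 < b)
  have hL : 0 < log b := Real.log_pos hb1
  obtain ⟨κ, hκ, C1, h1⟩ := reduction 0 (log b) α hL hα (Real.log_lt_log (by linarith) hαb)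
  obtain ⟨C2, hC2, h2⟩ := BB_one_bound (log b) hL.ne'
  obtain ⟨C3, hC3, h3⟩ := BB_one_near (log b) hL
  set C4 := C2 * b + 1 with hC4
  have hC4p : 0 < C4 := by positivity
  refine ⟨κ, |C1| + ‖κ‖ * (C2 * 2 + C4 + C3 * α) + 1, by positivity, fun δ hδ G N hN => ?_⟩
  obtain ⟨J, hJ1, hJ2⟩ := ((h1 N).and (eventually_ge_atTop (Nat.log b N + 1))).exists
  simp only [exp_log_mul b hb] at hJ1
  set T := Nat.log b N with hT
  have hN0 : (0:ℝ) < N := by exact_mod_cast hN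
  have hlogN : 0 ≤ log N := Real.log_natCast_nonneg N
  have hTN : (b:ℝ)^T ≤ N := by exact_mod_cast Nat.pow_log_le_self b (by omega : N ≠ 0)
  have hNT : (N:ℝ) ≤ (b:ℝ)^(T+1) := by exact_mod_cast (Nat.lt_pow_succ_log_self (by omega) N).le
  have hlam : ∀ l : ℕ, 1 ≤ α * (b:ℝ)^l := fun l => by
    have : 1 ≤ (b:ℝ)^l := one_le_pow₀ hb1.le
    nlinarith
  have hsplit := Finset.sum_range_add_sum_Ico (fun l => BB 1 (log b) (α * (b:ℝ)^l) N) hJ2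
  set E := 1 / δ + 1 + log N with hE
  have hE0 : 0 ≤ E := by positivity
  have hlamN : ∀ l, l < T → α * (b:ℝ)^l ≤ N := by
    intro l hl
    calc α * (b:ℝ)^l ≤ b * (b:ℝ)^l := by gcongr
      _ = (b:ℝ)^(l+1) := by ring
      _ ≤ (b:ℝ)^T := pow_le_pow_right₀ hb1.le hl
      _ ≤ N := hTN
  have hPB : ∀ x : ℝ, ‖(PB 1 x : ℂ)‖ ≤ 1 := by
    intro x
    rw [Complex.norm_real, Real.norm_eq_abs, PB_one, abs_le]
    have := Int.fract_nonneg x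
    have := Int.fract_lt_one x
    constructor <;> linarith
  have hall : ∀ l ∈ range (T+1), ‖BB 1 (log b) (α * (b:ℝ)^l) N - (PB 1 (α * (b:ℝ)^l) : ℂ)‖ ≤ C4 := by
    intro l hl
    refine (norm_sub_le _ _).trans (add_le_add ?_ (hPB _))
    rw [Finset.mem_range] at hl
    rcases Nat.lt_succ_iff_lt_or_eq.1 hl with h | h
    · refine ((h2 _ (hlam l) N hN).2 (hlamN l h)).trans ?_
      nlinarith
    · refine (h2 _ (hlam l) N hN).1.trans ?_
      gcongr
      rw [div_le_iff₀ (by have := hlam l; linarith)]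
      refine hNT.trans ?_
      rw [pow_succ, ← h]
      have : 0 < (b:ℝ)^l * b := by positivity
      nlinarith
  have g1 : ‖∑ l ∈ range (T+1), (BB 1 (log b) (α * (b:ℝ)^l) N - (PB 1 (α * (b:ℝ)^l) : ℂ))‖ ≤
      C4 * (∑ l ∈ range (T+1), (if Int.fract (α * (b:ℝ)^l) < δ ∨ 1 - δ < Int.fract (α * (b:ℝ)^l) then (1:ℝ) else 0)) + C4 * (G+1) + C3 * α * (1 / (b:ℝ)^G * E) := by
    refine (norm_sum_le_of_le (f := fun l => BB 1 (log b) (α * (b:ℝ)^l) N - (PB 1 (α * (b:ℝ)^l) : ℂ)) (n := fun l => C4 * (if Int.fract (α * (b:ℝ)^l) < δ ∨ 1 - δ < Int.fract (α * (b:ℝ)^l) then (1:ℝ) else 0) + C4 * (if l < T - G then 0 else 1) + C3 * α * E / N * (if l < T - G then (b:ℝ)^l else 0)) _ ?_).trans ?_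
    · intro l hl
      have := hall l hl
      have p1 : 0 ≤ C3 * α * E / N * (b:ℝ)^l := by positivity
      by_cases hbad : Int.fract (α * (b:ℝ)^l) < δ ∨ 1 - δ < Int.fract (α * (b:ℝ)^l)
      · rw [if_pos hbad]
        split_ifs <;> linarith
      · rw [if_neg hbad]
        by_cases hlT : l < T - G
        · rw [if_pos hlT, if_pos hlT]
          push Not at hbad
          refine (h3 _ (hlam l) N hN (hlamN l (by omega)) δ hδ hbad.1 hbad.2).trans (le_of_eq ?_)
          rw [← hE]; ring
        · rw [if_neg hlT, if_neg hlT]; linarith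
    · rw [Finset.sum_add_distrib, Finset.sum_add_distrib, ← Finset.mul_sum, ← Finset.mul_sum, ← Finset.mul_sum]
      have q1 : ∑ l ∈ range (T+1), (if l < T - G then (0:ℝ) else 1) ≤ G + 1 := by
        have : ∑ l ∈ range (T+1), (if l < T - G then (0:ℝ) else 1) = ∑ l ∈ range (T+1), (if ¬ (l < T - G) then (1:ℝ) else 0) := by
          apply Finset.sum_congr rfl; intro l _; split_ifs <;> simp_all
        rw [this, ← Finset.sum_filter, Finset.sum_const, nsmul_one]
        have : (range (T+1)).filter (fun l => ¬ (l < T - G)) ⊆ Finset.Ico (T - G) (T+1) := by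
          intro l hl
          rw [Finset.mem_filter, Finset.mem_range] at hl
          rw [Finset.mem_Ico]; omega
        have := Finset.card_le_card this
        rw [Nat.card_Ico] at this
        have h4 : (Finset.filter (fun l => ¬ (l < T - G)) (range (T+1))).card ≤ G + 1 := by omega
        exact_mod_cast h4
      have q2 : ∑ l ∈ range (T+1), (if l < T - G then (b:ℝ)^l else 0) ≤ N / (b:ℝ)^G := by
        rcases le_total T G with hTG | hTG
        · rw [Finset.sum_eq_zero]
          · positivity
          · intro l _; rw [if_neg (by omega)]
        rw [← Finset.sum_filter]
        have : (range (T+1)).filter (fun l => l < T - G) ⊆ range (T-G) := by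
          intro l hl
          rw [Finset.mem_filter] at hl
          exact Finset.mem_range.2 hl.2
        refine (Finset.sum_le_sum_of_subset_of_nonneg this (fun _ _ _ => by positivity)).trans ((geo3 b (T-G) hb).trans ?_)
        rw [le_div_iff₀ (by positivity), ← pow_add, Nat.sub_add_cancel hTG]
        exact hTN
      have q3 : C3 * α * E / N * ∑ l ∈ range (T+1), (if l < T - G then (b:ℝ)^l else 0) ≤ C3 * α * (1 / (b:ℝ)^G * E) := by
        calc _ ≤ C3 * α * E / N * (N / (b:ℝ)^G) := by gcongr
          _ = _ := by field_simp
      gcongr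
  have g2 : ‖∑ l ∈ Finset.Ico (T+1) J, BB 1 (log b) (α * (b:ℝ)^l) N‖ ≤ C2 * 2 := by
    refine (norm_sum_le_of_le (n := fun l => C2 * ((N:ℝ) / (b:ℝ)^l)) _ ?_).trans ?_
    · intro l _
      refine (h2 _ (hlam l) N hN).1.trans ?_
      have : (0:ℝ) < (b:ℝ)^l := by positivity
      gcongr
      nlinarith
    · rw [← Finset.mul_sum]
      gcongr
      exact geo2 b N J hb
  rw [Finset.sum_sub_distrib] at g1
  rw [zero_add, ← hsplit] at hJ1
  set X1 := ∑ l ∈ range (T+1), BB 1 (log b) (α * (b:ℝ)^l) N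
  set X2 := ∑ l ∈ Finset.Ico (T+1) J, BB 1 (log b) (α * (b:ℝ)^l) N
  set X3 := ∑ l ∈ range (T+1), (PB 1 (α * (b:ℝ)^l) : ℂ)
  set Bd := ∑ l ∈ range (T+1), (if Int.fract (α * (b:ℝ)^l) < δ ∨ 1 - δ < Int.fract (α * (b:ℝ)^l) then (1:ℝ) else 0)
  have hBd : 0 ≤ Bd := Finset.sum_nonneg fun l _ => by split_ifs <;> norm_num
  have e : SS 0 (log b) α N - κ * X3 = (SS 0 (log b) α N - κ * (X1 + X2)) + κ * ((X1 - X3) + X2) := by ring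
  rw [e]
  have k1 : ‖κ * ((X1 - X3) + X2)‖ ≤ ‖κ‖ * (C2 * 2 + C4 + C3 * α) * (1 + Bd + G + 1 / (b:ℝ)^G * E) := by
    rw [norm_mul, mul_assoc]
    gcongr
    refine (norm_add_le _ _).trans ((add_le_add g1 g2).trans ?_)
    have r1 : 0 ≤ 1 / (b:ℝ)^G * E := by positivity
    have r2 : (0:ℝ) ≤ G := by positivity
    set Y := 1 / (b:ℝ)^G * E
    have r3 : 0 < C3 * α := by positivity
    nlinarith [mul_nonneg hC2.le r1, mul_nonneg hC2.le r2, mul_nonneg hC2.le hBd, mul_nonneg hC4p.le r1, mul_nonneg r3.le r2, mul_nonneg r3.le hBd]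
  have k2 : C1 ≤ |C1| * (1 + Bd + G + 1 / (b:ℝ)^G * E) := by
    have r1 : 0 ≤ 1 / (b:ℝ)^G * E := by positivity
    have r2 : (0:ℝ) ≤ G := by positivity
    have := le_abs_self C1
    have r4 := abs_nonneg C1
    nlinarith [mul_nonneg r4 r1, mul_nonneg r4 r2, mul_nonneg r4 hBd]
  have r1 : 0 ≤ 1 + Bd + G + 1 / (b:ℝ)^G * E := by positivity
  calc _ ≤ C1 + ‖κ‖ * (C2 * 2 + C4 + C3 * α) * (1 + Bd + G + 1 / (b:ℝ)^G * E) := (norm_add_le _ _).trans (add_le_add hJ1 k1)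
    _ ≤ |C1| * (1 + Bd + G + 1 / (b:ℝ)^G * E) + ‖κ‖ * (C2 * 2 + C4 + C3 * α) * (1 + Bd + G + 1 / (b:ℝ)^G * E) := by linarith
    _ ≤ _ := by nlinarith

/-- Cesaro mean -/
noncomputable def ces (u : ℕ → ℝ) (n : ℕ) : ℝ := (∑ l ∈ range n, u l) / n

lemma ces_close (u v : ℕ → ℝ) (C x : ℝ) (h : ∀ n, |∑ l ∈ range n, u l - ∑ l ∈ range n, v l| ≤ C)
    (hu : Tendsto (ces u) atTop (𝓝 x)) : Tendsto (ces v) atTop (𝓝 x) := by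
  have h0 : Tendsto (fun n => ces u n - ces v n) atTop (𝓝 0) := by
    apply squeeze_zero_norm (a := fun n : ℕ => C * ((n:ℝ))⁻¹)
    · intro n
      unfold ces
      rw [← sub_div, Real.norm_eq_abs, abs_div, div_eq_mul_inv, Nat.abs_cast]
      gcongr
      exact h n
    · simpa using (tendsto_inv_atTop_nhds_zero_nat (𝕜 := ℝ)).const_mul C
  have := hu.sub h0
  simpa using this

lemma shift_sum (u : ℕ → ℝ) (C : ℝ) (hC : ∀ l, |u l| ≤ C) (t n : ℕ) :
    |∑ l ∈ range n, u (l + t) - ∑ l ∈ range n, u l| ≤ 2 * t * C := by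
  induction t with
  | zero => simp
  | succ t ih =>
    have h1 := Finset.sum_range_succ (fun l => u (l + t)) n
    rw [Finset.sum_range_succ'] at h1
    have h2 : ∑ l ∈ range n, u (l + (t+1)) = ∑ l ∈ range n, u (l + 1 + t) :=
      Finset.sum_congr rfl fun l _ => by congr 1; ring
    have h3 := abs_le.1 (hC (n + t))
    have h4 := abs_le.1 (hC (0 + t))
    rw [h2]
    push_cast
    rw [abs_le] at ih ⊢
    constructor <;> linarith [ih.1, ih.2]

lemma ces_shift (u : ℕ → ℝ) (C x : ℝ) (hC : ∀ l, |u l| ≤ C) (t : ℕ) :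
    Tendsto (ces (fun l => u (l + t))) atTop (𝓝 x) ↔ Tendsto (ces u) atTop (𝓝 x) :=
  ⟨fun h => ces_close _ _ (2 * t * C) x (shift_sum u C hC t) h,
   fun h => ces_close _ _ (2 * t * C) x (fun n => by rw [abs_sub_comm]; exact shift_sum u C hC t n) h⟩

lemma sum_block (u : ℕ → ℝ) (k n : ℕ) : ∑ l ∈ range (n * k), u l = ∑ i ∈ range n, ∑ r ∈ range k, u (k * i + r) := by
  induction n with
  | zero => simp
  | succ n ih =>
    rw [Finset.sum_range_succ, ← ih, Nat.succ_mul, Finset.sum_range_add]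
    simp only [mul_comm]

/-- integer part of `y b^l` -/
noncomputable def DD (b : ℕ) (y : ℝ) (l : ℕ) : ℕ := ⌊y * (b:ℝ)^l⌋₊

lemma DD_div (b : ℕ) (hb : 2 ≤ b) (y : ℝ) (l s : ℕ) : DD b y (l + s) / b^s = DD b y l := by
  unfold DD
  rw [← Nat.floor_div_natCast]
  congr 1
  have : (b:ℝ) ≠ 0 := by positivity
  push_cast
  rw [pow_add]; field_simp

lemma DD_pow (b k : ℕ) (y : ℝ) (i : ℕ) : DD (b^k) y i = DD b y (k * i) := by
  unfold DD; push_cast; rw [pow_mul]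

/-- equidistribution of blocks -/
def HypE (b : ℕ) (y : ℝ) : Prop := ∀ m c : ℕ, c < b^m →
  Tendsto (ces fun l => if DD b y l % b^m = c then (1:ℝ) else 0) atTop (𝓝 (1 / (b:ℝ)^m))

lemma ces_add (u v : ℕ → ℝ) (x y : ℝ) (hu : Tendsto (ces u) atTop (𝓝 x)) (hv : Tendsto (ces v) atTop (𝓝 y)) :
    Tendsto (ces fun l => u l + v l) atTop (𝓝 (x + y)) := by
  refine (hu.add hv).congr fun n => ?_
  unfold ces; rw [Finset.sum_add_distrib, add_div]

lemma ces_mul (c : ℝ) (u : ℕ → ℝ) (x : ℝ) (hu : Tendsto (ces u) atTop (𝓝 x)) :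
    Tendsto (ces fun l => c * u l) atTop (𝓝 (c * x)) := by
  refine (hu.const_mul c).congr fun n => ?_
  unfold ces; rw [← Finset.mul_sum, mul_div_assoc]

lemma ces_const (c : ℝ) : Tendsto (ces fun _ => c) atTop (𝓝 c) := by
  refine tendsto_const_nhds.congr' ?_
  filter_upwards [eventually_gt_atTop 0] with n hn
  have : (n:ℝ) ≠ 0 := by positivity
  unfold ces; simp; field_simp

lemma ces_sum {ι : Type*} (s : Finset ι) (u : ι → ℕ → ℝ) (x : ι → ℝ) (h : ∀ i ∈ s, Tendsto (ces (u i)) atTop (𝓝 (x i))) :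
    Tendsto (ces fun l => ∑ i ∈ s, u i l) atTop (𝓝 (∑ i ∈ s, x i)) := by
  refine (tendsto_finsetSum s h).congr fun n => ?_
  unfold ces; rw [← Finset.sum_div, Finset.sum_comm]

lemma ind_sum (g : ℕ → ℝ) (q : ℕ) (hq : 0 < q) (d : ℕ) : g (d % q) = ∑ c ∈ range q, g c * (if d % q = c then (1:ℝ) else 0) := by
  rw [Finset.sum_eq_single (d % q)]
  · simp
  · intro c _ hc; rw [if_neg (Ne.symm hc), mul_zero]
  · intro h; exact absurd (Finset.mem_range.2 (Nat.mod_lt _ hq)) h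

lemma freq_sum (q : ℕ) (hq : 0 < q) (d : ℕ → ℕ) (h : ∀ c < q, Tendsto (ces fun l => if d l % q = c then (1:ℝ) else 0) atTop (𝓝 (1 / q)))
    (g : ℕ → ℝ) : Tendsto (ces fun l => g (d l % q)) atTop (𝓝 ((∑ c ∈ range q, g c) / q)) := by
  have := ces_sum (range q) (fun c l => g c * (if d l % q = c then (1:ℝ) else 0)) (fun c => g c * (1/q))
    (fun c hc => ces_mul _ _ _ (h c (Finset.mem_range.1 hc)))
  rw [← Finset.sum_mul, mul_one_div] at this
  simpa only [← ind_sum g q hq] using this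

/-- averages along multiples of `k` control everything -/
lemma ces_block (u : ℕ → ℝ) (C : ℝ) (hC : ∀ l, |u l| ≤ C)
    (h : ∀ ε > 0, ∃ k : ℕ, 0 < k ∧ ∀ᶠ n : ℕ in atTop, |∑ l ∈ range (n * k), u l| ≤ ε * (n * k)) :
    Tendsto (ces u) atTop (𝓝 0) := by
  rw [Metric.tendsto_atTop']
  intro ε hε
  obtain ⟨k, hk, hev⟩ := h (ε/2) (by positivity)
  obtain ⟨n0, hn0⟩ := eventually_atTop.1 hev
  have hC0 : 0 ≤ C := (abs_nonneg _).trans (hC 0)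
  obtain ⟨n1, hn1⟩ := exists_nat_gt (2 * (k * C) / ε)
  refine ⟨max (n0 * k) n1, fun n hn => ?_⟩
  have h1 : n0 ≤ n / k := (Nat.le_div_iff_mul_le hk).2 (by have := le_max_left (n0*k) n1; omega)
  have h2 : (n1:ℝ) < n := by exact_mod_cast lt_of_le_of_lt (le_max_right _ _) hn
  have h3 := hn0 _ h1
  have hnp : (0:ℝ) < n := lt_of_le_of_lt (Nat.cast_nonneg _) h2
  have h4 : k * C < ε / 2 * n := by
    have := hn1.trans h2
    rw [div_lt_iff₀ hε] at this; linarith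
  have h5 : n = n / k * k + n % k := by rw [mul_comm]; exact (Nat.div_add_mod n k).symm
  have h6 : |∑ l ∈ range n, u l| ≤ ε / 2 * n + k * C := by
    conv_lhs => rw [h5]
    rw [Finset.sum_range_add]
    refine (abs_add_le _ _).trans (add_le_add (h3.trans ?_) ?_)
    · gcongr
      exact_mod_cast Nat.div_mul_le_self n k
    · refine (Finset.abs_sum_le_sum_abs _ _).trans ((Finset.sum_le_sum fun i _ => hC _).trans ?_)
      rw [Finset.sum_const, Finset.card_range, nsmul_eq_mul]
      gcongr
      exact (Nat.mod_lt n hk).le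
  rw [dist_zero_right, Real.norm_eq_abs, ces, abs_div, Nat.abs_cast, div_lt_iff₀ hnp]
  linarith

lemma simply_iff (B : ℕ) (y : ℝ) (hy : 0 < y) : SimplyNormal B y ↔
    ∀ a < B, Tendsto (ces fun i => if DD B y i % B = a then (1:ℝ) else 0) atTop (𝓝 (1 / B)) := by
  refine forall₂_congr fun a ha => ?_
  have e0 : ∀ i, (⌊y * (B:ℝ)^i⌋ % (B:ℤ) = (a:ℤ)) ↔ DD B y i % B = a := by
    intro i
    have : ((DD B y i : ℕ) : ℤ) = ⌊y * (B:ℝ)^i⌋ := Int.natCast_floor_eq_floor (by positivity)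
    rw [← this]; norm_cast
  set u : ℕ → ℝ := fun i => if DD B y i % B = a then (1:ℝ) else 0 with hu
  have hb : ∀ i, |u i| ≤ 1 := by intro i; simp only [hu]; split_ifs <;> simp
  have e : ∀ l, (digitCount B y a l : ℝ) = ∑ i ∈ range (l+1), u i := by
    intro l
    simp only [hu, digitCount]
    rw [← Finset.sum_filter, Finset.sum_const, nsmul_one]
    congr 2
    exact Finset.filter_congr fun i _ => e0 i
  have h0 : Tendsto (fun l : ℕ => u l / l) atTop (𝓝 0) := by
    apply squeeze_zero_norm (a := fun n : ℕ => 1 * ((n:ℝ))⁻¹)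
    · intro n
      rw [Real.norm_eq_abs, abs_div, div_eq_mul_inv, Nat.abs_cast]
      gcongr
      exact hb n
    · simpa using (tendsto_inv_atTop_nhds_zero_nat (𝕜 := ℝ)).const_mul 1
  constructor
  · intro h
    have h1 := h.sub h0
    rw [sub_zero] at h1
    refine h1.congr fun l => ?_
    rw [e, Finset.sum_range_succ, ces]; ring
  · intro h
    have h1 := h.add h0
    rw [add_zero] at h1
    refine h1.congr fun l => ?_
    rw [e, Finset.sum_range_succ, ces]; ring

lemma sum_div_block (g : ℕ → ℝ) (p n : ℕ) (hp : 0 < p) : ∑ a ∈ range (n * p), g (a / p) = p * ∑ i ∈ range n, g i := by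
  rw [sum_block (fun a => g (a/p)), Finset.mul_sum]
  refine Finset.sum_congr rfl fun i _ => ?_
  rw [Finset.sum_congr rfl (g := fun _ => g i), Finset.sum_const, Finset.card_range, nsmul_eq_mul]
  intro r hr
  rw [Nat.mul_add_div hp, Nat.div_eq_of_lt (Finset.mem_range.1 hr), add_zero]

lemma sum_mod_block (g : ℕ → ℝ) (p n : ℕ) : ∑ a ∈ range (n * p), g (a % p) = n * ∑ i ∈ range p, g i := by
  rw [sum_block (fun a => g (a%p))]
  have : ∀ i ∈ range n, ∑ r ∈ range p, g ((p * i + r) % p) = ∑ r ∈ range p, g r := by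
    intro i _
    refine Finset.sum_congr rfl fun r hr => ?_
    rw [Nat.mul_add_mod, Nat.mod_eq_of_lt (Finset.mem_range.1 hr)]
  rw [Finset.sum_congr rfl this, Finset.sum_const, Finset.card_range, nsmul_eq_mul]

lemma normal_hypE (b : ℕ) (hb : 2 ≤ b) (y : ℝ) (hy : 0 < y) (h : NormalToBase b y) : HypE b y := by
  intro m c hc
  set u : ℕ → ℝ := fun l => if DD b y l % b^m = c then (1:ℝ) else 0 with hu
  have hu1 : ∀ l, |u l - 1 / (b:ℝ)^m| ≤ 1 := by
    intro l
    have h1 : (0:ℝ) < 1 / (b:ℝ)^m := by positivity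
    have h2 : 1 / (b:ℝ)^m ≤ 1 := by
      rw [div_le_one (by positivity)]
      exact one_le_pow₀ (by exact_mod_cast (by omega : 1 ≤ b))
    simp only [hu]; rw [abs_le]; split_ifs <;> constructor <;> linarith
  suffices H : Tendsto (ces fun l => u l - 1 / (b:ℝ)^m) atTop (𝓝 0) by
    have := ces_add _ _ _ _ H (ces_const (1 / (b:ℝ)^m))
    simpa using this
  refine ces_block _ 1 hu1 fun ε hε => ?_
  obtain ⟨k, hk⟩ := exists_nat_gt (2 * m / ε + m)
  have hmk : m < k := by
    have : (m:ℝ) < k := lt_of_le_of_lt (by have : 0 ≤ 2 * m / ε := by positivity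
                                           linarith) hk
    exact_mod_cast this
  refine ⟨k, by omega, ?_⟩
  have hkε : (m:ℝ) ≤ ε / 2 * k := by
    have : 2 * m / ε < k := by have : (0:ℝ) ≤ m := by positivity
                               linarith
    rw [div_lt_iff₀ hε] at this; linarith
  have hdig := (simply_iff (b^k) y hy).1 (h k (by omega))
  have hr : ∀ r ∈ Finset.Ico m k, Tendsto (ces fun i => u (k * i + r) - 1 / (b:ℝ)^m) atTop (𝓝 0) := by
    intro r hr
    rw [Finset.mem_Ico] at hr
    set g : ℕ → ℝ := fun a => if (a / b^(k-r)) % b^m = c then (1:ℝ) else 0 with hg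
    have h1 := freq_sum (b^k) (by positivity) (DD (b^k) y) hdig g
    have h1b : ∀ l, |g (DD (b^k) y l % b^k)| ≤ 1 := by intro i; simp only [hg]; split_ifs <;> simp
    have h2 := (ces_shift _ 1 _ h1b 1).2 h1
    have e1 : ∀ i, g (DD (b^k) y (i+1) % b^k) = u (k * i + r) := by
      intro i
      simp only [hg, hu]
      rw [DD_pow, show k * (i+1) = (k * i + r) + (k - r) by rw [mul_add]; omega,
        show b^k = b^(k-r) * b^r by rw [← pow_add]; congr 1; omega, Nat.mod_mul_right_div_self,
        DD_div b hb, Nat.mod_mod_of_dvd _ (pow_dvd_pow b hr.1)]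
    have e2 : ∑ a ∈ range (b^k), g a = b^(k-m) := by
      rw [show b^k = b^(r-m) * b^m * b^(k-r) by rw [← pow_add, ← pow_add]; congr 1; omega]
      rw [hg, sum_div_block (fun a => if a % b^m = c then (1:ℝ) else 0) _ _ (by positivity),
        sum_mod_block (fun a => if a = c then (1:ℝ) else 0)]
      rw [Finset.sum_ite_eq', if_pos (Finset.mem_range.2 hc)]
      push_cast
      rw [mul_one, ← pow_add]; congr 1; omega
    rw [e2] at h2
    simp only [e1] at h2
    have e3 : (b:ℝ)^(k-m) / ((b^k : ℕ):ℝ) = 1 / (b:ℝ)^m := by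
      have : (b:ℝ)^k = b^(k-m) * b^m := by rw [← pow_add]; congr 1; omega
      push_cast
      rw [this]
      have : (b:ℝ) ≠ 0 := by positivity
      field_simp
    rw [e3] at h2
    have := ces_add _ _ _ _ h2 (ces_const (-(1 / (b:ℝ)^m)))
    simpa [sub_eq_add_neg] using this
  have hs := ces_sum (Finset.Ico m k) (fun r i => u (k * i + r) - 1 / (b:ℝ)^m) _ hr
  rw [Finset.sum_const_zero] at hs
  have hkp : (0:ℝ) < k := by exact_mod_cast (by omega : 0 < k)
  have hs2 := (Metric.tendsto_atTop'.1 hs) (ε / 2 * k) (by positivity)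
  obtain ⟨n0, hn0⟩ := hs2
  filter_upwards [eventually_gt_atTop n0] with n hn
  have h3 := hn0 n hn
  have hnp : (0:ℝ) < n := by exact_mod_cast (by omega : 0 < n)
  rw [dist_zero_right, Real.norm_eq_abs, ces, abs_div, Nat.abs_cast, div_lt_iff₀ hnp] at h3
  rw [sum_block (fun l => u l - 1 / (b:ℝ)^m)]
  have h4 : ∀ i, ∑ r ∈ range k, (u (k*i+r) - 1 / (b:ℝ)^m) =
      ∑ r ∈ range m, (u (k*i+r) - 1 / (b:ℝ)^m) + ∑ r ∈ Finset.Ico m k, (u (k*i+r) - 1 / (b:ℝ)^m) :=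
    fun i => (Finset.sum_range_add_sum_Ico _ hmk.le).symm
  simp only [h4]
  rw [Finset.sum_add_distrib]
  have h5 : |∑ i ∈ range n, ∑ r ∈ range m, (u (k*i+r) - 1 / (b:ℝ)^m)| ≤ n * m := by
    refine (Finset.abs_sum_le_sum_abs _ _).trans ((Finset.sum_le_sum (g := fun _ => (m:ℝ)) fun i _ => ?_).trans ?_)
    · refine (Finset.abs_sum_le_sum_abs _ _).trans ((Finset.sum_le_sum fun i _ => hu1 _).trans ?_)
      simp
    · simp
  refine (abs_add_le _ _).trans ?_
  have h6 : (n:ℝ) * m ≤ n * (ε / 2 * k) := by gcongr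
  linarith

lemma fract_cell (b : ℕ) (hb : 2 ≤ b) (y : ℝ) (hy : 0 < y) (l m : ℕ) :
    ((DD b y (l+m) % b^m : ℕ):ℝ) / ((b^m : ℕ):ℝ) ≤ Int.fract (y * (b:ℝ)^l) ∧
    Int.fract (y * (b:ℝ)^l) < (((DD b y (l+m) % b^m : ℕ):ℝ) + 1) / ((b^m : ℕ):ℝ) := by
  have hq : (0:ℝ) < ((b^m : ℕ):ℝ) := by positivity
  have h0 : 0 ≤ y * (b:ℝ)^l := by positivity
  have h1 : (⌊y * (b:ℝ)^l⌋ : ℝ) = (DD b y l : ℝ) := (natCast_floor_eq_intCast_floor h0).symm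
  have h2 := Nat.div_add_mod (DD b y (l+m)) (b^m)
  rw [DD_div b hb] at h2
  have h3 : ((b^m : ℕ):ℝ) * DD b y l + ((DD b y (l+m) % b^m : ℕ):ℝ) = DD b y (l+m) := by exact_mod_cast h2
  have h4 : (DD b y (l+m) : ℝ) ≤ y * (b:ℝ)^(l+m) := Nat.floor_le (by positivity)
  have h5 : y * (b:ℝ)^(l+m) < DD b y (l+m) + 1 := Nat.lt_floor_add_one _
  have h6 : y * (b:ℝ)^(l+m) = y * (b:ℝ)^l * ((b^m : ℕ):ℝ) := by push_cast; ring
  rw [div_le_iff₀ hq, lt_div_iff₀ hq, Int.fract, h1]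
  constructor <;> nlinarith

lemma hypE_shift (b : ℕ) (hb : 2 ≤ b) (y : ℝ) (h : HypE b y) (m : ℕ) (g : ℕ → ℝ) :
    Tendsto (ces fun l => g (DD b y (l+m) % b^m)) atTop (𝓝 ((∑ c ∈ range (b^m), g c) / ((b^m:ℕ):ℝ))) := by
  have hq : 0 < b^m := by positivity
  have h' : ∀ c < b^m, Tendsto (ces fun l => if DD b y l % b^m = c then (1:ℝ) else 0) atTop (𝓝 (1 / ((b^m:ℕ):ℝ))) := by
    intro c hc; rw [Nat.cast_pow]; exact h m c hc
  generalize b^m = q at h' hq ⊢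
  have h1 := freq_sum q hq (DD b y) h' g
  refine (ces_shift (fun l => g (DD b y l % q)) (∑ c ∈ range q, |g c|) _ (fun l => ?_) m).2 h1
  exact Finset.single_le_sum (f := fun c => |g c|) (fun _ _ => abs_nonneg _) (Finset.mem_range.2 (Nat.mod_lt _ hq))

lemma hypE_PB (b : ℕ) (hb : 2 ≤ b) (y : ℝ) (hy : 0 < y) (h : HypE b y) (K : ℕ) (hK : 1 ≤ K) :
    Tendsto (ces fun l => PB K (y * (b:ℝ)^l)) atTop (𝓝 0) := by
  have huc : UniformContinuousOn (bernoulliFun K) (Icc 0 1) :=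
    isCompact_Icc.uniformContinuousOn_of_continuous (continuous_bernoulliFun (k := K)).continuousOn
  rw [Metric.tendsto_atTop']
  intro ε hε
  obtain ⟨δ, hδ, hu⟩ := Metric.uniformContinuousOn_iff.1 huc (ε/3) (by positivity)
  have hb1 : (1:ℝ) < b := by exact_mod_cast (by omega : 1 < b)
  obtain ⟨m1, hm1⟩ := pow_unbounded_of_one_lt (max (1/δ) (3 * |bernoulliFun K 0| / ε)) hb1
  set q : ℕ := b^m1 with hq
  have hqr : (q:ℝ) = (b:ℝ)^m1 := by push_cast [hq]; rfl
  have hqp : (0:ℝ) < q := by rw [hqr]; positivity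
  have hq1 : (1:ℝ) ≤ q := by rw [hqr]; exact one_le_pow₀ hb1.le
  rw [← hqr] at hm1
  have hq2 : 1 / (q:ℝ) < δ := by
    rw [div_lt_iff₀ hqp, ← div_lt_iff₀' hδ]; exact (le_max_left _ _).trans_lt hm1
  have hq3 : |bernoulliFun K 0| / q < ε / 3 := by
    have := (le_max_right _ _).trans_lt hm1
    rw [div_lt_iff₀ hε] at this
    rw [div_lt_iff₀ hqp]; linarith
  have h1 := hypE_shift b hb y h m1 (fun c => bernoulliFun K ((c:ℝ)/q))
  have h2 := bernoulliFun_mul K (m := q) (by rw [hq]; positivity) 0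
  simp only [mul_zero, zero_add] at h2
  have h3 : |(∑ c ∈ range q, bernoulliFun K ((c:ℝ)/q)) / q| < ε / 3 := by
    refine lt_of_le_of_lt ?_ hq3
    have e : (∑ c ∈ range q, bernoulliFun K ((c:ℝ)/q)) / q = bernoulliFun K 0 / q^K := by
      rw [h2]; field_simp
    rw [e, abs_div, abs_of_pos (a := (q:ℝ)^K) (by positivity)]
    gcongr
    calc (q:ℝ) = q^1 := (pow_one _).symm
      _ ≤ q^K := pow_le_pow_right₀ hq1 hK
  obtain ⟨n0, hn0⟩ := (Metric.tendsto_atTop'.1 h1) (ε/3) (by positivity)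
  refine ⟨n0, fun n hn => ?_⟩
  have h4 := hn0 n hn
  have hnp : (0:ℝ) < n := by exact_mod_cast (by omega : 0 < n)
  rw [dist_zero_right, Real.norm_eq_abs]
  rw [Real.dist_eq] at h4
  have h5 : |ces (fun l => PB K (y * (b:ℝ)^l)) n - ces (fun l => bernoulliFun K (((DD b y (l+m1) % b^m1 : ℕ):ℝ)/q)) n| ≤ ε / 3 := by
    unfold ces
    rw [← sub_div, ← Finset.sum_sub_distrib, abs_div, Nat.abs_cast, div_le_iff₀ hnp]
    refine (Finset.abs_sum_le_sum_abs _ _).trans ((Finset.sum_le_sum (g := fun _ => ε/3) fun l _ => ?_).trans ?_)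
    · have hc := fract_cell b hb y hy l m1
      rw [← hq] at hc
      have hlt : ((DD b y (l+m1) % q : ℕ):ℝ) < q := by exact_mod_cast Nat.mod_lt _ (by positivity)
      have hcd : ((DD b y (l+m1) % q : ℕ):ℝ) / q < 1 := by rwa [div_lt_one hqp]
      have h6 := hu (Int.fract (y * (b:ℝ)^l)) ⟨Int.fract_nonneg _, (Int.fract_lt_one _).le⟩
        (((DD b y (l+m1) % q : ℕ):ℝ) / q) ⟨by positivity, hcd.le⟩ ?_
      · rw [Real.dist_eq] at h6; exact h6.le
      · rw [add_div] at hc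
        rw [Real.dist_eq, abs_lt]; constructor <;> linarith [hc.1, hc.2]
    · rw [Finset.sum_const, Finset.card_range, nsmul_eq_mul, mul_comm]
  rw [abs_le] at h5
  rw [abs_lt] at h4 h3 ⊢
  constructor <;> linarith [h5.1, h5.2, h4.1, h4.2, h3.1, h3.2]

open Classical in
lemma hypE_bad (b : ℕ) (hb : 2 ≤ b) (y : ℝ) (hy : 0 < y) (h : HypE b y) (m : ℕ) (hm : 1 ≤ m) (ε : ℝ) (hε : 0 < ε) :
    ∀ᶠ n : ℕ in atTop, ∑ l ∈ range n, (if Int.fract (y * (b:ℝ)^l) < 1 / (b:ℝ)^m ∨ 1 - 1 / (b:ℝ)^m < Int.fract (y * (b:ℝ)^l) then (1:ℝ) else 0)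
      ≤ (2 / (b:ℝ)^m + ε) * n := by
  set g : ℕ → ℝ := fun c => (if c = 0 then (1:ℝ) else 0) + (if c = b^m - 1 then (1:ℝ) else 0) with hg
  have h1 := hypE_shift b hb y h m g
  have hqn : 2 ≤ b^m := by calc 2 ≤ b := hb
                           _ = b^1 := (pow_one b).symm
                           _ ≤ b^m := Nat.pow_le_pow_right (by omega) hm
  have e : ∑ c ∈ range (b^m), g c = 2 := by
    rw [hg, Finset.sum_add_distrib, Finset.sum_ite_eq', Finset.sum_ite_eq', if_pos, if_pos]
    · norm_num
    · rw [Finset.mem_range]; omega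
    · rw [Finset.mem_range]; omega
  rw [e] at h1
  filter_upwards [h1.eventually_lt_const (show _ < 2 / ((b^m:ℕ):ℝ) + ε by linarith), eventually_gt_atTop 0] with n hn hn0
  have hnp : (0:ℝ) < n := by exact_mod_cast hn0
  rw [ces, div_lt_iff₀ hnp] at hn
  push_cast at hn
  refine le_trans (Finset.sum_le_sum fun l _ => ?_) hn.le
  have hc := fract_cell b hb y hy l m
  have hlt : DD b y (l+m) % b^m < b^m := Nat.mod_lt _ (by positivity)
  have hqp : (0:ℝ) < ((b^m:ℕ):ℝ) := by positivity
  rw [div_le_iff₀ hqp, lt_div_iff₀ hqp] at hc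
  have hg0 : 0 ≤ g (DD b y (l+m) % b^m) := by simp only [hg]; split_ifs <;> norm_num
  by_cases h3 : Int.fract (y * (b:ℝ)^l) < 1 / (b:ℝ)^m ∨ 1 - 1 / (b:ℝ)^m < Int.fract (y * (b:ℝ)^l)
  · rw [if_pos h3]
    rcases h3 with h3 | h3
    · rw [show ((b:ℝ)^m) = ((b^m:ℕ):ℝ) by push_cast; rfl, lt_div_iff₀ hqp] at h3
      have h4 : ((DD b y (l+m) % b^m : ℕ):ℝ) < 1 := by linarith [hc.1]
      have h5 : DD b y (l+m) % b^m = 0 := by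
        exact Nat.lt_one_iff.1 (by exact_mod_cast h4)
      simp only [hg, h5, if_true]; split_ifs <;> norm_num
    · rw [show ((b:ℝ)^m) = ((b^m:ℕ):ℝ) by push_cast; rfl] at h3
      have h4 : ((b^m:ℕ):ℝ) < ((DD b y (l+m) % b^m : ℕ):ℝ) + 1 + 1 := by
        have := mul_lt_mul_of_pos_right h3 hqp
        rw [sub_mul, one_mul, one_div, inv_mul_cancel₀ hqp.ne'] at this
        linarith [hc.2]
      have h5 : DD b y (l+m) % b^m = b^m - 1 := by
        have : b^m < DD b y (l+m) % b^m + 1 + 1 := by exact_mod_cast h4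
        omega
      simp only [hg, h5, if_true]; split_ifs <;> norm_num
  · rw [if_neg h3]; exact hg0

lemma natlog_le (b : ℕ) (hb : 2 ≤ b) (N : ℕ) (hN : b ≤ N) : ((Nat.log b N + 1 : ℕ):ℝ) ≤ 3 * log N := by
  have h1 : 1 ≤ Nat.log b N := Nat.log_pos (by omega) hN
  have h2 : b ^ Nat.log b N ≤ N := Nat.pow_log_le_self b (by omega)
  have h3 : ((2:ℝ)) ^ Nat.log b N ≤ N := by
    calc ((2:ℝ)) ^ Nat.log b N ≤ (b:ℝ)^Nat.log b N := by gcongr; exact_mod_cast hb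
      _ ≤ N := by exact_mod_cast h2
  have h4 := Real.log_le_log (by positivity) h3
  rw [Real.log_pow] at h4
  have h5 := Real.log_two_gt_d9
  have h6 : (1:ℝ) ≤ Nat.log b N := by exact_mod_cast h1
  push_cast
  nlinarith

lemma tendsto_T (b : ℕ) (hb : 2 ≤ b) : Tendsto (fun N => Nat.log b N + 1) atTop atTop := by
  refine tendsto_atTop.2 fun M => ?_
  filter_upwards [eventually_ge_atTop (b^M)] with N hN
  have := Nat.le_log_of_pow_le (by omega : 1 < b) hN
  omega

lemma tendsto_logN : Tendsto (fun N : ℕ => log N) atTop atTop :=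
  Real.tendsto_log_atTop.comp tendsto_natCast_atTop_atTop

/-- a criterion for convergence to zero after normalisation -/
lemma norm_crit (S : ℕ → ℂ) (h : ∀ ε > 0, ∀ᶠ N : ℕ in atTop, ‖S N‖ ≤ ε * log N) :
    Tendsto (fun N : ℕ => (1 / (log N : ℂ)) * S N) atTop (𝓝 0) := by
  rw [Metric.tendsto_atTop']
  intro ε hε
  obtain ⟨n0, hn0⟩ := eventually_atTop.1 ((h (ε/2) (by positivity)).and (tendsto_logN.eventually_gt_atTop 0))
  refine ⟨n0, fun n hn => ?_⟩
  obtain ⟨h1, h2⟩ := hn0 n (le_of_lt hn)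
  rw [dist_zero_right, norm_mul, norm_div, norm_one, Complex.norm_real, Real.norm_eq_abs, abs_of_pos h2, one_div,
    inv_mul_lt_iff₀ h2]
  nlinarith

lemma sumPB_small (b : ℕ) (hb : 2 ≤ b) (v : ℕ → ℝ) (κ : ℂ) (hv : Tendsto (ces v) atTop (𝓝 0)) (ε : ℝ) (hε : 0 < ε) :
    ∀ᶠ N : ℕ in atTop, ‖κ * ∑ l ∈ range (Nat.log b N + 1), (v l : ℂ)‖ ≤ ε * log N := by
  have h1 := (Metric.tendsto_nhds.1 hv) (ε / (3 * (‖κ‖ + 1))) (by positivity)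
  have h2 := (tendsto_T b hb).eventually h1
  filter_upwards [h2, eventually_ge_atTop b] with N hN hNb
  have h3 := natlog_le b hb N hNb
  have hT : (0:ℝ) < ((Nat.log b N + 1 : ℕ):ℝ) := by positivity
  rw [dist_zero_right, Real.norm_eq_abs, ces, abs_div, Nat.abs_cast, div_lt_iff₀ hT] at hN
  rw [norm_mul, ← Complex.ofReal_sum, Complex.norm_real, Real.norm_eq_abs]
  set X := |∑ l ∈ range (Nat.log b N + 1), v l|
  calc ‖κ‖ * X ≤ (‖κ‖ + 1) * (ε / (3 * (‖κ‖ + 1)) * ((Nat.log b N + 1 : ℕ):ℝ)) := by gcongr; linarith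
    _ = ε / 3 * ((Nat.log b N + 1 : ℕ):ℝ) := by field_simp
    _ ≤ ε / 3 * (3 * log N) := by gcongr
    _ = _ := by ring

lemma forward_pos (b : ℕ) (hb : 2 ≤ b) (α : ℝ) (h1 : 1 < α) (h2 : α < b) (h : HypE b α) (k : ℕ) (hk : 1 ≤ k) :
    Tendsto (fun N : ℕ => (1 / (log N : ℂ)) * SS k (log b) α N) atTop (𝓝 0) := by
  obtain ⟨κ, -, C, hC⟩ := SS_pos k hk b hb α h1 h2
  refine norm_crit _ fun ε hε => ?_
  filter_upwards [sumPB_small b hb _ κ (hypE_PB b hb α (by linarith) h (k+1) (by omega)) (ε/2) (by positivity),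
    eventually_ge_atTop 1, tendsto_logN.eventually_ge_atTop (2 * C / ε)] with N hN hN1 hN2
  rw [div_le_iff₀ hε] at hN2
  have h3 := hC N hN1
  have h4 := norm_le_norm_add_norm_sub' (SS k (log b) α N) (κ * ∑ l ∈ range (Nat.log b N + 1), (PB (k+1) (α * (b:ℝ)^l) : ℂ))
  linarith

lemma forward_zero (b : ℕ) (hb : 2 ≤ b) (α : ℝ) (h1 : 1 < α) (h2 : α < b) (h : HypE b α) :
    Tendsto (fun N : ℕ => (1 / (log N : ℂ)) * SS 0 (log b) α N) atTop (𝓝 0) := by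
  obtain ⟨κ, C, hC0, hC⟩ := SS_zero b hb α h1 h2
  refine norm_crit _ fun ε hε => ?_
  have hb1 : (1:ℝ) < b := by exact_mod_cast (by omega : 1 < b)
  obtain ⟨m, hm⟩ := pow_unbounded_of_one_lt (36 * C / ε) hb1
  set q : ℝ := (b:ℝ)^(m+1) with hq
  have hqm : 36 * C / ε < q := by
    refine hm.trans ?_
    rw [hq, pow_succ]
    have : (0:ℝ) < (b:ℝ)^m := by positivity
    nlinarith
  have hqp : 0 < q := by positivity
  have hCq : C / q ≤ ε / 36 := by
    rw [div_lt_iff₀ hε] at hqm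
    rw [div_le_iff₀ hqp]; linarith
  have hbad := (tendsto_T b hb).eventually (hypE_bad b hb α (by linarith) h (m+1) (by omega) (1/q) (by positivity))
  filter_upwards [sumPB_small b hb _ κ (hypE_PB b hb α (by linarith) h 1 (by omega)) (ε/4) (by positivity),
    eventually_ge_atTop b, hbad, tendsto_logN.eventually_ge_atTop (4 * (C * (1 + ((m+1:ℕ):ℝ) + 1 / q * (q + 1))) / ε),
    tendsto_logN.eventually_ge_atTop 0] with N hN hNb hB hN2 hlog
  have h3 := hC (1/q) (by positivity) (m+1) N (by omega)
  have h4 := norm_le_norm_add_norm_sub' (SS 0 (log b) α N) (κ * ∑ l ∈ range (Nat.log b N + 1), (PB 1 (α * (b:ℝ)^l) : ℂ))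
  have h5 := natlog_le b hb N hNb
  rw [div_le_iff₀ hε] at hN2
  rw [← hq] at h3 hB
  set X := ∑ l ∈ range (Nat.log b N + 1), (if Int.fract (α * (b:ℝ)^l) < 1 / q ∨ 1 - 1 / q < Int.fract (α * (b:ℝ)^l) then (1:ℝ) else 0)
  rw [one_div_one_div] at h3
  have h6 : C * X ≤ ε / 4 * log N := by
    calc C * X ≤ C * ((2 / q + 1 / q) * ((Nat.log b N + 1 : ℕ):ℝ)) := by gcongr
      _ ≤ C * ((2 / q + 1 / q) * (3 * log N)) := by gcongr
      _ = C / q * (9 * log N) := by ring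
      _ ≤ ε / 36 * (9 * log N) := by gcongr
      _ = _ := by ring
  have h7 : C / q * log N ≤ ε / 36 * log N := by gcongr
  have h8 : C * (1 + X + ((m+1:ℕ):ℝ) + 1 / q * (q + 1 + log N)) =
    C * (1 + ((m+1:ℕ):ℝ) + 1 / q * (q + 1)) + C * X + C / q * log N := by ring
  rw [h8] at h3
  have h9 : 0 ≤ ε * log N := by positivity
  linarith

lemma back_PB (b : ℕ) (hb : 2 ≤ b) (α : ℝ) (h1 : 1 < α) (h2 : α < b) (k : ℕ) (hk : 1 ≤ k)
    (h : Tendsto (fun N : ℕ => (1 / (log N : ℂ)) * SS k (log b) α N) atTop (𝓝 0)) :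
    Tendsto (ces fun l => PB (k+1) (α * (b:ℝ)^l)) atTop (𝓝 0) := by
  obtain ⟨κ, hκ, C, hC⟩ := SS_pos k hk b hb α h1 h2
  rw [← tendsto_add_atTop_iff_nat 1]
  have hp : Tendsto (fun J : ℕ => b^J) atTop atTop := tendsto_pow_atTop_atTop_of_one_lt (by omega)
  have h3 := (h.comp hp).norm
  rw [norm_zero] at h3
  have hlb : 0 < log b := Real.log_pos (by exact_mod_cast (by omega : 1 < b))
  have h4 : Tendsto (fun J : ℕ => (log b / ‖κ‖) * ‖((fun N : ℕ => (1 / (log N : ℂ)) * SS k (log b) α N) ∘ fun J : ℕ => b^J) J‖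
      + |C| / ‖κ‖ * (1 / ((J:ℝ) + 1))) atTop (𝓝 0) := by
    have := (h3.const_mul (log b / ‖κ‖)).add ((tendsto_one_div_add_atTop_nhds_zero_nat (𝕜 := ℝ)).const_mul (|C| / ‖κ‖))
    simpa using this
  have hκp : 0 < ‖κ‖ := norm_pos_iff.2 hκ
  refine squeeze_zero_norm' ?_ h4
  filter_upwards [eventually_gt_atTop 0] with J hJ
  have hJp : (0:ℝ) < J := by exact_mod_cast hJ
  have h5 := hC (b^J) (Nat.one_le_pow _ _ (by omega))
  rw [Nat.log_pow (by omega)] at h5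
  have e1 : log ((b^J : ℕ):ℝ) = J * log b := by push_cast; rw [Real.log_pow]
  simp only [Function.comp]
  rw [e1, norm_mul, norm_div, norm_one, Complex.norm_real, Real.norm_eq_abs, Real.norm_eq_abs, abs_of_pos (a := J * log b) (by positivity),
    ces, abs_div, Nat.abs_cast]
  rw [← Complex.ofReal_sum] at h5
  set S := ∑ l ∈ range (J+1), PB (k+1) (α * (b:ℝ)^l)
  set Z := SS k (log b) α (b^J)
  have h6 : ‖κ‖ * |S| ≤ ‖Z‖ + |C| := by
    have := norm_le_norm_add_norm_sub (Z) (κ * (S:ℂ))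
    rw [norm_mul, Complex.norm_real, Real.norm_eq_abs] at this
    linarith [le_abs_self C]
  have h7 : |S| ≤ (‖Z‖ + |C|) / ‖κ‖ := by rw [le_div_iff₀ hκp]; linarith
  push_cast
  calc |S| / ((J:ℝ)+1) ≤ ((‖Z‖ + |C|) / ‖κ‖) / ((J:ℝ)+1) := by gcongr
    _ = ‖Z‖ / ‖κ‖ / ((J:ℝ)+1) + |C| / ‖κ‖ * (1 / ((J:ℝ)+1)) := by ring
    _ ≤ ‖Z‖ / ‖κ‖ / (J:ℝ) + |C| / ‖κ‖ * (1 / ((J:ℝ)+1)) := by gcongr; linarith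
    _ = _ := by field_simp

/-- polynomials, corrected to be periodic, have the right averages -/
lemma poly_mean (x : ℕ → ℝ) (h : ∀ K, 2 ≤ K → Tendsto (ces fun l => bernoulliFun K (x l)) atTop (𝓝 0)) (p : Polynomial ℝ) :
    Tendsto (ces fun l => p.eval (x l) - (p.eval 1 - p.eval 0) * x l) atTop
      (𝓝 (∫ t in (0:ℝ)..1, (p.eval t - (p.eval 1 - p.eval 0) * t))) := by
  have hint : ∀ p : Polynomial ℝ, IntervalIntegrable (fun t => p.eval t - (p.eval 1 - p.eval 0) * t) volume 0 1 := by
    intro p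
    exact Continuous.intervalIntegrable (by fun_prop) _ _
  set P : Polynomial ℝ → Prop := fun p => Tendsto (ces fun l => p.eval (x l) - (p.eval 1 - p.eval 0) * x l) atTop
      (𝓝 (∫ t in (0:ℝ)..1, (p.eval t - (p.eval 1 - p.eval 0) * t))) with hP
  have hadd : ∀ p q, P p → P q → P (p + q) := by
    intro p q hp hq
    have := ces_add _ _ _ _ hp hq
    rw [← intervalIntegral.integral_add (hint p) (hint q)] at this
    simp only [hP, Polynomial.eval_add]
    refine (this.congr fun n => ?_).trans_eq ?_
    · congr 1; ext l; ring
    · congr 1; apply intervalIntegral.integral_congr; intro t _; simp only; ring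
  have hmul : ∀ (c : ℝ) p, P p → P (Polynomial.C c * p) := by
    intro c p hp
    have := ces_mul c _ _ hp
    rw [← intervalIntegral.integral_const_mul] at this
    simp only [hP, Polynomial.eval_mul, Polynomial.eval_C]
    refine (this.congr fun n => ?_).trans_eq ?_
    · congr 1; ext l; ring
    · congr 1; apply intervalIntegral.integral_congr; intro t _; simp only; ring
  have hB : ∀ n, P ((Polynomial.bernoulli n).map (algebraMap ℚ ℝ)) := by
    intro n
    have e : ∀ t, ((Polynomial.bernoulli n).map (algebraMap ℚ ℝ)).eval t = bernoulliFun n t := fun t => rfl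
    simp only [hP, e]
    rcases n with _ | _ | n
    · simp only [bernoulliFun_zero, sub_self, zero_mul, sub_zero]
      simpa using ces_const 1
    · simp only [zero_add, bernoulliFun_one]
      have : ∀ t : ℝ, t - 1/2 - (1 - 1/2 - (0 - 1/2)) * t = -1/2 := by intro t; ring
      simp only [this]
      simpa using ces_const (-1/2)
    · have h0 : bernoulliFun (n+2) 1 = bernoulliFun (n+2) 0 := bernoulliFun_endpoints_eq_of_ne_one (by omega)
      show Tendsto (ces fun l => bernoulliFun (n+2) (x l) - (bernoulliFun (n+2) 1 - bernoulliFun (n+2) 0) * x l) atTop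
        (𝓝 (∫ t in (0:ℝ)..1, (bernoulliFun (n+2) t - (bernoulliFun (n+2) 1 - bernoulliFun (n+2) 0) * t)))
      rw [h0]
      simp only [sub_self, zero_mul, sub_zero]
      rw [integral_bernoulliFun_eq_zero (by omega)]
      exact h (n+2) (by omega)
  have h0 : P 0 := by
    have := hmul 0 _ (hB 0)
    simpa only [Polynomial.C_0, zero_mul] using this
  have hsum : ∀ (s : Finset ℕ) (f : ℕ → Polynomial ℝ), (∀ i ∈ s, P (f i)) → P (∑ i ∈ s, f i) := by
    intro s f hf
    exact Finset.sum_induction f P hadd h0 hf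
  refine Polynomial.induction_on' p hadd fun n a => ?_
  have e := congrArg (Polynomial.map (algebraMap ℚ ℝ)) (Polynomial.sum_bernoulli n)
  rw [Polynomial.map_sum] at e
  have e2 : (Polynomial.monomial n a : Polynomial ℝ) = Polynomial.C (a / ((n:ℝ)+1)) *
      ∑ k ∈ range (n+1), Polynomial.C (((n+1).choose k : ℕ):ℝ) * (Polynomial.bernoulli k).map (algebraMap ℚ ℝ) := by
    have : ∑ k ∈ range (n+1), Polynomial.C (((n+1).choose k : ℕ):ℝ) * (Polynomial.bernoulli k).map (algebraMap ℚ ℝ) = Polynomial.monomial n ((n:ℝ)+1) := by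
      rw [Polynomial.map_monomial] at e
      convert e using 1
      · refine Finset.sum_congr rfl fun k _ => ?_
        rw [Polynomial.smul_eq_C_mul, Polynomial.map_mul, Polynomial.map_C]; simp
      · simp
    rw [this, Polynomial.C_mul_monomial, div_mul_cancel₀]
    positivity
  show P _
  rw [e2]
  exact hmul _ _ (hsum _ _ fun i _ => hmul _ _ (hB i))

lemma cont_mean (x : ℕ → ℝ) (hx : ∀ l, x l ∈ Icc (0:ℝ) 1)
    (h : ∀ K, 2 ≤ K → Tendsto (ces fun l => bernoulliFun K (x l)) atTop (𝓝 0)) (f : ℝ → ℝ) (hf : Continuous f) (h01 : f 0 = f 1) :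
    Tendsto (ces fun l => f (x l)) atTop (𝓝 (∫ t in (0:ℝ)..1, f t)) := by
  rw [Metric.tendsto_atTop']
  intro ε hε
  obtain ⟨p, hp⟩ := exists_polynomial_near_of_continuousOn 0 1 f hf.continuousOn (ε/12) (by positivity)
  have hp0 := abs_lt.1 (hp 0 (by simp))
  have hp1 := abs_lt.1 (hp 1 (by simp))
  set r : ℝ → ℝ := fun t => p.eval t - (p.eval 1 - p.eval 0) * t with hr
  have hrc : Continuous r := by simp only [hr]; fun_prop
  have hrf : ∀ t ∈ Icc (0:ℝ) 1, |f t - r t| ≤ ε / 4 := by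
    intro t ht
    have h1 := abs_lt.1 (hp t ht)
    have h2 : |(p.eval 1 - p.eval 0) * t| ≤ ε / 6 := by
      rw [abs_mul, abs_of_nonneg ht.1]
      have : |p.eval 1 - p.eval 0| ≤ ε / 6 := by rw [abs_le]; constructor <;> linarith
      nlinarith [abs_nonneg (p.eval 1 - p.eval 0), ht.1, ht.2]
    rw [abs_le] at h2 ⊢
    simp only [hr]
    constructor <;> linarith
  obtain ⟨n0, hn0⟩ := (Metric.tendsto_atTop'.1 (poly_mean x h p)) (ε/4) (by positivity)
  refine ⟨n0, fun n hn => ?_⟩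
  have h4 := hn0 n hn
  have hnp : (0:ℝ) < n := by exact_mod_cast (by omega : 0 < n)
  rw [Real.dist_eq] at h4 ⊢
  have h5 : |ces (fun l => f (x l)) n - ces (fun l => r (x l)) n| ≤ ε / 4 := by
    unfold ces
    rw [← sub_div, ← Finset.sum_sub_distrib, abs_div, Nat.abs_cast, div_le_iff₀ hnp]
    refine (Finset.abs_sum_le_sum_abs _ _).trans ((Finset.sum_le_sum (g := fun _ => ε/4) fun l _ => hrf _ (hx l)).trans ?_)
    rw [Finset.sum_const, Finset.card_range, nsmul_eq_mul, mul_comm]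
  have h6 : |(∫ t in (0:ℝ)..1, f t) - ∫ t in (0:ℝ)..1, r t| ≤ ε / 4 := by
    rw [← intervalIntegral.integral_sub (hf.intervalIntegrable _ _) (hrc.intervalIntegrable _ _)]
    have := intervalIntegral.norm_integral_le_of_norm_le_const (a := (0:ℝ)) (b := 1) (f := fun t => f t - r t) (C := ε/4) (fun t ht => by
      rw [uIoc_of_le zero_le_one] at ht
      exact hrf t ⟨ht.1.le, ht.2⟩)
    simpa using this
  rw [abs_le] at h5 h6
  rw [abs_lt] at h4 ⊢
  constructor <;> linarith [h5.1, h5.2, h4.1, h4.2, h6.1, h6.2]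

/-- lower bound for the frequency of an interval -/
lemma cell_lower (x : ℕ → ℝ) (hx : ∀ l, x l ∈ Icc (0:ℝ) 1)
    (h : ∀ K, 2 ≤ K → Tendsto (ces fun l => bernoulliFun K (x l)) atTop (𝓝 0)) (c d : ℝ) (hc : 0 ≤ c) (hcd : c < d) (hd : d ≤ 1)
    (w : ℕ → ℝ) (hw0 : ∀ l, 0 ≤ w l) (hw : ∀ l, c ≤ x l → x l < d → w l = 1) (ε : ℝ) (hε : 0 < ε) :
    ∀ᶠ n : ℕ in atTop, d - c - ε < ces w n := by
  set η : ℝ := min (ε / 4) ((d - c) / 2) with hη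
  have hηp : 0 < η := lt_min (by positivity) (by linarith)
  have hη1 : η ≤ ε / 4 := min_le_left _ _
  have hη2 : η ≤ (d - c) / 2 := min_le_right _ _
  set f : ℝ → ℝ := fun t => min 1 (max 0 (min (t - c) (d - t) / η)) with hf
  have hfc : Continuous f := by simp only [hf]; fun_prop
  have f0 : f 0 = 0 := by
    have : min (0 - c) (d - 0) / η ≤ 0 := div_nonpos_of_nonpos_of_nonneg ((min_le_left _ _).trans (by linarith)) hηp.le
    simp only [hf]; rw [max_eq_left this]; simp
  have f1 : f 1 = 0 := by
    have : min (1 - c) (d - 1) / η ≤ 0 := div_nonpos_of_nonpos_of_nonneg ((min_le_right _ _).trans (by linarith)) hηp.le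
    simp only [hf]; rw [max_eq_left this]; simp
  have fnn : ∀ t, 0 ≤ f t := fun t => le_min zero_le_one (le_max_left _ _)
  have h1 := cont_mean x hx h f hfc (f0.trans f1.symm)
  have hI : d - c - 2 * η ≤ ∫ t in (0:ℝ)..1, f t := by
    calc d - c - 2 * η = ∫ t in (c+η)..(d-η), (1:ℝ) := by simp; ring
      _ = ∫ t in (c+η)..(d-η), f t := by
        refine intervalIntegral.integral_congr fun t ht => ?_
        rw [uIcc_of_le (by linarith)] at ht
        have : 1 ≤ min (t - c) (d - t) / η := by
          rw [le_div_iff₀ hηp, one_mul]; exact le_min (by linarith [ht.1]) (by linarith [ht.2])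
        simp only [hf]
        rw [max_eq_right (by linarith), min_eq_left this]
      _ ≤ _ := intervalIntegral.integral_mono_interval (by linarith) (by linarith) (by linarith)
        (Eventually.of_forall fnn) (hfc.intervalIntegrable _ _)
  filter_upwards [h1.eventually_const_lt (show d - c - ε < _ by linarith)] with n hn
  refine hn.trans_le ?_
  unfold ces
  gcongr with l _
  by_cases h2 : c ≤ x l ∧ x l < d
  · rw [hw l h2.1 h2.2]; exact min_le_left _ _
  · refine le_trans ?_ (hw0 l)
    have : min (x l - c) (d - x l) / η ≤ 0 := by
      refine div_nonpos_of_nonpos_of_nonneg ?_ hηp.le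
      by_cases h3 : c ≤ x l
      · refine (min_le_right _ _).trans ?_
        have : d ≤ x l := by by_contra h4; exact h2 ⟨h3, not_le.1 h4⟩
        linarith
      · exact (min_le_left _ _).trans (by linarith)
    simp only [hf]; rw [max_eq_left this]; simp

lemma back_hypE (b : ℕ) (hb : 2 ≤ b) (y : ℝ) (hy : 0 < y)
    (h : ∀ K, 2 ≤ K → Tendsto (ces fun l => PB K (y * (b:ℝ)^l)) atTop (𝓝 0)) : HypE b y := by
  intro m c hc
  set q : ℕ := b^m with hq
  have hqp : (0:ℝ) < q := by rw [hq]; positivity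
  have hqr : (q:ℝ) = (b:ℝ)^m := by push_cast [hq]; rfl
  rw [← hqr]
  set u : ℕ → ℕ → ℝ := fun c l => if DD b y l % q = c then (1:ℝ) else 0 with hu
  have hu1 : ∀ c l, |u c l| ≤ 1 := by intro c l; simp only [hu]; split_ifs <;> simp
  refine (ces_shift (u c) 1 _ (hu1 c) m).1 ?_
  have hlow : ∀ c < q, ∀ ε > 0, ∀ᶠ n : ℕ in atTop, 1 / (q:ℝ) - ε < ces (fun l => u c (l+m)) n := by
    intro c hc ε hε
    have hc1 : (c:ℝ) + 1 ≤ q := by exact_mod_cast hc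
    have := cell_lower (fun l => Int.fract (y * (b:ℝ)^l)) (fun l => ⟨Int.fract_nonneg _, (Int.fract_lt_one _).le⟩) h
      (c / q) ((c + 1) / q) (by positivity) (by gcongr; linarith) (by rwa [div_le_one hqp]) (fun l => u c (l+m))
      (fun l => by simp only [hu]; split_ifs <;> norm_num) (fun l h1 h2 => ?_) ε hε
    · rwa [← sub_div, add_sub_cancel_left] at this
    · have h3 := fract_cell b hb y hy l m
      rw [← hq] at h3
      rw [div_le_iff₀ hqp] at h1 h3
      rw [lt_div_iff₀ hqp] at h2 h3
      have h4 : (c:ℝ) < ((DD b y (l+m) % q : ℕ):ℝ) + 1 := by linarith [h3.2]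
      have h5 : ((DD b y (l+m) % q : ℕ):ℝ) < c + 1 := by linarith [h3.1]
      have h6 : c < DD b y (l+m) % q + 1 := by exact_mod_cast h4
      have h7 : DD b y (l+m) % q < c + 1 := by exact_mod_cast h5
      simp only [hu]; rw [if_pos (by omega)]
  rw [Metric.tendsto_nhds]
  intro ε hε
  have hall : ∀ᶠ n : ℕ in atTop, ∀ c ∈ range q, 1 / (q:ℝ) - ε / q < ces (fun l => u c (l+m)) n :=
    (Finset.eventually_all _).2 fun c hc => hlow c (Finset.mem_range.1 hc) (ε / q) (by positivity)
  filter_upwards [hall, eventually_gt_atTop 0] with n hn hn0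
  have hnp : (0:ℝ) < n := by exact_mod_cast hn0
  have hsum : ∑ c ∈ range q, ces (fun l => u c (l+m)) n = 1 := by
    unfold ces
    rw [← Finset.sum_div, Finset.sum_comm, div_eq_one_iff_eq hnp.ne']
    have : ∀ l, ∑ c ∈ range q, u c (l+m) = 1 := by
      intro l
      simp only [hu]
      rw [Finset.sum_ite_eq, if_pos (Finset.mem_range.2 (Nat.mod_lt _ (by positivity)))]
    simp [this]
  have hcm : c ∈ range q := Finset.mem_range.2 hc
  have hq1 : (1:ℝ) ≤ q := by exact_mod_cast (by omega : 1 ≤ q)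
  have h1 := hn c hcm
  have hεq : ε / q ≤ ε := div_le_self hε.le hq1
  have h2 : ces (fun l => u c (l+m)) n < 1 / (q:ℝ) + ε := by
    rw [← Finset.add_sum_erase _ _ hcm] at hsum
    have h3 : ∑ c ∈ (range q).erase c, (1 / (q:ℝ) - ε / q) ≤ ∑ c ∈ (range q).erase c, ces (fun l => u c (l+m)) n :=
      Finset.sum_le_sum fun i hi => (hn i (Finset.mem_of_mem_erase hi)).le
    rw [Finset.sum_const, Finset.card_erase_of_mem hcm, Finset.card_range, nsmul_eq_mul, Nat.cast_pred (by omega)] at h3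
    have h4 : ((q:ℝ) - 1) * (1 / (q:ℝ) - ε / q) = 1 - 1 / q - ε + ε / q := by field_simp; ring
    have h5 : 0 < ε / q := by positivity
    linarith
  rw [Real.dist_eq, abs_lt]
  constructor <;> linarith

/-- centred digit indicator -/
noncomputable def gam (B a d : ℕ) : ℝ := (if d % B = a then (1:ℝ) else 0) - 1 / B

/-- partial sums of digit indicators -/
noncomputable def psi (B a M d : ℕ) : ℝ := ∑ s ∈ range M, gam B a (d / B^s)

lemma gam_abs (B a d : ℕ) (hB : 1 ≤ B) : |gam B a d| ≤ 1 := by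
  have h1 : (0:ℝ) < 1 / (B:ℝ) := by positivity
  have h2 : 1 / (B:ℝ) ≤ 1 := by
    rw [div_le_one (by positivity)]; exact_mod_cast hB
  unfold gam; rw [abs_le]; split_ifs <;> constructor <;> linarith

lemma psi_succ (B a M d : ℕ) : psi B a (M+1) d = gam B a d + psi B a M (d / B) := by
  unfold psi
  rw [Finset.sum_range_succ', add_comm]
  congr 1
  · simp
  · refine Finset.sum_congr rfl fun s _ => ?_
    rw [Nat.div_div_eq_div_mul, pow_succ']

lemma psi_mod (B a M d : ℕ) : psi B a M (d % B^M) = psi B a M d := by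
  unfold psi
  refine Finset.sum_congr rfl fun s hs => ?_
  rw [Finset.mem_range] at hs
  unfold gam
  congr 2
  rw [show B^M = B^s * B^(M-s) by rw [← pow_add]; congr 1; omega, Nat.mod_mul_right_div_self,
    Nat.mod_mod_of_dvd _ (dvd_pow_self B (by omega))]

lemma psi_var (B a : ℕ) (ha : a < B) (M : ℕ) : ∑ c ∈ range (B^M), (psi B a M c)^2 ≤ M * (B:ℝ)^M := by
  have hB : 1 ≤ B := by omega
  have hg : ∑ s ∈ range B, gam B a s = 0 := by
    have : ∀ s ∈ range B, gam B a s = (if s = a then (1:ℝ) else 0) - 1 / B := by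
      intro s hs; unfold gam; rw [Nat.mod_eq_of_lt (Finset.mem_range.1 hs)]
    have hB0 : (B:ℝ) ≠ 0 := by positivity
    rw [Finset.sum_congr rfl this, Finset.sum_sub_distrib, Finset.sum_ite_eq', if_pos (Finset.mem_range.2 ha)]
    simp [hB0]
  have hg2 : ∑ s ∈ range B, (gam B a s)^2 ≤ B := by
    refine (Finset.sum_le_sum (g := fun _ => (1:ℝ)) fun s _ => ?_).trans (by simp)
    exact (sq_le_one_iff_abs_le_one _).2 (gam_abs B a s hB)
  induction M with
  | zero => simp [psi]
  | succ M ih =>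
    rw [pow_succ, sum_block (fun c => (psi B a (M+1) c)^2)]
    have h1 : ∀ i ∈ range (B^M), ∑ r ∈ range B, (psi B a (M+1) (B * i + r))^2 ≤ B + B * (psi B a M i)^2 := by
      intro i _
      have h2 : ∀ r ∈ range B, (psi B a (M+1) (B * i + r))^2 = (gam B a r)^2 + (2 * psi B a M i) * gam B a r + (psi B a M i)^2 := by
        intro r hr
        have : gam B a (B * i + r) = gam B a r := by unfold gam; rw [Nat.mul_add_mod]
        rw [psi_succ, this, Nat.mul_add_div (by omega), Nat.div_eq_of_lt (Finset.mem_range.1 hr), add_zero]; ring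
      rw [Finset.sum_congr rfl h2, Finset.sum_add_distrib, Finset.sum_add_distrib, ← Finset.mul_sum, hg]
      simp only [Finset.sum_const, Finset.card_range, nsmul_eq_mul]
      linarith
    refine (Finset.sum_le_sum h1).trans ?_
    rw [Finset.sum_add_distrib, ← Finset.mul_sum]
    simp only [Finset.sum_const, Finset.card_range, nsmul_eq_mul]
    have hBp : (0:ℝ) ≤ B := by positivity
    have := mul_le_mul_of_nonneg_left ih hBp
    push_cast
    rw [pow_succ]
    linarith

lemma hypE_normal (b : ℕ) (hb : 2 ≤ b) (y : ℝ) (hy : 0 < y) (h : HypE b y) : NormalToBase b y := by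
  intro k hk
  rw [simply_iff _ y hy]
  intro a ha
  set B : ℕ := b^k with hB
  have hB1 : 1 ≤ B := Nat.one_le_pow _ _ (by omega)
  set v : ℕ → ℝ := fun i => gam B a (DD B y i) with hv
  have hv1 : ∀ i, |v i| ≤ 1 := fun i => gam_abs _ _ _ hB1
  suffices H : Tendsto (ces v) atTop (𝓝 0) by
    have := ces_add _ _ _ _ H (ces_const (1 / (B:ℝ)))
    simpa [hv, gam] using this
  refine ces_block v 1 hv1 fun ε hε => ⟨1, one_pos, ?_⟩
  obtain ⟨M, hM⟩ := exists_nat_gt (8 * k / ε^2)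
  have hkp : (0:ℝ) < k := by exact_mod_cast hk
  have hMp : (0:ℝ) < M := lt_trans (by positivity) hM
  have hMk : 8 * k < M * ε^2 := by rwa [div_lt_iff₀ (by positivity)] at hM
  have hBM : B^M = b^(k*M) := by rw [hB, pow_mul]
  -- mean square
  have h1 := hypE_shift b hb y h (k*M) (fun c => (psi B a M c)^2)
  rw [← hBM] at h1
  simp only [psi_mod] at h1
  have h2 : (∑ c ∈ range (B^M), (psi B a M c)^2) / ((B^M : ℕ):ℝ) < 2 * M := by
    rw [div_lt_iff₀ (by positivity)]
    have := psi_var B a ha M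
    have h3 : (0:ℝ) < M * (B:ℝ)^M := by positivity
    push_cast
    linarith
  have h3 := h1.eventually_lt_const h2
  have h4 : Tendsto (fun n : ℕ => n * k) atTop atTop := tendsto_id.atTop_mul_const' hk
  filter_upwards [h4.eventually h3, eventually_gt_atTop 0, eventually_ge_atTop ⌈4 * M / ε⌉₊] with n hn hn0 hnM
  have hnp : (0:ℝ) < n := by exact_mod_cast hn0
  have hnM2 : 4 * M ≤ ε * n := by
    have := (Nat.le_ceil _).trans (Nat.cast_le (α := ℝ).2 hnM)
    rw [div_le_iff₀ hε] at this; linarith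
  rw [ces, div_lt_iff₀ (by positivity), sum_block (fun l => (psi B a M (DD b y (l + k * M)))^2)] at hn
  -- the subsampled square sum
  set X : ℕ → ℝ := fun i => psi B a M (DD b y (k * i + k * M)) with hX
  have h5 : ∑ i ∈ range n, (X i)^2 ≤ 2 * M * (n * k) := by
    refine le_trans (Finset.sum_le_sum fun i _ => ?_) (by push_cast at hn; exact hn.le)
    have := Finset.single_le_sum (f := fun r => (psi B a M (DD b y (k * i + r + k * M)))^2) (s := range k)
      (fun _ _ => sq_nonneg _) (Finset.mem_range.2 hk)
    simpa [hX] using this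
  have h6 : (∑ i ∈ range n, X i)^2 ≤ n * (2 * M * (n * k)) := by
    refine (sq_sum_le_card_mul_sum_sq).trans ?_
    rw [Finset.card_range]; gcongr
  have h7 : ∀ i, X i = ∑ s ∈ range M, v (i + (M - s)) := by
    intro i
    simp only [hX, psi, hv]
    refine Finset.sum_congr rfl fun s hs => ?_
    rw [Finset.mem_range] at hs
    rw [hB, DD_pow, ← pow_mul, show k * i + k * M = k * (i + (M - s)) + k * s by
      rw [← mul_add, ← mul_add]; congr 1; omega, DD_div b hb]
  have h8 : |∑ i ∈ range n, X i - M * ∑ i ∈ range n, v i| ≤ M * (2 * M) := by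
    simp only [h7]
    rw [Finset.sum_comm]
    have : (M:ℝ) * ∑ i ∈ range n, v i = ∑ s ∈ range M, ∑ i ∈ range n, v i := by simp
    rw [this, ← Finset.sum_sub_distrib]
    refine (Finset.abs_sum_le_sum_abs _ _).trans ((Finset.sum_le_sum (g := fun _ => 2 * (M:ℝ)) fun s _ => ?_).trans (by simp))
    refine (shift_sum v 1 hv1 (M - s) n).trans ?_
    have : ((M - s : ℕ):ℝ) ≤ M := by exact_mod_cast Nat.sub_le M s
    linarith
  have h9 : |∑ i ∈ range n, X i| ≤ M * (ε / 2 * n) := by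
    refine abs_le_of_sq_le_sq (h6.trans ?_) (by positivity)
    have : n^2 * M * (8 * k) ≤ n^2 * M * (M * ε^2) := by gcongr
    nlinarith
  rw [mul_one, Nat.cast_one, mul_one]
  have h10 : M * |∑ i ∈ range n, v i| ≤ M * (ε / 2 * n + 2 * M) := by
    rw [← abs_of_pos hMp, ← abs_mul, abs_of_pos hMp]
    rw [abs_le] at h8 h9 ⊢
    constructor <;> nlinarith
  have h11 := le_of_mul_le_mul_left h10 hMp
  linarith

lemma hypE_scale (b : ℕ) (y z : ℝ) (t s : ℕ) (hts : y * (b:ℝ)^t = z * (b:ℝ)^s) (h : HypE b y) : HypE b z := by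
  intro m c hc
  have hu1 : ∀ x l, |(fun l => if DD b x l % b^m = c then (1:ℝ) else 0) l| ≤ 1 := by
    intro x l; simp only; split_ifs <;> simp
  refine (ces_shift _ 1 _ (hu1 z) s).1 ?_
  refine ((ces_shift _ 1 _ (hu1 y) t).2 (h m c hc)).congr fun n => ?_
  congr 1; ext l
  have : DD b y (l+t) = DD b z (l+s) := by
    unfold DD; congr 1
    rw [pow_add, pow_add, mul_left_comm, hts, mul_left_comm]
  rw [this]

lemma SS_scale (b : ℕ) (hb : 2 ≤ b) (α : ℝ) (hα : 0 < α) (j : ℤ) (k N : ℕ) :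
    SS k (log b) (α * (b:ℝ)^j) N = SS k (log b) α N := by
  have hlb : (log b : ℂ) ≠ 0 := by
    exact_mod_cast (Real.log_pos (by exact_mod_cast (by omega : 1 < b))).ne'
  have hb0 : (0:ℝ) < b := by positivity
  unfold SS
  refine Finset.sum_congr rfl fun n _ => ?_
  congr 2
  rw [Complex.exp_eq_exp_iff_exists_int]
  refine ⟨n * j, ?_⟩
  rw [Real.log_mul hα.ne' (by positivity), Real.log_zpow, Complex.ofReal_add, Complex.ofReal_mul, Complex.ofReal_intCast, Int.cast_mul]
  generalize (log b : ℂ) = L at hlb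
  field_simp

lemma main_iff (α : ℝ) (hα : 0 < α) (hirr : Irrational α) (b : ℕ) (hb : 2 ≤ b) :
    NormalToBase b α ↔ ∀ k : ℕ, Tendsto (fun N : ℕ => (1 / (log N : ℂ)) * SS k (log b) α N) atTop (𝓝 0) := by
  have hb1 : (1:ℝ) < b := by exact_mod_cast (by omega : 1 < b)
  have hb0 : (0:ℝ) < b := by linarith
  obtain ⟨j, hj1, hj2⟩ := exists_mem_Ico_zpow hα hb1
  have hjne : (b:ℝ)^j ≠ α := by
    intro h
    refine hirr ⟨(b:ℚ)^j, ?_⟩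
    push_cast; exact h
  set β : ℝ := α * (b:ℝ)^(-j) with hβ
  have hzp : (0:ℝ) < (b:ℝ)^j := by positivity
  have hβα : α = β * (b:ℝ)^j := by rw [hβ, mul_assoc, zpow_neg, inv_mul_cancel₀ hzp.ne', mul_one]
  have hβ1 : 1 < β := by
    rw [hβ, zpow_neg, ← div_eq_mul_inv, lt_div_iff₀ hzp, one_mul]
    exact lt_of_le_of_ne hj1 hjne
  have hβ2 : β < b := by
    rw [hβ, zpow_neg, ← div_eq_mul_inv, div_lt_iff₀ hzp]
    rwa [zpow_add_one₀ hb0.ne', mul_comm] at hj2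
  have hts : α * (b:ℝ)^(-j).toNat = β * (b:ℝ)^j.toNat := by
    rw [hβα, mul_assoc, ← zpow_natCast, ← zpow_natCast, ← zpow_add₀ hb0.ne']
    congr 2; omega
  have hSS : ∀ k N, SS k (log b) β N = SS k (log b) α N := fun k N => SS_scale b hb α hα (-j) k N
  have hβ0 : 0 < β := by linarith
  constructor
  · intro h k
    have hE := hypE_scale b α β _ _ hts (normal_hypE b hb α hα h)
    simp only [← hSS]
    rcases Nat.eq_zero_or_pos k with rfl | hk
    · exact forward_zero b hb β hβ1 hβ2 hE
    · exact forward_pos b hb β hβ1 hβ2 hE k hk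
  · intro h
    simp only [← hSS] at h
    refine hypE_normal b hb α hα (hypE_scale b β α _ _ hts.symm (back_hypE b hb β hβ0 fun K hK => ?_))
    obtain ⟨k, rfl⟩ : ∃ k, K = k + 1 := ⟨K - 1, by omega⟩
    exact back_PB b hb β hβ1 hβ2 k (by omega) (h k)

end

theorem statement1 (α : ℝ) (hα : 0 < α) (halg : IsAlgebraic ℚ α) (hirr : Irrational α)
    (b : ℕ) (hb : 2 ≤ b) :
    NormalToBase b α ↔
      ∀ k : ℕ,
        Filter.Tendsto
          (fun N : ℕ =>
            (1 / (Real.log N : ℂ)) *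
              ∑ n ∈ (Finset.Icc (-(N : ℤ)) (N : ℤ)).erase 0,
                riemannZeta (-(k : ℂ) + 2 * (Real.pi : ℂ) * Complex.I * (n : ℂ) /
                    (Real.log b : ℂ)) *
                  Complex.exp (2 * (Real.pi : ℂ) * Complex.I * (n : ℂ) * (Real.log α : ℂ) /
                    (Real.log b : ℂ)) / (n : ℂ) ^ (k + 1))
          Filter.atTop (nhds 0) := by
  exact main_iff α hα hirr b hb
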